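/- arXiv:2504.16205 — 2 statements merged into one kernel-verified Lean document; each statement's English description precedes it below -/
import Mathlib

section
/- Let m ≥ 3 and let a, b ∈ ZMod m be nonzero with 2a ≠ 0 and 2b ≠ 0. If the I-graph I(m;a,b) is connected and it is not the case that m ≡ 5 (mod 6) and I(m;a,b) is isomorphic to the generalized Petersen graph G(m,2) = I(m;1,2), then I(m;a,b) is Hamiltonian. -/
open SimpleGraph

/-- The bicirculant graph `B(m;R,S,T)` on vertex set `ZMod m ⊕ ZMod m`. -/
def bicirculant (m : ℕ) (R S T : Set (ZMod m)) : SimpleGraph (ZMod m ⊕ ZMod m) :=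
  SimpleGraph.fromRel (fun x y =>
    match x, y with
    | Sum.inl i, Sum.inl i' => ∃ j ∈ R, i' = i + j
    | Sum.inr i, Sum.inr i' => ∃ j ∈ T, i' = i + j
    | Sum.inl i, Sum.inr i' => ∃ j ∈ S, i' = i + j
    | Sum.inr _, Sum.inl _ => False)

/-- The I-graph `I(m;a,b) = B(m;{a,-a},{0},{b,-b})`. -/
def Igraph (m : ℕ) (a b : ZMod m) : SimpleGraph (ZMod m ⊕ ZMod m) :=
  bicirculant m {a, -a} {0} {b, -b}

/-- A system of cuts on a window `S` with successor maps `σ` (outer vertices) and `τ` (inner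
vertices): `cu x` removes the edge from `x` to `σ x`, `cv x` the edge from `x` to `τ x`, and
`half x` keeps the spoke at `x`. Each vertex keeps two edges, and what is kept is connected. -/
structure CutSystem {ι : Type} (S : Set ι) (σ τ : ι → ι) (half cu cv : ι → Bool) : Prop where
  locU : ∀ x ∈ S, (cu x && cu (σ x)) = false
  halfU : ∀ x ∈ S, half (σ x) = xor (cu x) (cu (σ x))
  locV : ∀ x ∈ S, (cv x && cv (τ x)) = false
  halfV : ∀ x ∈ S, half (τ x) = xor (cv x) (cv (τ x))
  conn : ∀ (α : Type) (U V : ι → α), (∀ x ∈ S, cu x = false → U x = U (σ x)) →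
    (∀ x ∈ S, cv x = false → V x = V (τ x)) → (∀ x ∈ S, half x = true → U x = V x) →
    ∃ k, ∀ x ∈ S, U x = k ∧ V x = k

/-- `I(m;a,b)` has a connected spanning 2-regular subgraph, described by cuts. -/
def Good {m : ℕ} (a b : ZMod m) : Prop :=
  ∃ half cu cv, CutSystem (Set.univ : Set (ZMod m)) (· + a) (· + b) half cu cv

theorem Good.symm {m : ℕ} {a b : ZMod m} (h : Good a b) : Good b a := by
  obtain ⟨half, cu, cv, h⟩ := h
  refine ⟨half, cv, cu, h.locV, h.halfV, h.locU, h.halfU, fun α U V hU hV hs => ?_⟩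
  obtain ⟨k, hk⟩ := h.conn α V U hV hU (fun x hx hh => (hs x hx hh).symm)
  exact ⟨k, fun x hx => (hk x hx).symm⟩

theorem Good.neg_right {m : ℕ} {a b : ZMod m} (h : Good a b) : Good a (-b) := by
  obtain ⟨half, cu, cv, h⟩ := h
  refine ⟨half, cu, fun x => cv (x - b), h.locU, h.halfU, fun x _ => ?_, fun x _ => ?_,
    fun α U V hU hV hs => h.conn α U V hU (fun x _ hx => ?_) hs⟩
  · have := h.locV (x - b - b) trivial
    simp only [sub_add_cancel] at this
    rw [← this, Bool.and_comm]
    simp [sub_eq_add_neg]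
  · have := h.halfV (x - b - b) trivial
    simp only [sub_add_cancel] at this
    simp only [← sub_eq_add_neg]
    rw [this, Bool.xor_comm]
  · have := hV (x + b) trivial (by simpa using hx)
    simpa using this.symm

theorem Good.of_neg_right {m : ℕ} {a b : ZMod m} (h : Good a (-b)) : Good a b := by
  simpa using h.neg_right

theorem Good.of_neg_left {m : ℕ} {a b : ZMod m} (h : Good (-a) b) : Good a b :=
  h.symm.of_neg_right.symm

section cutGraph

variable {m : ℕ} (a b : ZMod m) (half cu cv : ZMod m → Bool)

/-- The edges kept by a cut system. -/
def cutGraph : SimpleGraph (ZMod m ⊕ ZMod m) :=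
  SimpleGraph.fromRel (fun x y =>
    match x, y with
    | Sum.inl i, Sum.inl i' => i' = i + a ∧ cu i = false
    | Sum.inr i, Sum.inr i' => i' = i + b ∧ cv i = false
    | Sum.inl i, Sum.inr i' => i' = i ∧ half i = true
    | Sum.inr _, Sum.inl _ => False)

theorem cutGraph_le : cutGraph a b half cu cv ≤ Igraph m a b := by
  intro x y h
  rcases x with x | x <;> rcases y with y | y <;>
    simp [cutGraph, Igraph, bicirculant, SimpleGraph.fromRel_adj] at h ⊢ <;> grind

theorem ncard_neighborSet_inl (ha : a ≠ 0) (ha2 : 2 * a ≠ 0)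
    (h : CutSystem (Set.univ : Set (ZMod m)) (· + a) (· + b) half cu cv) (x : ZMod m) :
    ((cutGraph a b half cu cv).neighborSet (Sum.inl x)).ncard = 2 := by
  have h1 := h.locU (x - a) trivial
  have h2 := h.halfU (x - a) trivial
  simp only [sub_add_cancel] at h1 h2
  have hne : x - a ≠ x + a := fun h' => ha2 (by linear_combination -h')
  have e1 : x ≠ x + a := by simpa using ha
  have e2 : x - a ≠ x := by simpa using ha
  have key : (cutGraph a b half cu cv).neighborSet (Sum.inl x) =
      if cu (x - a) then {Sum.inl (x + a), Sum.inr x} else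
      if cu x then {Sum.inl (x - a), Sum.inr x} else {Sum.inl (x - a), Sum.inl (x + a)} := by
    ext y
    rcases y with y | y
    · simp only [cutGraph, mem_neighborSet, SimpleGraph.fromRel_adj]
      have : x = y + a ↔ y = x - a := by grind
      split_ifs with c1 c2 <;> simp <;> grind
    · simp only [cutGraph, mem_neighborSet, SimpleGraph.fromRel_adj]
      split_ifs with c1 c2 <;> simp_all
  rw [key]
  split_ifs
  · exact Set.ncard_pair (by simp)
  · exact Set.ncard_pair (by simp)
  · exact Set.ncard_pair (by simpa using hne)

theorem ncard_neighborSet_inr (hb : b ≠ 0) (hb2 : 2 * b ≠ 0)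
    (h : CutSystem (Set.univ : Set (ZMod m)) (· + a) (· + b) half cu cv) (x : ZMod m) :
    ((cutGraph a b half cu cv).neighborSet (Sum.inr x)).ncard = 2 := by
  have h1 := h.locV (x - b) trivial
  have h2 := h.halfV (x - b) trivial
  simp only [sub_add_cancel] at h1 h2
  have hne : x - b ≠ x + b := fun h' => hb2 (by linear_combination -h')
  have e1 : x ≠ x + b := by simpa using hb
  have e2 : x - b ≠ x := by simpa using hb
  have key : (cutGraph a b half cu cv).neighborSet (Sum.inr x) =
      if cv (x - b) then {Sum.inr (x + b), Sum.inl x} else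
      if cv x then {Sum.inr (x - b), Sum.inl x} else {Sum.inr (x - b), Sum.inr (x + b)} := by
    ext y
    rcases y with y | y
    · simp only [cutGraph, mem_neighborSet, SimpleGraph.fromRel_adj]
      split_ifs with c1 c2 <;> simp_all <;> grind
    · simp only [cutGraph, mem_neighborSet, SimpleGraph.fromRel_adj]
      have : x = y + b ↔ y = x - b := by grind
      split_ifs with c1 c2 <;> simp <;> grind
  rw [key]
  split_ifs
  · exact Set.ncard_pair (by simp)
  · exact Set.ncard_pair (by simp)
  · exact Set.ncard_pair (by simpa using hne)

end cutGraph

theorem Good.isHamiltonian {m : ℕ} [NeZero m] {a b : ZMod m} (ha : a ≠ 0) (hb : b ≠ 0)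
    (ha2 : 2 * a ≠ 0) (hb2 : 2 * b ≠ 0) (hg : Good a b) : (Igraph m a b).IsHamiltonian := by
  obtain ⟨half, cu, cv, h⟩ := hg
  refine IsHamiltonian.mono (cutGraph_le a b half cu cv) fun _ => ?_
  set H := cutGraph a b half cu cv with hH
  have hdeg : ∀ v, (H.neighborSet v).ncard = 2 := by
    rintro (x | x)
    · exact ncard_neighborSet_inl a b half cu cv ha ha2 h x
    · exact ncard_neighborSet_inr a b half cu cv hb hb2 h x
  have hcyc : H.IsCycles := fun v _ => hdeg v
  obtain ⟨k, hk⟩ := h.conn H.ConnectedComponent (fun x => H.connectedComponentMk (Sum.inl x))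
    (fun x => H.connectedComponentMk (Sum.inr x))
    (fun x _ hx => ConnectedComponent.sound (Adj.reachable (by
      simpa [hH, cutGraph, SimpleGraph.fromRel_adj, ha] using Or.inl hx)))
    (fun x _ hx => ConnectedComponent.sound (Adj.reachable (by
      simpa [hH, cutGraph, SimpleGraph.fromRel_adj, hb] using Or.inl hx)))
    (fun x _ hx => ConnectedComponent.sound (Adj.reachable (by
      simpa [hH, cutGraph, SimpleGraph.fromRel_adj] using hx)))
  have hall : ∀ v, v ∈ k.supp := by
    rintro (x | x)
    · exact (hk x trivial).1
    · exact (hk x trivial).2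
  obtain ⟨p, hp, hpk⟩ := hcyc.exists_cycle_toSubgraph_verts_eq_connectedComponentSupp
    (hall (Sum.inl 0)) (Set.nonempty_of_ncard_ne_zero (by rw [hdeg]; decide))
  have hmem : ∀ v, v ∈ p.support.tail := fun v => by
    have hv : v ∈ p.support := by
      rw [← Walk.mem_verts_toSubgraph, hpk]; exact hall v
    rw [← Walk.cons_tail_support] at hv
    rcases List.mem_cons.1 hv with rfl | hv
    · exact Walk.end_mem_tail_support hp.not_nil
    · exact hv
  refine ⟨_, p, Walk.isHamiltonianCycle_iff_isCycle_and_length_eq.2 ⟨hp, ?_⟩⟩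
  have hlen : p.support.tail.length = p.length := by simp
  rw [← hlen, ← List.toFinset_card_of_nodup hp.support_nodup, ← Finset.card_univ]
  exact congrArg _ (Finset.eq_univ_of_forall fun v => List.mem_toFinset.2 (hmem v))

theorem CutSystem.of_map {ι ι' : Type} {S : Set ι} {S' : Set ι'} {σ τ : ι → ι} {σ' τ' : ι' → ι'}
    {half cu cv : ι → Bool} (e : ι' → ι) (he : ∀ x ∈ S, ∃ y ∈ S', e y = x)
    (hS : ∀ y ∈ S', e y ∈ S)
    (hσ : ∀ y ∈ S', σ (e y) = e (σ' y)) (hτ : ∀ y ∈ S', τ (e y) = e (τ' y))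
    (h : CutSystem S' σ' τ' (half ∘ e) (cu ∘ e) (cv ∘ e)) : CutSystem S σ τ half cu cv := by
  refine ⟨fun x hx => ?_, fun x hx => ?_, fun x hx => ?_, fun x hx => ?_,
    fun α U V hU hV hs => ?_⟩
  · obtain ⟨y, hy, rfl⟩ := he x hx
    rw [hσ y hy]; exact h.locU y hy
  · obtain ⟨y, hy, rfl⟩ := he x hx
    rw [hσ y hy]; exact h.halfU y hy
  · obtain ⟨y, hy, rfl⟩ := he x hx
    rw [hτ y hy]; exact h.locV y hy
  · obtain ⟨y, hy, rfl⟩ := he x hx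
    rw [hτ y hy]; exact h.halfV y hy
  · obtain ⟨k, hk⟩ := h.conn α (U ∘ e) (V ∘ e)
      (fun y hy hc => by simpa [hσ y hy] using hU (e y) (hS y hy) hc)
      (fun y hy hc => by simpa [hτ y hy] using hV (e y) (hS y hy) hc)
      (fun y hy hc => hs (e y) (hS y hy) hc)
    refine ⟨k, fun x hx => ?_⟩
    obtain ⟨y, hy, rfl⟩ := he x hx
    exact hk y hy

theorem CutSystem.congr {ι : Type} {S : Set ι} {σ τ σ' τ' : ι → ι} {half cu cv : ι → Bool}
    (h : CutSystem S σ' τ' half cu cv) (hσ : ∀ x ∈ S, σ x = σ' x) (hτ : ∀ x ∈ S, τ x = τ' x) :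
    CutSystem S σ τ half cu cv :=
  CutSystem.of_map id (fun x hx => ⟨x, hx, rfl⟩) (fun _ hx => hx) hσ hτ h

/-- Exchanging the outer and inner vertices. -/
theorem CutSystem.swap {ι : Type} {S : Set ι} {σ τ : ι → ι} {half cu cv : ι → Bool}
    (h : CutSystem S σ τ half cu cv) : CutSystem S τ σ half cv cu := by
  refine ⟨h.locV, h.halfV, h.locU, h.halfU, fun α U V hU hV hs => ?_⟩
  obtain ⟨k, hk⟩ := h.conn α V U hV hU (fun x hx hh => (hs x hx hh).symm)
  exact ⟨k, fun x hx => (hk x hx).symm⟩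

/-- `σ x` is the first point of the window `S`, placed in `ZMod m` by `ψ`, that is met after `x`
when repeatedly adding `a`. -/
def FirstReturn {m : ℕ} {ι : Type} (S : Set ι) (ψ : ι → ZMod m) (a : ZMod m) (σ : ι → ι) : Prop :=
  ∀ x ∈ S, σ x ∈ S ∧ ∃ t : ℕ, ψ (σ x) = ψ x + (t + 1) • a ∧ ∀ s < t, ψ x + (s + 1) • a ∉ ψ '' S

namespace FirstReturn

variable {m : ℕ} {ι : Type} {S : Set ι} {ψ : ι → ZMod m} {a : ZMod m} {σ : ι → ι}

theorem injOn (hψ : Set.InjOn ψ S) (h : FirstReturn S ψ a σ) : Set.InjOn σ S := by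
  have aux : ∀ x ∈ S, ∀ y ∈ S, σ x = σ y → ∀ t t' : ℕ, ψ (σ x) = ψ x + (t + 1) • a →
      ψ (σ y) = ψ y + (t' + 1) • a → (∀ s < t', ψ y + (s + 1) • a ∉ ψ '' S) → t ≤ t' → x = y := by
    intro x hx y hy hxy t t' h1 h2 h3 htt
    obtain ⟨k, rfl⟩ := Nat.exists_eq_add_of_le htt
    have e : ψ x = ψ y + k • a := by
      have : ψ x + (t + 1) • a = ψ y + (t + k + 1) • a := by rw [← h1, ← h2, hxy]
      have h' : (t + k + 1) • a = k • a + (t + 1) • a := by rw [← add_smul]; congr 1; omega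
      rw [h', ← add_assoc] at this
      exact add_right_cancel this
    rcases k with _ | k
    · exact hψ hx hy (by simpa using e)
    · exact absurd ⟨x, hx, e⟩ (h3 k (by omega))
  intro x hx y hy hxy
  obtain ⟨_, t, h1, h2⟩ := h x hx
  obtain ⟨_, t', h1', h2'⟩ := h y hy
  rcases le_total t t' with h3 | h3
  · exact aux x hx y hy hxy t t' h1 h1' h2' h3
  · exact (aux y hy x hx hxy.symm t' t h1' h1 h2 h3).symm

theorem eq_of_add (hψ : Set.InjOn ψ S) (h : FirstReturn S ψ a σ) {x y : ι} (hx : x ∈ S)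
    (hy : y ∈ S) (hxy : ψ y = ψ x + a) : σ x = y := by
  obtain ⟨hσ, t, h1, h2⟩ := h x hx
  rcases t with _ | t
  · exact hψ hσ hy (by simpa [hxy] using h1)
  · exact absurd ⟨y, hy, by simpa using hxy⟩ (h2 0 (by omega))

theorem surjOn (hψ : Set.InjOn ψ S) (hS : S.Finite) (h : FirstReturn S ψ a σ) :
    ∀ y ∈ S, ∃ x ∈ S, σ x = y := by
  intro y hy
  have hsub : σ '' S ⊆ S := by rintro _ ⟨x, hx, rfl⟩; exact (h x hx).1
  rw [← Set.eq_of_subset_of_ncard_le hsub (h.injOn hψ).ncard_image.ge hS] at hy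
  exact hy

theorem exists_of_finite [NeZero m] (S : Set ι) (ψ : ι → ZMod m) (a : ZMod m) :
    ∃ σ, FirstReturn S ψ a σ := by
  classical
  have key : ∀ x, ∃ y, x ∈ S → y ∈ S ∧ ∃ t : ℕ, ψ y = ψ x + (t + 1) • a ∧
      ∀ s < t, ψ x + (s + 1) • a ∉ ψ '' S := by
    intro x
    by_cases hx : x ∈ S
    · have hex : ∃ t : ℕ, ψ x + (t + 1) • a ∈ ψ '' S := by
        refine ⟨m - 1, x, hx, ?_⟩
        rw [Nat.sub_add_cancel (NeZero.one_le)]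
        simp
      obtain ⟨y, hy, hyx⟩ := Nat.find_spec hex
      exact ⟨y, fun _ => ⟨hy, Nat.find hex, hyx, fun s hs => Nat.find_min hex hs⟩⟩
    · exact ⟨x, fun h => absurd h hx⟩
  choose σ hσ using key
  exact ⟨σ, hσ⟩

/-- A property preserved by the first return map propagates along `a`-orbits. -/
theorem orbit (hψ : Set.InjOn ψ S) (h : FirstReturn S ψ a σ) {P : ι → Prop}
    (hP : ∀ x ∈ S, P x → P (σ x)) (t : ℕ) :
    ∀ x ∈ S, P x → ∀ y ∈ S, ψ y = ψ x + t • a → P y := by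
  induction t using Nat.strong_induction_on with
  | _ t ih =>
    intro x hx hPx y hy hxy
    rcases t with _ | t
    · rwa [hψ hy hx (by simpa using hxy)]
    obtain ⟨hσ, s, h1, h2⟩ := h x hx
    rcases lt_or_ge t s with hs | hs
    · exact absurd ⟨y, hy, hxy⟩ (h2 t hs)
    · refine ih (t - s) (by omega) (σ x) hσ (hP x hx hPx) y hy ?_
      rw [h1, hxy, add_assoc, ← add_smul]
      congr 2; omega

end FirstReturn

/-- A cut system on a window meeting every orbit extends to `ZMod m`. -/
theorem CutSystem.good {m : ℕ} {ι : Type} {S : Set ι} {ψ : ι → ZMod m} {a b : ZMod m}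
    {σ τ : ι → ι} {half cu cv : ι → Bool} (h : CutSystem S σ τ half cu cv) (hS : S.Finite)
    (hψ : Set.InjOn ψ S) (hσ : FirstReturn S ψ a σ) (hτ : FirstReturn S ψ b τ)
    (hita : ∀ z, ∃ x ∈ S, ∃ t : ℕ, z = ψ x + t • a) (hitb : ∀ z, ∃ x ∈ S, ∃ t : ℕ, z = ψ x + t • b)
    (hcu : ∀ x ∈ S, cu x = true → ψ (σ x) = ψ x + a)
    (hcv : ∀ x ∈ S, cv x = true → ψ (τ x) = ψ x + b) : Good a b := by
  classical
  let ext (f : ι → Bool) (z : ZMod m) : Bool := decide (∃ x ∈ S, ψ x = z ∧ f x = true)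
  have ext_ψ : ∀ f x, x ∈ S → ext f (ψ x) = f x := by
    intro f x hx
    have : (∃ y ∈ S, ψ y = ψ x ∧ f y = true) ↔ f x = true :=
      ⟨fun ⟨y, hy, h1, h2⟩ => hψ hy hx h1 ▸ h2, fun h => ⟨x, hx, rfl, h⟩⟩
    simp [ext, this]
  have ext_not : ∀ f z, z ∉ ψ '' S → ext f z = false := by
    intro f z hz
    simp only [ext, decide_eq_false_iff_not]
    rintro ⟨x, hx, h1, -⟩
    exact hz ⟨x, hx, h1⟩
  have loc : ∀ (a : ZMod m) (σ : ι → ι) (cu : ι → Bool), FirstReturn S ψ a σ →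
      (∀ x ∈ S, cu x = true → ψ (σ x) = ψ x + a) → (∀ x ∈ S, (cu x && cu (σ x)) = false) →
      ∀ z, (ext cu z && ext cu (z + a)) = false := by
    intro a σ cu hσ hcu hl z
    by_cases hz : z ∈ ψ '' S
    · obtain ⟨x, hx, rfl⟩ := hz
      cases hc : cu x with
      | false => simp [ext_ψ _ _ hx, hc]
      | true =>
        rw [← hcu x hx hc, ext_ψ _ _ hx, ext_ψ _ _ (hσ x hx).1]
        exact hl x hx
    · simp [ext_not _ _ hz]
  have hlf : ∀ (a : ZMod m) (σ : ι → ι) (cu : ι → Bool), FirstReturn S ψ a σ →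
      (∀ x ∈ S, cu x = true → ψ (σ x) = ψ x + a) → (∀ x ∈ S, half (σ x) = xor (cu x) (cu (σ x))) →
      ∀ z, ext half (z + a) = xor (ext cu z) (ext cu (z + a)) := by
    intro a σ cu hσ hcu hl z
    by_cases hz : z + a ∈ ψ '' S
    · obtain ⟨y, hy, hyz⟩ := hz
      obtain ⟨x, hx, rfl⟩ := hσ.surjOn hψ hS y hy
      rw [← hyz, ext_ψ _ _ hy, ext_ψ _ _ hy, hl x hx]
      congr 1
      cases hc : cu x with
      | true =>
        have := hcu x hx hc
        have : z = ψ x := by rw [hyz] at this; exact add_right_cancel this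
        rw [this, ext_ψ _ _ hx, hc]
      | false =>
        by_contra hne
        have h1 : ext cu z = true := by
          cases h' : ext cu z with
          | true => rfl
          | false => exact absurd h'.symm hne
        obtain ⟨x', hx', rfl, hcx'⟩ := of_decide_eq_true h1
        have e : σ x' = σ x := hψ (hσ x' hx').1 hy (by rw [hcu x' hx' hcx', hyz])
        have := hσ.injOn hψ hx' hx e
        rw [this, hc] at hcx'
        exact Bool.noConfusion hcx'
    · rw [ext_not _ _ hz, ext_not _ _ hz, Bool.xor_false]
      by_contra hne
      have h1 : ext cu z = true := by
        cases h' : ext cu z with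
        | true => rfl
        | false => exact absurd h'.symm hne
      obtain ⟨x', hx', rfl, hcx'⟩ := of_decide_eq_true h1
      exact hz ⟨σ x', (hσ x' hx').1, hcu x' hx' hcx'⟩
  have spread : ∀ (a : ZMod m) (σ : ι → ι) (cu : ι → Bool), FirstReturn S ψ a σ →
      ∀ (α : Type) (U : ZMod m → α), (∀ z, ext cu z = false → U z = U (z + a)) →
      ∀ x ∈ S, cu x = false → U (ψ x) = U (ψ (σ x)) := by
    intro a σ cu hσ α U hU x hx hc
    obtain ⟨-, t, h1, h2⟩ := hσ x hx
    have key : ∀ s ≤ t + 1, U (ψ x) = U (ψ x + s • a) := by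
      intro s
      induction s with
      | zero => simp
      | succ s ih =>
        intro hs
        rw [ih (by omega), succ_nsmul, ← add_assoc]
        apply hU
        rcases s with _ | s
        · simpa [ext_ψ _ _ hx] using hc
        · exact ext_not _ _ (h2 s (by omega))
    rw [h1]; exact key _ le_rfl
  have fill : ∀ (a : ZMod m) (σ : ι → ι) (cu : ι → Bool), FirstReturn S ψ a σ →
      (∀ x ∈ S, cu x = true → ψ (σ x) = ψ x + a) →
      ∀ (α : Type) (U : ZMod m → α) (k : α), (∀ z, ext cu z = false → U z = U (z + a)) →
      (∀ x ∈ S, U (ψ x) = k) → ∀ x ∈ S, ∀ t : ℕ, U (ψ x + t • a) = k := by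
    intro a σ cu hσ hcu α U k hU hk x hx t
    induction t with
    | zero => simpa using hk x hx
    | succ t ih =>
      rw [succ_nsmul, ← add_assoc]
      by_cases hw : ψ x + t • a ∈ ψ '' S
      · obtain ⟨y, hy, hyw⟩ := hw
        rw [← hyw] at ih ⊢
        cases hc : cu y with
        | true => rw [← hcu y hy hc]; exact hk _ (hσ y hy).1
        | false => rw [← hU _ (by rw [ext_ψ _ _ hy, hc])]; exact ih
      · rw [← hU _ (ext_not _ _ hw)]; exact ih
  refine ⟨ext half, ext cu, ext cv, fun z _ => loc a σ cu hσ hcu h.locU z,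
    fun z _ => hlf a σ cu hσ hcu h.halfU z, fun z _ => loc b τ cv hτ hcv h.locV z,
    fun z _ => hlf b τ cv hτ hcv h.halfV z, fun α U V hU hV hs => ?_⟩
  obtain ⟨k, hk⟩ := h.conn α (U ∘ ψ) (V ∘ ψ)
    (fun x hx hc => spread a σ cu hσ α U (fun z => hU z trivial) x hx hc)
    (fun x hx hc => spread b τ cv hτ α V (fun z => hV z trivial) x hx hc)
    (fun x hx hc => hs (ψ x) trivial (by rw [ext_ψ _ _ hx, hc]))
  refine ⟨k, fun z _ => ⟨?_, ?_⟩⟩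
  · obtain ⟨x, hx, t, rfl⟩ := hita z
    exact fill a σ cu hσ hcu α U k (fun z => hU z trivial) (fun x hx => (hk x hx).1) x hx t
  · obtain ⟨x, hx, t, rfl⟩ := hitb z
    exact fill b τ cv hτ hcv α V k (fun z => hV z trivial) (fun x hx => (hk x hx).2) x hx t

/-- One round of propagating a set of vertices, encoded as a bit mask, along a list of edges. -/
def spreadMask (E : List (ℕ × ℕ)) (mask : ℕ) : ℕ :=
  E.foldl (fun k e => if k.testBit e.1 || k.testBit e.2 then k ||| (1 <<< e.1) ||| (1 <<< e.2)
    else k) mask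

/-- At most `n` rounds of propagation from `mask` reach all of `full`. -/
def reachesMask (E : List (ℕ × ℕ)) (full : ℕ) : ℕ → ℕ → Bool
  | 0, mask => mask == full
  | n + 1, mask => mask == full || reachesMask E full n (spreadMask E mask)

theorem spreadMask_sound {α : Type} (col : ℕ → α) (k : α) (E : List (ℕ × ℕ))
    (hE : ∀ e ∈ E, col e.1 = col e.2) (mask : ℕ) (hm : ∀ v, mask.testBit v = true → col v = k) :
    ∀ v, (spreadMask E mask).testBit v = true → col v = k := by
  induction E generalizing mask with
  | nil => exact hm
  | cons e E ih =>
    refine ih (fun e' he' => hE e' (List.mem_cons_of_mem _ he')) _ ?_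
    have he := hE e List.mem_cons_self
    beta_reduce
    split_ifs with hc
    · have h1 : col e.1 = k := by
        rcases Bool.or_eq_true_iff.1 hc with h | h
        · exact hm _ h
        · exact he.trans (hm _ h)
      intro v hv
      simp only [Nat.testBit_or, Nat.one_shiftLeft, Nat.testBit_two_pow, Bool.or_eq_true,
        decide_eq_true_eq] at hv
      rcases hv with (hv | rfl) | rfl
      · exact hm v hv
      · exact h1
      · exact he ▸ h1
    · exact hm

theorem reachesMask_sound {α : Type} (col : ℕ → α) (k : α) (E : List (ℕ × ℕ))
    (hE : ∀ e ∈ E, col e.1 = col e.2) (full n mask : ℕ)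
    (hm : ∀ v, mask.testBit v = true → col v = k) (h : reachesMask E full n mask = true) :
    ∀ v, full.testBit v = true → col v = k := by
  induction n generalizing mask with
  | zero =>
    have : mask = full := by simpa [reachesMask] using h
    exact this ▸ hm
  | succ n ih =>
    rcases Bool.or_eq_true_iff.1 h with h | h
    · have : mask = full := by simpa using h
      exact this ▸ hm
    · exact ih _ (spreadMask_sound col k E hE mask hm) h

/-- The spokes kept by the outer cuts `H`. -/
def halfOf (σ : ℕ → ℕ) (H : List ℕ) (x : ℕ) : Bool :=
  xor (H.contains x) (H.any fun y => σ y == x)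

/-- The edges kept by the cuts `H`, `V` at a given place; outer vertices are even, inner
ones odd. -/
def keptEdges (σ τ : ℕ → ℕ) (H V : List ℕ) (x : ℕ) : List (ℕ × ℕ) :=
  (if H.contains x then [] else [(2 * x, 2 * σ x)]) ++
  (if V.contains x then [] else [(2 * x + 1, 2 * τ x + 1)]) ++
  (if halfOf σ H x then [(2 * x, 2 * x + 1)] else [])

/-- Checks that lists of cuts on the window `{0, …, w - 1}` are a cut system. -/
def checkCuts (w : ℕ) (σ τ : ℕ → ℕ) (H V : List ℕ) : Bool :=
  ((List.range w).all fun x =>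
    !(H.contains x && H.contains (σ x)) && !(V.contains x && V.contains (τ x)) &&
    (halfOf σ H (σ x) == xor (H.contains x) (H.contains (σ x))) &&
    (halfOf σ H (τ x) == xor (V.contains x) (V.contains (τ x)))) &&
  reachesMask ((List.range w).flatMap (keptEdges σ τ H V)) (2 ^ (2 * w) - 1) w 1

theorem CutSystem.of_check {w : ℕ} {σ τ : ℕ → ℕ} {H V : List ℕ}
    (h : checkCuts w σ τ H V = true) :
    CutSystem {x | x < w} σ τ (halfOf σ H) (fun x => H.contains x) (fun x => V.contains x) := by
  obtain ⟨h1, h2⟩ := Bool.and_eq_true_iff.1 h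
  simp only [List.all_eq_true, List.mem_range, Bool.and_eq_true, Bool.not_eq_true',
    beq_iff_eq] at h1
  refine ⟨fun x hx => (h1 x hx).1.1.1, fun x hx => (h1 x hx).1.2, fun x hx => (h1 x hx).1.1.2,
    fun x hx => (h1 x hx).2, fun α U V' hU hV hs => ⟨U 0, ?_⟩⟩
  let col (v : ℕ) : α := if v % 2 = 0 then U (v / 2) else V' (v / 2)
  have c0 : ∀ x, col (2 * x) = U x := fun x => by simp [col]
  have c1 : ∀ x, col (2 * x + 1) = V' x := fun x => by
    have : (2 * x + 1) / 2 = x := by omega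
    simp [col, this, Nat.add_mod]
  have hE : ∀ e ∈ (List.range w).flatMap (keptEdges σ τ H V), col e.1 = col e.2 := by
    intro e he
    obtain ⟨x, hx, he⟩ := List.mem_flatMap.1 he
    have hx : x < w := List.mem_range.1 hx
    simp only [keptEdges, List.mem_append] at he
    rcases he with (he | he) | he <;> split_ifs at he with hc
    · simp at he
    · rw [List.mem_singleton.1 he, c0, c0]; exact hU x hx (by simpa using hc)
    · simp at he
    · rw [List.mem_singleton.1 he, c1, c1]; exact hV x hx (by simpa using hc)
    · rw [List.mem_singleton.1 he, c0, c1]; exact hs x hx (by simpa using hc)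
    · simp at he
  have key := reachesMask_sound col (U 0) _ hE _ _ 1 (fun v hv => by
    have : v = 0 := by
      by_contra hv0
      simp [Nat.testBit_one_eq_true_iff_self_eq_zero] at hv
      exact hv0 hv
    simp [this, col]) h2
  intro x (hx : x < w)
  constructor
  · rw [← c0]; refine key _ ?_
    rw [Nat.testBit_two_pow_sub_one]; simp; omega
  · rw [← c1]; refine key _ ?_
    rw [Nat.testBit_two_pow_sub_one]; simp; omega

/-- The first return map for a shift by `p` on the interval `{0, …, L - 1}` in `ZMod n`. -/
def intervalStep (n L p x : ℕ) : ℕ :=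
  if x + p < L then x + p else (x + (p - n % p)) % p

theorem intervalStep_mod (n L p : ℕ) : intervalStep (n % p) L p = intervalStep n L p := by
  funext x; simp [intervalStep]

section generator

variable {m : ℕ} {c : ZMod m}

theorem nsmul_eq_iff_mod (hc : addOrderOf c = m) (x y : ℕ) : x • c = y • c ↔ x % m = y % m := by
  rw [nsmul_inj_mod, hc]

theorem injOn_nsmul (hc : addOrderOf c = m) {L : ℕ} (hL : L ≤ m) :
    Set.InjOn (fun x : ℕ => x • c) {x | x < L} := by
  intro x (hx : x < L) y (hy : y < L) hxy
  have := (nsmul_eq_iff_mod hc _ _).1 hxy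
  rwa [Nat.mod_eq_of_lt (by omega), Nat.mod_eq_of_lt (by omega)] at this

theorem firstReturn_interval (hc : addOrderOf c = m) {L p : ℕ} (hL : L ≤ m) (hp : 0 < p)
    (hpL : p ≤ L) :
    FirstReturn {x | x < L} (fun x : ℕ => x • c) (p • c) (intervalStep m L p) := by
  intro x (hx : x < L)
  unfold intervalStep
  split_ifs with h
  · exact ⟨h, 0, by simp [add_smul], by simp⟩
  · have hlt := Nat.mod_lt (x + (p - m % p)) hp
    refine ⟨lt_of_lt_of_le hlt hpL, (m - x - 1) / p, ?_, fun s hs => ?_⟩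
    · have h1 := Nat.div_add_mod (m - x - 1) p
      have h2 := Nat.mod_lt (m - x - 1) hp
      have h3 := Nat.div_add_mod m p
      have h4 := Nat.mod_lt m hp
      set k := (m - x - 1) / p
      have e : (x + (p - m % p)) % p + m = x + (k + 1) * p := by
        have h5 : x + (k + 1) * p - m < p ∧ m ≤ x + (k + 1) * p := by
          have : (k + 1) * p = p * k + p := by ring
          omega
        have h6 : (x + (p - m % p)) % p = x + (k + 1) * p - m := by
          have : x + (p - m % p) + p * k = x + (k + 1) * p - m + p * (m / p) := by
            have : (k + 1) * p = p * k + p := by ring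
            omega
          rw [← Nat.mod_eq_of_lt h5.1, ← Nat.add_mul_mod_self_left _ p k, this,
            Nat.add_mul_mod_self_left]
        omega
      beta_reduce
      rw [smul_smul, ← add_smul, ← e, add_smul]
      simp
    · rintro ⟨y, hy : y < L, hy2⟩
      beta_reduce at hy2
      rw [smul_smul, ← add_smul] at hy2
      have := (nsmul_eq_iff_mod hc _ _).1 hy2
      have h1 := Nat.div_mul_le_self (m - x - 1) p
      have h3 : (s + 1) * p ≤ (m - x - 1) / p * p := Nat.mul_le_mul_right p (by omega)
      have h4 : p ≤ (s + 1) * p := Nat.le_mul_of_pos_left p (by omega)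
      rw [Nat.mod_eq_of_lt (by omega), Nat.mod_eq_of_lt (by omega)] at this
      omega

variable [NeZero m]

theorem exists_nsmul_eq (hc : addOrderOf c = m) (z : ZMod m) : ∃ r < m, z = r • c := by
  have hinj : Function.Injective (fun x : ZMod m => x.val • c) := by
    intro x y hxy
    have := (nsmul_eq_iff_mod hc _ _).1 hxy
    rw [Nat.mod_eq_of_lt x.val_lt, Nat.mod_eq_of_lt y.val_lt] at this
    exact ZMod.val_injective m this
  obtain ⟨x, hx⟩ := (Finite.injective_iff_surjective.1 hinj) z
  exact ⟨x.val, x.val_lt, hx.symm⟩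

theorem exists_interval_hit (hc : addOrderOf c = m) {L p : ℕ} (hp : 0 < p) (hpL : p ≤ L)
    (z : ZMod m) : ∃ x ∈ {x : ℕ | x < L}, ∃ t : ℕ, z = x • c + t • (p • c) := by
  obtain ⟨r, -, rfl⟩ := exists_nsmul_eq hc z
  refine ⟨r % p, lt_of_lt_of_le (Nat.mod_lt r hp) hpL, r / p, ?_⟩
  rw [smul_smul, ← add_smul, Nat.mod_add_div']

theorem CutSystem.good_interval (hc : addOrderOf c = m) {L p q : ℕ} {half cu cv : ℕ → Bool}
    (hL : L ≤ m) (hp : 0 < p) (hpL : p ≤ L) (hq : 0 < q) (hqL : q ≤ L)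
    (h : CutSystem {x | x < L} (intervalStep m L p) (intervalStep m L q) half cu cv)
    (hcu : ∀ x < L, cu x = true → x + p < L ∨ intervalStep m L p x + m = x + p)
    (hcv : ∀ x < L, cv x = true → x + q < L ∨ intervalStep m L q x + m = x + q) :
    Good (p • c) (q • c) := by
  have aux : ∀ p x, x + p < L ∨ intervalStep m L p x + m = x + p →
      (intervalStep m L p x) • c = x • c + p • c := by
    intro p x hx
    rw [← add_smul]
    rcases hx with hx | hx
    · simp [intervalStep, hx]
    · rw [← hx, add_smul]
      simp
  exact h.good (Set.finite_lt_nat L) (injOn_nsmul hc hL) (firstReturn_interval hc hL hp hpL)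
    (firstReturn_interval hc hL hq hqL) (exists_interval_hit hc hp hpL)
    (exists_interval_hit hc hq hqL) (fun x hx h => aux p x (hcu x hx h))
    (fun x hx h => aux q x (hcv x hx h))

/-- A cut system on an interval, with no cut leaving it, that depends on `m` only modulo the
steps. -/
theorem good_of_interval_check (hc : addOrderOf c = m) (L p q r s : ℕ) (H V : List ℕ)
    (hL : L ≤ m) (hr : r = m % p) (hs : s = m % q)
    (h : checkCuts L (intervalStep r L p) (intervalStep s L q) H V = true)
    (hpq : (decide (0 < p ∧ p ≤ L ∧ 0 < q ∧ q ≤ L) && H.all (· + p < L) && V.all (· + q < L)) =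
      true) : Good (p • c) (q • c) := by
  subst hr hs
  rw [intervalStep_mod, intervalStep_mod] at h
  simp only [Bool.and_eq_true, decide_eq_true_eq, List.all_eq_true] at hpq
  obtain ⟨⟨⟨hp, hpL, hq, hqL⟩, hH⟩, hV⟩ := hpq
  exact (CutSystem.of_check h).good_interval hc hL hp hpL hq hqL
    (fun x _ hx => Or.inl (hH x (by simpa using hx)))
    (fun x _ hx => Or.inl (hV x (by simpa using hx)))

/-- A cut system on all of `ZMod m`. -/
theorem good_of_cyclic_check (hc : addOrderOf c = m) (n p q : ℕ) (H V : List ℕ) (hn : m = n)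
    (h : checkCuts n (intervalStep n n p) (intervalStep n n q) H V = true)
    (hpq : (decide (0 < p ∧ p ≤ n ∧ 0 < q ∧ q ≤ n) &&
      H.all (fun x => x + p < n || intervalStep n n p x + n == x + p) &&
      V.all (fun x => x + q < n || intervalStep n n q x + n == x + q)) =
      true) : Good (p • c) (q • c) := by
  subst hn
  simp only [Bool.and_eq_true, decide_eq_true_eq, List.all_eq_true, Bool.or_eq_true,
    beq_iff_eq] at hpq
  obtain ⟨⟨⟨hp, hpL, hq, hqL⟩, hH⟩, hV⟩ := hpq
  exact (CutSystem.of_check h).good_interval hc le_rfl hp hpL hq hqL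
    (fun x _ hx => hH x (by simpa using hx)) (fun x _ hx => hV x (by simpa using hx))

theorem good_one_one (hc : addOrderOf c = m) (hm : 2 ≤ m) : Good (1 • c) (1 • c) :=
  good_of_interval_check hc 2 1 1 0 0 [0] [0] hm (Nat.mod_one m).symm (Nat.mod_one m).symm
    (by decide +kernel) (by decide +kernel)

theorem good_one_three (hc : addOrderOf c = m) (hm : 6 ≤ m) : Good (1 • c) (3 • c) := by
  have h1 : 0 = m % 1 := (Nat.mod_one m).symm
  have h3 : m % 3 = 0 ∨ m % 3 = 1 ∨ m % 3 = 2 := by omega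
  rcases h3 with h | h | h
  · exact good_of_interval_check hc 6 1 3 0 0 [0, 2, 4] [0, 1, 2] hm h1 h.symm
      (by decide +kernel) (by decide +kernel)
  · exact good_of_interval_check hc 6 1 3 0 1 [0, 2, 4] [0, 1, 2] hm h1 h.symm
      (by decide +kernel) (by decide +kernel)
  · by_cases h8 : m = 8
    · exact good_of_cyclic_check hc 8 1 3 [2, 6] [3, 7] h8 (by decide +kernel) (by decide +kernel)
    · exact good_of_interval_check hc 11 1 3 0 2 [0, 3, 5, 7, 9] [0, 1, 5, 6, 7] (by omega) h1
        h.symm (by decide +kernel) (by decide +kernel)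

theorem good_two_three (hc : addOrderOf c = m) (hm : 7 ≤ m) : Good (2 • c) (3 • c) := by
  by_cases h7 : m = 7
  · exact good_of_cyclic_check hc 7 2 3 [2, 5, 6] [4, 5, 6] h7
      (by decide +kernel) (by decide +kernel)
  by_cases h8 : m = 8
  · exact good_of_cyclic_check hc 8 2 3 [4, 7] [4, 6] h8 (by decide +kernel) (by decide +kernel)
  by_cases h9 : m = 9
  · exact good_of_cyclic_check hc 9 2 3 [2, 6, 7] [4, 6, 8] h9
      (by decide +kernel) (by decide +kernel)
  by_cases h11 : m = 11
  · exact good_of_cyclic_check hc 11 2 3 [2, 3, 6, 7, 10] [3, 4, 5, 9, 10] h11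
      (by decide +kernel) (by decide +kernel)
  by_cases h12 : m = 12
  · exact good_of_cyclic_check hc 12 2 3 [2, 3, 6, 7, 10, 11] [3, 4, 5, 9, 10, 11] h12
      (by decide +kernel) (by decide +kernel)
  by_cases h13 : m = 13
  · exact good_of_cyclic_check hc 13 2 3 [2, 6, 7, 10, 11] [4, 6, 8, 10, 12] h13
      (by decide +kernel) (by decide +kernel)
  by_cases h15 : m = 15
  · exact good_of_cyclic_check hc 15 2 3 [2, 7, 12] [4, 9, 14] h15
      (by decide +kernel) (by decide +kernel)
  have h6 : m % 6 = 0 ∨ m % 6 = 1 ∨ m % 6 = 2 ∨ m % 6 = 3 ∨ m % 6 = 4 ∨ m % 6 = 5 := by omega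
  rcases h6 with h | h | h | h | h | h
  · exact good_of_interval_check hc 14 2 3 0 0 [0, 3, 4, 7, 8, 11] [0, 2, 4, 6, 8, 10] (by omega)
      (by omega) (by omega) (by decide +kernel) (by decide +kernel)
  · exact good_of_interval_check hc 16 2 3 1 1 [0, 3, 6, 9, 10, 13] [0, 2, 6, 8, 10, 12]
      (by omega) (by omega) (by omega) (by decide +kernel) (by decide +kernel)
  · exact good_of_interval_check hc 6 2 3 0 2 [0, 3] [0, 2] (by omega)
      (by omega) (by omega) (by decide +kernel) (by decide +kernel)
  · exact good_of_interval_check hc 18 2 3 1 0 [0, 3, 8, 11, 12, 15] [0, 2, 8, 10, 12, 14]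
      (by omega) (by omega) (by omega) (by decide +kernel) (by decide +kernel)
  · exact good_of_interval_check hc 6 2 3 0 1 [0, 3] [0, 2] (by omega)
      (by omega) (by omega) (by decide +kernel) (by decide +kernel)
  · exact good_of_interval_check hc 16 2 3 1 2 [0, 3, 6, 9, 10, 13] [0, 2, 6, 8, 10, 12]
      (by omega) (by omega) (by omega) (by decide +kernel) (by decide +kernel)

theorem good_one_four_fifteen {c : ZMod 15} (hc : addOrderOf c = 15) : Good (1 • c) (4 • c) :=
  good_of_cyclic_check hc 15 1 4 [1, 5, 7, 9, 11, 13] [1, 2, 7, 8, 9, 10] rfl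
    (by decide +kernel) (by decide +kernel)

theorem good_one_four_seventeen {c : ZMod 17} (hc : addOrderOf c = 17) : Good (1 • c) (4 • c) :=
  good_of_cyclic_check hc 17 1 4 [2, 4, 7, 9, 12, 14, 16] [3, 4, 5, 10, 12, 13, 15] rfl
    (by decide +kernel) (by decide +kernel)

theorem good_one_four_nineteen {c : ZMod 19} (hc : addOrderOf c = 19) : Good (1 • c) (4 • c) :=
  good_of_cyclic_check hc 19 1 4 [5, 9, 11, 13, 15, 17] [5, 6, 11, 12, 13, 14] rfl
    (by decide +kernel) (by decide +kernel)

theorem good_one_seven_twentyfive {c : ZMod 25} (hc : addOrderOf c = 25) :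
    Good (1 • c) (7 • c) :=
  good_of_cyclic_check hc 25 1 7 [11, 14, 16, 18, 21, 23] [11, 12, 14, 15, 16, 17] rfl
    (by decide +kernel) (by decide +kernel)

end generator

theorem decide_eq_xor {p q r : Prop} [Decidable p] [Decidable q] [Decidable r] :
    decide p = xor (decide q) (decide r) ↔ (p ↔ ¬(q ↔ r)) := by
  by_cases p <;> by_cases q <;> by_cases r <;> simp [*]

theorem intervalStep_self_one {n x : ℕ} (hx : x < n) :
    intervalStep n n 1 x = if x + 1 < n then x + 1 else x + 1 - n := by
  unfold intervalStep
  split_ifs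
  · rfl
  · omega

theorem intervalStep_self_two {n x : ℕ} (hn : n % 2 = 1) (hx : x < n) :
    intervalStep n n 2 x = if x + 2 < n then x + 2 else x + 2 - n := by
  unfold intervalStep
  split_ifs
  · rfl
  · omega

/-- Two interleaved colorings that cross over at each step depend only on the parity. -/
theorem eq_of_crossing {α : Type} {f g : ℕ → α} {j : ℕ} (h1 : ∀ i, i + 1 < j → f i = g (i + 1))
    (h2 : ∀ i, i + 1 < j → g i = f (i + 1)) (i : ℕ) (hi : i < j) :
    (i % 2 = 0 → f i = f 0 ∧ g i = g 0) ∧ (i % 2 = 1 → f i = g 0 ∧ g i = f 0) := by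
  induction i with
  | zero => simp
  | succ i ih =>
    have := ih (by omega)
    rw [← h1 i hi, ← h2 i hi]
    refine ⟨fun h => ?_, fun h => ?_⟩
    · exact (this.2 (by omega)).symm
    · exact (this.1 (by omega)).symm

theorem cutSystem_one_two_of_mod_three {n j : ℕ} (hn : n = 3 * j) (hj : j % 2 = 1) :
    CutSystem {x | x < n} (fun x => if x + 1 < n then x + 1 else x + 1 - n)
      (fun x => if x + 2 < n then x + 2 else x + 2 - n) (fun x => decide (x % 3 ≠ 2))
      (fun x => decide (x % 3 = 0)) (fun x => decide (x % 3 = 1)) := by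
  refine ⟨fun x (hx : x < n) => ?_, fun x (hx : x < n) => ?_, fun x (hx : x < n) => ?_,
    fun x (hx : x < n) => ?_, fun α U V hU hV hs => ⟨U 1, ?_⟩⟩
  · rw [← Bool.not_eq_true]; simp; split_ifs <;> omega
  · rw [Bool.eq_iff_iff]; simp; split_ifs <;> omega
  · rw [← Bool.not_eq_true]; simp; split_ifs <;> omega
  · rw [Bool.eq_iff_iff]; simp; split_ifs <;> omega
  have hU1 : ∀ x, x + 1 < n → x % 3 ≠ 0 → U x = U (x + 1) := fun x hx hc => by
    have := hU x (show x < n by omega) (by simpa using hc)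
    simpa [hx] using this
  have hV1 : ∀ x, x + 2 < n → x % 3 ≠ 1 → V x = V (x + 2) := fun x hx hc => by
    have := hV x (show x < n by omega) (by simpa using hc)
    simpa [hx] using this
  have hUn : U (3 * (j - 1) + 2) = U 0 := by
    have := hU (3 * (j - 1) + 2) (show _ < n by omega) (by simp)
    rw [if_neg (by omega)] at this
    rw [this]; congr 1; omega
  have hVn : V (3 * (j - 1) + 2) = V 1 := by
    have := hV (3 * (j - 1) + 2) (show _ < n by omega) (by simp)
    rw [if_neg (by omega)] at this
    rw [this]; congr 1; omega
  have hsp : ∀ x, x < n → x % 3 ≠ 2 → U x = V x := fun x hx hc => hs x hx (by simpa using hc)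
  have f1 : ∀ i, i < j → U (3 * i + 1) = U (3 * i + 2) := fun i hi => hU1 _ (by omega) (by omega)
  have f2 : ∀ i, i + 1 < j → U (3 * i + 2) = U (3 * (i + 1)) :=
    fun i hi => hU1 _ (by omega) (by omega)
  have g1 : ∀ i, i < j → V (3 * i) = V (3 * i + 2) := fun i hi => hV1 _ (by omega) (by omega)
  have g2 : ∀ i, i + 1 < j → V (3 * i + 2) = V (3 * (i + 1) + 1) :=
    fun i hi => hV1 _ (by omega) (by omega)
  have key := eq_of_crossing (f := fun i => U (3 * i + 1)) (g := fun i => V (3 * i)) (j := j)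
    (fun i hi => by
      rw [f1 i (by omega), f2 i hi, hsp (3 * (i + 1)) (by omega) (by omega)])
    (fun i hi => by
      rw [g1 i (by omega), g2 i hi, hsp (3 * (i + 1) + 1) (by omega) (by omega)])
  have h0 : V 0 = U 1 := by
    have := ((key (j - 1) (by omega)).1 (by omega)).1
    beta_reduce at this
    rw [f1 _ (by omega), hUn, hsp 0 (by omega) (by omega)] at this
    simpa using this
  have all : ∀ i, i < j → U (3 * i + 1) = U 1 ∧ V (3 * i) = U 1 := by
    intro i hi
    rcases Nat.mod_two_eq_zero_or_one i with h | h
    · simpa [h0] using (key i hi).1 h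
    · simpa [h0] using (key i hi).2 h
  intro x (hx : x < n)
  obtain ⟨i, hi, h⟩ : ∃ i, i < j ∧ (x = 3 * i ∨ x = 3 * i + 1 ∨ x = 3 * i + 2) :=
    ⟨x / 3, by omega, by omega⟩
  have hx1 := (all i hi).1
  have hx2 := (all i hi).2
  rcases h with rfl | rfl | rfl
  · rw [hsp (3 * i) hx (by omega)]; exact ⟨hx2, hx2⟩
  · rw [← hsp (3 * i + 1) hx (by omega)]; exact ⟨hx1, hx1⟩
  · rw [← f1 i hi, ← g1 i hi]; exact ⟨hx1, hx2⟩

theorem cutSystem_one_two_of_mod_three_eq_one {n j : ℕ} (hn : n = 3 * j + 1) (hj : 2 ≤ j) :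
    CutSystem {x | x < n} (fun x => if x + 1 < n then x + 1 else x + 1 - n)
      (fun x => if x + 2 < n then x + 2 else x + 2 - n)
      (fun x => decide (x % 3 ≠ 2 ∨ x + 2 = n))
      (fun x => decide (x % 3 = 0 ∧ x + 1 ≠ n ∨ x + 2 = n))
      (fun x => decide (x % 3 = 1 ∨ x + 2 = n)) := by
  refine ⟨fun x (hx : x < n) => ?_, fun x (hx : x < n) => ?_, fun x (hx : x < n) => ?_,
    fun x (hx : x < n) => ?_, fun α U V hU hV hs => ⟨U 1, ?_⟩⟩
  · rw [← Bool.not_eq_true]; simp only [Bool.and_eq_true, decide_eq_true_eq]; split_ifs <;> omega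
  · rw [decide_eq_xor]; split_ifs <;> omega
  · rw [← Bool.not_eq_true]; simp only [Bool.and_eq_true, decide_eq_true_eq]; split_ifs <;> omega
  · rw [decide_eq_xor]; split_ifs <;> omega
  have hU1 : ∀ x, x + 2 < n → x % 3 ≠ 0 → U x = U (x + 1) := fun x hx hc => by
    have := hU x (show x < n by omega) (by simp; omega)
    rwa [if_pos (by omega)] at this
  have hV1 : ∀ x, x + 2 < n → x % 3 ≠ 1 → V x = V (x + 2) := fun x hx hc => by
    have := hV x (show x < n by omega) (by simp; omega)
    rwa [if_pos (by omega)] at this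
  have hUn : U (3 * j) = U 0 := by
    have := hU (3 * j) (show _ < n by omega) (by simp; omega)
    rw [if_neg (by omega)] at this
    rw [this]; congr 1; omega
  have hVn : V (3 * j) = V 1 := by
    have := hV (3 * j) (show _ < n by omega) (by simp; omega)
    rw [if_neg (by omega)] at this
    rw [this]; congr 1; omega
  have hsp : ∀ x, x < n → x % 3 ≠ 2 → U x = V x := fun x hx hc => hs x hx (by simp; omega)
  have f1 : ∀ i, i < j → U (3 * i + 1) = U (3 * i + 2) := fun i hi => hU1 _ (by omega) (by omega)
  have f2 : ∀ i, i + 1 < j → U (3 * i + 2) = U (3 * (i + 1)) :=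
    fun i hi => hU1 _ (by omega) (by omega)
  have g1 : ∀ i, i < j → V (3 * i) = V (3 * i + 2) := fun i hi => hV1 _ (by omega) (by omega)
  have g2 : ∀ i, i + 1 < j → V (3 * i + 2) = V (3 * (i + 1) + 1) :=
    fun i hi => hV1 _ (by omega) (by omega)
  have h0 : V 0 = U 1 := by
    rw [← hsp 0 (by omega) (by omega), ← hUn, hsp (3 * j) (by omega) (by omega), hVn,
      hsp 1 (by omega) (by omega)]
  have all : ∀ i, i < j → U (3 * i + 1) = U 1 ∧ V (3 * i) = U 1 := by
    intro i
    induction i with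
    | zero => simp [h0]
    | succ i ih =>
      intro hi
      have := ih (by omega)
      refine ⟨?_, ?_⟩
      · rw [hsp (3 * (i + 1) + 1) (by omega) (by omega), ← g2 i hi, ← g1 i (by omega), this.2]
      · rw [← hsp (3 * (i + 1)) (by omega) (by omega), ← f2 i hi, ← f1 i (by omega), this.1]
  intro x (hx : x < n)
  obtain h | ⟨i, hi, h⟩ : x = 3 * j ∨ ∃ i, i < j ∧ (x = 3 * i ∨ x = 3 * i + 1 ∨ x = 3 * i + 2) := by
    by_cases h : x = 3 * j
    · exact Or.inl h
    · exact Or.inr ⟨x / 3, by omega, by omega⟩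
  · rw [h, hVn, hUn, hsp 0 (by omega) (by omega), ← hsp 1 (by omega) (by omega)]
    exact ⟨h0, rfl⟩
  have hx1 := (all i hi).1
  have hx2 := (all i hi).2
  rcases h with rfl | rfl | rfl
  · rw [hsp (3 * i) hx (by omega)]; exact ⟨hx2, hx2⟩
  · rw [← hsp (3 * i + 1) hx (by omega)]; exact ⟨hx1, hx1⟩
  · rw [← f1 i hi, ← g1 i hi]; exact ⟨hx1, hx2⟩

theorem good_one_two {m : ℕ} [NeZero m] {c : ZMod m} (hc : addOrderOf c = m) (hm : 3 ≤ m)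
    (h : m % 6 = 1 ∨ m % 6 = 3) : Good (1 • c) (2 • c) := by
  have h2 : m % 2 = 1 := by omega
  have fin : ∀ {half cu cv : ℕ → Bool}, CutSystem {x | x < m}
      (fun x => if x + 1 < m then x + 1 else x + 1 - m)
      (fun x => if x + 2 < m then x + 2 else x + 2 - m) half cu cv → Good (1 • c) (2 • c) := by
    intro half cu cv h
    refine (h.congr (fun x hx => intervalStep_self_one hx)
      (fun x hx => intervalStep_self_two h2 hx)).good_interval hc le_rfl one_pos
      (by omega) two_pos (by omega) (fun x hx _ => ?_) (fun x hx _ => ?_)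
    · rw [intervalStep_self_one hx]; split_ifs <;> omega
    · rw [intervalStep_self_two h2 hx]; split_ifs <;> omega
  rcases h with h | h
  · exact fin (cutSystem_one_two_of_mod_three_eq_one (j := m / 3) (by omega) (by omega))
  · exact fin (cutSystem_one_two_of_mod_three (j := m / 3) (by omega) (by omega))

/-- The multiples of `b` represent all cosets of the subgroup generated by `a`, of index `d`. -/
structure Cosets {m : ℕ} (a b : ZMod m) (d : ℕ) : Prop where
  dvd : ∀ x y : ℤ, x • a = y • b → (d : ℤ) ∣ y
  hit : ∀ z, ∃ j < d, ∃ t : ℤ, z = j • b + t • a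

theorem Cosets.exists_smul_eq {m : ℕ} {a b : ZMod m} {d : ℕ} (F : Cosets a b d) :
    ∃ t : ℤ, (d : ℤ) • b = t • a := by
  obtain ⟨j, hj, t, h⟩ := F.hit ((d : ℤ) • b)
  have h1 : (t : ℤ) • a = ((d : ℤ) - j) • b := by
    rw [sub_smul, h]; simp
  have h2 := F.dvd _ _ h1
  have : j = 0 := by
    have h3 : (d : ℤ) ∣ j := (Int.dvd_iff_dvd_of_dvd_sub h2).1 dvd_rfl
    have := Int.natCast_dvd_natCast.1 h3
    exact Nat.eq_zero_of_dvd_of_lt this hj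
  subst this
  exact ⟨t, by simpa using h⟩

/-- `d` and `e` are the indices of the subgroups generated by `a` and by `b`, which together
generate `ZMod m`. -/
structure Frame {m : ℕ} (a b : ZMod m) (d e : ℕ) : Prop where
  dvd : ∀ x y : ℤ, x • a = y • b → (e : ℤ) ∣ x ∧ (d : ℤ) ∣ y
  hitA : ∀ z, ∃ j < d, ∃ t : ℤ, z = j • b + t • a
  hitB : ∀ z, ∃ i < e, ∃ t : ℤ, z = i • a + t • b
  coprime : d.Coprime e

namespace Frame

variable {m : ℕ} {a b : ZMod m} {d e : ℕ}

theorem symm (F : Frame a b d e) : Frame b a e d :=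
  ⟨fun x y h => (F.dvd y x h.symm).symm, F.hitB, F.hitA, F.coprime.symm⟩

theorem neg_right (F : Frame a b d e) : Frame a (-b) d e := by
  refine ⟨fun x y h => ?_, fun z => ?_, fun z => ?_, F.coprime⟩
  · have := F.dvd x (-y) (by rw [h, neg_smul, smul_neg])
    simpa using this
  · obtain ⟨j, hj, t, h⟩ := F.hitA (-z)
    exact ⟨j, hj, -t, by rw [← neg_neg z, h]; simp [add_comm]⟩
  · obtain ⟨i, hi, t, h⟩ := F.hitB z
    exact ⟨i, hi, -t, by rw [h]; simp⟩

theorem d_pos (F : Frame a b d e) : 0 < d := by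
  obtain ⟨j, hj, -⟩ := F.hitA 0; omega

theorem e_pos (F : Frame a b d e) : 0 < e := F.symm.d_pos

theorem cosets (F : Frame a b d e) : Cosets a b d :=
  ⟨fun x y h => (F.dvd x y h).2, F.hitA⟩

theorem exists_smul_eq (F : Frame a b d e) : ∃ t : ℤ, (d : ℤ) • b = t • a :=
  F.cosets.exists_smul_eq

end Frame

theorem exists_nat_smul_eq {m : ℕ} [NeZero m] (a : ZMod m) (t : ℤ) : ∃ s : ℕ, t • a = s • a := by
  refine ⟨(t % m).toNat, ?_⟩
  have hm : (0 : ℤ) < m := by exact_mod_cast NeZero.pos m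
  have h1 : (((t % m).toNat : ℤ)) = t % m := Int.toNat_of_nonneg (Int.emod_nonneg _ hm.ne')
  rw [← natCast_zsmul, h1]
  conv_lhs => rw [← Int.emod_add_mul_ediv t m]
  simp [add_smul]

/-- `c` generates as soon as `a` and `b` are multiples of it. -/
theorem Frame.addOrderOf_eq {m : ℕ} [NeZero m] {a b c : ZMod m} {d e : ℕ} (F : Frame a b d e)
    {x y : ℤ} (ha : a = x • c) (hb : b = y • c) : addOrderOf c = m := by
  have : AddSubgroup.zmultiples c = ⊤ := by
    refine (AddSubgroup.eq_top_iff' _).2 fun z => ?_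
    obtain ⟨j, -, t, rfl⟩ := F.hitA z
    refine add_mem (AddSubgroup.nsmul_mem _ ?_ _) (AddSubgroup.zsmul_mem _ ?_ _)
    · rw [hb]; exact AddSubgroup.zsmul_mem _ (AddSubgroup.mem_zmultiples c) _
    · rw [ha]; exact AddSubgroup.zsmul_mem _ (AddSubgroup.mem_zmultiples c) _
  rw [addOrderOf_eq_card_of_zmultiples_eq_top this, Nat.card_zmod]

theorem Frame.of_gcd {m : ℕ} [NeZero m] (a b : ZMod m)
    (h : (Nat.gcd m a.val).Coprime (Nat.gcd m b.val)) :
    Frame a b (Nat.gcd m a.val) (Nat.gcd m b.val) := by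
  have aux : ∀ a b : ZMod m, (Nat.gcd m a.val).Coprime (Nat.gcd m b.val) →
      (∀ x y : ℤ, x • a = y • b → ((Nat.gcd m a.val : ℕ) : ℤ) ∣ y) ∧
      (∀ z, ∃ j < Nat.gcd m a.val, ∃ t : ℤ, z = j • b + t • a) := by
    intro a b h
    have hcop : (Nat.gcd m a.val).Coprime b.val := by
      have h1 : Nat.gcd (Nat.gcd m a.val) b.val ∣ Nat.gcd m b.val :=
        Nat.dvd_gcd ((Nat.gcd_dvd_left _ _).trans (Nat.gcd_dvd_left _ _)) (Nat.gcd_dvd_right _ _)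
      exact Nat.eq_one_of_dvd_coprimes h (Nat.gcd_dvd_left _ _) h1
    set d := Nat.gcd m a.val with hd
    have hdpos : 0 < d := Nat.gcd_pos_of_pos_left _ (NeZero.pos m)
    have hcopZ : IsCoprime (d : ℤ) (b.val : ℤ) := Nat.isCoprime_iff_coprime.2 hcop
    constructor
    · intro x y hxy
      have h1 : ((x * a.val - y * b.val : ℤ) : ZMod m) = 0 := by
        push_cast
        rw [zsmul_eq_mul, zsmul_eq_mul] at hxy
        simpa [sub_eq_zero] using hxy
      have h2 : (d : ℤ) ∣ x * a.val - y * b.val :=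
        (Int.natCast_dvd_natCast.2 (Nat.gcd_dvd_left _ _)).trans
          ((ZMod.intCast_zmod_eq_zero_iff_dvd _ _).1 h1)
      have h3 : (d : ℤ) ∣ y * b.val := by
        have h4 : (d : ℤ) ∣ x * a.val :=
          Dvd.dvd.mul_left (Int.natCast_dvd_natCast.2 (Nat.gcd_dvd_right _ _)) _
        have := dvd_sub h4 h2
        simpa using this
      exact hcopZ.dvd_of_dvd_mul_right h3
    · intro z
      obtain ⟨u, v, huv⟩ := hcopZ
      have hdZ : (0 : ℤ) < d := by exact_mod_cast hdpos
      set j := (z.val * v : ℤ) % d with hj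
      have hj0 : 0 ≤ j := Int.emod_nonneg _ hdZ.ne'
      have hjd : j < d := Int.emod_lt_of_pos _ hdZ
      have hdvd : (d : ℤ) ∣ z.val - j * b.val := by
        have h1 := Int.emod_add_mul_ediv (z.val * v : ℤ) d
        refine ⟨z.val * u + (z.val * v) / d * b.val, ?_⟩
        rw [← hj] at h1
        linear_combination -(z.val : ℤ) * huv - (b.val : ℤ) * h1
      obtain ⟨k, hk⟩ := hdvd
      have hbez := Nat.gcd_eq_gcd_ab m a.val
      rw [← hd] at hbez
      refine ⟨j.toNat, by omega, Nat.gcdB m a.val * k, ?_⟩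
      have h1 : ((z.val : ℤ) : ZMod m) = ((j * b.val + (m * Nat.gcdA m a.val +
          a.val * Nat.gcdB m a.val) * k : ℤ) : ZMod m) := by
        congr 1; rw [← hbez, ← hk]; ring
      have hjn : ((j.toNat : ℕ) : ZMod m) = ((j : ℤ) : ZMod m) := by
        rw [← Int.cast_natCast, Int.toNat_of_nonneg hj0]
      rw [nsmul_eq_mul, zsmul_eq_mul, hjn]
      push_cast at h1 ⊢
      simp only [ZMod.natCast_val, ZMod.cast_id', id, CharP.cast_eq_zero, zero_mul, zero_add] at h1
      rw [h1]; ring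
  have h1 := aux a b h
  have h2 := aux b a h.symm
  exact ⟨fun x y hxy => ⟨h2.1 y x hxy.symm, h1.1 x y hxy⟩, h1.2, h2.2, h⟩

theorem exists_eq_of_reachable {m : ℕ} {a b : ZMod m} {u v : ZMod m ⊕ ZMod m}
    (h : (Igraph m a b).Reachable u v) :
    ∃ x y : ℤ, Sum.elim id id v = Sum.elim id id u + x • a + y • b := by
  obtain ⟨w⟩ := h
  induction w with
  | nil => exact ⟨0, 0, by simp⟩
  | @cons u v w h p ih =>
    obtain ⟨x, y, hxy⟩ := ih
    have : ∃ x y : ℤ, Sum.elim id id v = Sum.elim id id u + x • a + y • b := by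
      rcases u with u | u <;> rcases v with v | v <;>
        simp [Igraph, bicirculant, SimpleGraph.fromRel_adj] at h
      · rcases h.2 with (h | h) | (h | h)
        · exact ⟨1, 0, by simp [h]⟩
        · exact ⟨-1, 0, by simp [h]⟩
        · exact ⟨-1, 0, by simp [h]⟩
        · exact ⟨1, 0, by simp [h]⟩
      · exact ⟨0, 0, by simp [h]⟩
      · exact ⟨0, 0, by simp [h]⟩
      · rcases h.2 with (h | h) | (h | h)
        · exact ⟨0, 1, by simp [h]⟩
        · exact ⟨0, -1, by simp [h]⟩
        · exact ⟨0, -1, by simp [h]⟩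
        · exact ⟨0, 1, by simp [h]⟩
    obtain ⟨x', y', h'⟩ := this
    exact ⟨x' + x, y' + y, by rw [hxy, h']; simp only [zsmul_eq_mul, Int.cast_add]; ring⟩

theorem frame_of_connected {m : ℕ} [NeZero m] {a b : ZMod m} (h : (Igraph m a b).Connected) :
    ∃ d e, Frame a b d e := by
  refine ⟨_, _, Frame.of_gcd a b ?_⟩
  obtain ⟨x, y, hxy⟩ := exists_eq_of_reachable (h.preconnected (Sum.inl 0) (Sum.inl 1))
  simp only [Sum.elim_inl, id, zero_add] at hxy
  have h1 : ((1 - x * a.val - y * b.val : ℤ) : ZMod m) = 0 := by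
    push_cast
    rw [zsmul_eq_mul, zsmul_eq_mul] at hxy
    simp only [ZMod.natCast_val, ZMod.cast_id', id]
    linear_combination hxy
  have h2 := (ZMod.intCast_zmod_eq_zero_iff_dvd _ _).1 h1
  set g := Nat.gcd (Nat.gcd m a.val) (Nat.gcd m b.val) with hg
  have g1 : (g : ℤ) ∣ m := Int.natCast_dvd_natCast.2
    ((Nat.gcd_dvd_left _ _).trans (Nat.gcd_dvd_left _ _))
  have g2 : (g : ℤ) ∣ a.val := Int.natCast_dvd_natCast.2
    ((Nat.gcd_dvd_left _ _).trans (Nat.gcd_dvd_right _ _))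
  have g3 : (g : ℤ) ∣ b.val := Int.natCast_dvd_natCast.2
    ((Nat.gcd_dvd_right _ _).trans (Nat.gcd_dvd_right _ _))
  have g4 : (g : ℤ) ∣ 1 := by
    have := dvd_add (dvd_add (g1.trans h2) (g2.mul_left x)) (g3.mul_left y)
    rwa [sub_sub, add_assoc, sub_add_cancel] at this
  have := Int.natCast_dvd_natCast.1 (by simpa using g4 : (g : ℤ) ∣ ((1 : ℕ) : ℤ))
  exact Nat.dvd_one.1 this

/-- The box with `R` rows and `C` columns; `(j, i)` is row `j`, column `i`. -/
def box (R C : ℕ) : Set (ℕ × ℕ) := {x | x.1 < R ∧ x.2 < C}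

/-- The placement of the box in `ZMod m`. -/
def place {m : ℕ} (a b : ZMod m) (x : ℕ × ℕ) : ZMod m := x.2 • a + x.1 • b

/-- Step along a row; the row `j` is continued by the row `h j`. -/
def rowStep (C : ℕ) (h : ℕ → ℕ) (x : ℕ × ℕ) : ℕ × ℕ :=
  if x.2 + 1 < C then (x.1, x.2 + 1) else (h x.1, 0)

/-- Step along a column; the column `i` is continued by the column `g i`. -/
def colStep (R : ℕ) (g : ℕ → ℕ) (x : ℕ × ℕ) : ℕ × ℕ :=
  if x.1 + 1 < R then (x.1 + 1, x.2) else (0, g x.2)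

/-- The restrictions on how the rows of a box continue one another. -/
structure Gluing (R d : ℕ) (h : ℕ → ℕ) : Prop where
  lt : ∀ j < R, h j < R
  inj : ∀ j < R, ∀ j' < R, h j = h j' → j = j'
  mod : ∀ j < R, h j % d = j % d
  trans : ∀ P : ℕ → Prop, (∀ j < R, P j → P (h j)) →
    ∀ j < R, ∀ j' < R, j % d = j' % d → P j → P j'

theorem box_finite (R C : ℕ) : (box R C).Finite :=
  ((Set.finite_lt_nat R).prod (Set.finite_lt_nat C)).subset fun _ hx => hx

theorem place_swap {m : ℕ} (a b : ZMod m) (x : ℕ × ℕ) : place b a x.swap = place a b x := by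
  simp [place, add_comm]

theorem injOn_place_swap {m : ℕ} {a b : ZMod m} {R C : ℕ}
    (h : Set.InjOn (place a b) (box R C)) : Set.InjOn (place b a) (box C R) := by
  intro x hx y hy hxy
  refine Prod.swap_injective (h (x₁ := x.swap) ⟨hx.2, hx.1⟩ (x₂ := y.swap) ⟨hy.2, hy.1⟩ ?_)
  rw [place_swap b a, place_swap b a, hxy]

theorem FirstReturn.swap_box {m : ℕ} {a b c : ZMod m} {R C : ℕ} {σ : ℕ × ℕ → ℕ × ℕ}
    (h : FirstReturn (box C R) (place b a) c σ) :
    FirstReturn (box R C) (place a b) c (fun x => (σ x.swap).swap) := by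
  intro x hx
  obtain ⟨h1, t, h2, h3⟩ := h x.swap ⟨hx.2, hx.1⟩
  refine ⟨⟨h1.2, h1.1⟩, t, ?_, fun s hs => ?_⟩
  · rw [place_swap b a, h2, place_swap a b]
  · rintro ⟨y, hy, hy2⟩
    refine h3 s hs ⟨y.swap, ⟨hy.2, hy.1⟩, ?_⟩
    rw [place_swap a b, place_swap a b, hy2]

theorem Cosets.exists_rowStep {m : ℕ} [NeZero m] {a b : ZMod m} {d : ℕ}
    (F : Cosets a b d) {R C : ℕ} (hC : 0 < C)
    (hinj : Set.InjOn (place a b) (box R C)) :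
    ∃ h, FirstReturn (box R C) (place a b) a (rowStep C h) ∧ Gluing R d h := by
  obtain ⟨σ, hσ⟩ := FirstReturn.exists_of_finite (box R C) (place a b) a
  have step : ∀ j i, j < R → i + 1 < C → σ (j, i) = (j, i + 1) := fun j i hj hi =>
    hσ.eq_of_add hinj ⟨hj, by simp only; omega⟩ ⟨hj, hi⟩
      (by simp only [place]; rw [succ_nsmul]; abel)
  have exit0 : ∀ j < R, (σ (j, C - 1)).2 = 0 := by
    intro j hj
    have hmem := (hσ (j, C - 1) ⟨hj, by simp only; omega⟩).1
    by_contra hne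
    obtain ⟨i, hi⟩ := Nat.exists_eq_succ_of_ne_zero hne
    have hiC : i + 1 < C := by have := hmem.2; omega
    have h1 := step (σ (j, C - 1)).1 i hmem.1 hiC
    have h2 : σ (j, C - 1) = σ ((σ (j, C - 1)).1, i) := by
      rw [h1]; exact Prod.ext rfl hi
    have h3 := hσ.injOn hinj (x₁ := (j, C - 1)) ⟨hj, by simp only; omega⟩
      (x₂ := ((σ (j, C - 1)).1, i)) ⟨hmem.1, by simp only; omega⟩ h2
    have := congrArg Prod.snd h3
    simp only at this
    omega
  have hrow : ∀ x ∈ box R C, σ x = rowStep C (fun j => (σ (j, C - 1)).1) x := by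
    rintro ⟨j, i⟩ ⟨hj, hi⟩
    simp only at hj hi
    unfold rowStep
    split_ifs with h
    · exact step j i hj h
    · obtain rfl : i = C - 1 := by simp only at h; omega
      exact Prod.ext rfl (exit0 j hj)
  have hσ' : FirstReturn (box R C) (place a b) a (rowStep C (fun j => (σ (j, C - 1)).1)) := by
    intro x hx
    rw [← hrow x hx]; exact hσ x hx
  refine ⟨_, hσ', fun j hj => (hσ (j, C - 1) ⟨hj, by simp only; omega⟩).1.1, ?_, ?_, ?_⟩
  · intro j hj j' hj' hjj
    have := hσ.injOn hinj (x₁ := (j, C - 1)) ⟨hj, by simp only; omega⟩ (x₂ := (j', C - 1))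
      ⟨hj', by simp only; omega⟩ (Prod.ext hjj (by rw [exit0 j hj, exit0 j' hj']))
    exact congrArg Prod.fst this
  · intro j hj
    obtain ⟨-, t, h1, -⟩ := hσ (j, C - 1) ⟨hj, by simp only; omega⟩
    have h2 := exit0 j hj
    simp only [place, h2, zero_smul, zero_add] at h1
    have h3 : (((C - 1 : ℕ) : ℤ) + (t + 1)) • a = (((σ (j, C - 1)).1 : ℤ) - j) • b := by
      rw [sub_smul, natCast_zsmul, h1, add_smul, natCast_zsmul, natCast_zsmul, ← Nat.cast_succ,
        natCast_zsmul]
      simp only [add_smul, Nat.succ_eq_add_one, one_smul]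
      abel
    have h4 := F.dvd _ _ h3
    exact ((Nat.modEq_iff_dvd).2 h4).symm
  · intro P hP j hj j' hj' hjj hPj
    obtain ⟨s, hs⟩ := F.exists_smul_eq
    obtain ⟨k, hk⟩ := (Nat.modEq_iff_dvd (n := d)).1 hjj
    obtain ⟨t, ht⟩ := exists_nat_smul_eq a (k * s)
    refine hσ'.orbit hinj (P := fun x => P x.1) ?_ t (j, 0) ⟨hj, hC⟩ hPj (j', 0) ⟨hj', hC⟩ ?_
    · rintro ⟨j, i⟩ ⟨hj, hi⟩ hP'
      unfold rowStep
      split_ifs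
      · exact hP'
      · exact hP j hj hP'
    · simp only [place, zero_smul, zero_add]
      rw [← ht, ← sub_eq_iff_eq_add', mul_smul, ← hs, ← mul_smul, mul_comm, ← hk, sub_smul,
        natCast_zsmul, natCast_zsmul]

namespace Frame

variable {m : ℕ} [NeZero m] {a b : ZMod m} {d e : ℕ}

theorem exists_rowStep (F : Frame a b d e) {R C : ℕ} (hC : 0 < C)
    (hinj : Set.InjOn (place a b) (box R C)) :
    ∃ h, FirstReturn (box R C) (place a b) a (rowStep C h) ∧ Gluing R d h :=
  F.cosets.exists_rowStep hC hinj

theorem exists_colStep (F : Frame a b d e) {R C : ℕ} (hR : 0 < R)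
    (hinj : Set.InjOn (place a b) (box R C)) :
    ∃ g, FirstReturn (box R C) (place a b) b (colStep R g) ∧ Gluing C e g := by
  obtain ⟨g, h1, h2⟩ := F.symm.exists_rowStep hR (injOn_place_swap hinj)
  refine ⟨g, ?_, h2⟩
  convert h1.swap_box using 1
  funext x
  simp only [rowStep, colStep, Prod.fst_swap, Prod.snd_swap]
  split_ifs <;> rfl

end Frame

/-- When the box has one row for each coset, every row continues itself. -/
theorem Gluing.eq_self {R d : ℕ} {h : ℕ → ℕ} (H : Gluing R d h) (hRd : R ≤ d) {j : ℕ}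
    (hj : j < R) : h j = j := by
  have := H.mod j hj
  rwa [Nat.mod_eq_of_lt (lt_of_lt_of_le (H.lt j hj) hRd),
    Nat.mod_eq_of_lt (lt_of_lt_of_le hj hRd)] at this

/-- A cut system on a box that has a point in each coset. -/
theorem CutSystem.good_box {m : ℕ} [NeZero m] {a b : ZMod m} {d e R C : ℕ} {h g : ℕ → ℕ}
    {half cu cv : ℕ × ℕ → Bool} (H : CutSystem (box R C) (rowStep C h) (colStep R g) half cu cv)
    (F : Frame a b d e) (hR : d ≤ R) (hC : e ≤ C) (hinj : Set.InjOn (place a b) (box R C))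
    (hh : FirstReturn (box R C) (place a b) a (rowStep C h))
    (hg : FirstReturn (box R C) (place a b) b (colStep R g))
    (hcu : ∀ j < R, cu (j, C - 1) = true → place a b (h j, 0) = place a b (j, C - 1) + a)
    (hcv : ∀ i < C, cv (R - 1, i) = true → place a b (0, g i) = place a b (R - 1, i) + b) :
    Good a b := by
  have hd := F.d_pos
  have he := F.e_pos
  refine H.good (box_finite R C) hinj hh hg (fun z => ?_) (fun z => ?_) ?_ ?_
  · obtain ⟨j, hj, t, ht⟩ := F.hitA z
    obtain ⟨s, hs⟩ := exists_nat_smul_eq a t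
    exact ⟨(j, 0), ⟨by simp only; omega, by simp only; omega⟩, s, by simp [place, ht, hs]⟩
  · obtain ⟨i, hi, t, ht⟩ := F.hitB z
    obtain ⟨s, hs⟩ := exists_nat_smul_eq b t
    exact ⟨(0, i), ⟨by simp only; omega, by simp only; omega⟩, s, by simp [place, ht, hs]⟩
  · rintro ⟨j, i⟩ ⟨hj, hi⟩ hc
    simp only at hj hi
    unfold rowStep
    split_ifs with hlt
    · simp only [place]; rw [succ_nsmul]; abel
    · obtain rfl : i = C - 1 := by simp only at hlt; omega
      exact hcu j hj hc
  · rintro ⟨j, i⟩ ⟨hj, hi⟩ hc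
    simp only at hj hi
    unfold colStep
    split_ifs with hlt
    · simp only [place]; rw [succ_nsmul]; abel
    · obtain rfl : j = R - 1 := by simp only at hlt; omega
      exact hcv i hi hc

/-- Outer cuts after inserting four columns behind the column `k`. -/
def insertU (k r : ℕ) (cu : ℕ × ℕ → Bool) (x : ℕ × ℕ) : Bool :=
  if x.2 ≤ k then cu x else if x.2 = k + 1 then false
  else if x.2 = k + 2 then x.1 == r + 1 || x.1 == r + 2 else if x.2 = k + 3 then false
  else if x.2 = k + 4 then x.1 == r || x.1 == r + 1 else cu (x.1, x.2 - 4)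

/-- Inner cuts after inserting four columns behind the column `k`. -/
def insertV (k r : ℕ) (cv : ℕ × ℕ → Bool) (x : ℕ × ℕ) : Bool :=
  if x.2 ≤ k then cv x else if x.2 = k + 1 then x.1 == r
  else if x.2 = k + 2 then x.1 == r + 1 else if x.2 = k + 3 then x.1 == r + 1
  else if x.2 = k + 4 then x.1 == r else cv (x.1, x.2 - 4)

/-- Spokes after inserting four columns behind the column `k`. -/
def insertHalf (k r : ℕ) (half : ℕ × ℕ → Bool) (x : ℕ × ℕ) : Bool :=
  if x.2 ≤ k then half x else if x.2 = k + 1 then x.1 == r || x.1 == r + 1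
  else if x.2 = k + 2 then x.1 == r + 1 || x.1 == r + 2
  else if x.2 = k + 3 then x.1 == r + 1 || x.1 == r + 2
  else if x.2 = k + 4 then x.1 == r || x.1 == r + 1 else half (x.1, x.2 - 4)

theorem eq_of_single_cut {α : Type} {f : ℕ → α} {R c : ℕ} (hc : c + 1 < R)
    (h : ∀ j, j + 1 < R → j ≠ c → f j = f (j + 1)) (h0 : f (R - 1) = f 0) :
    ∀ j < R, f j = f 0 := by
  have lo : ∀ j ≤ c, f j = f 0 := by
    intro j
    induction j with
    | zero => simp
    | succ j ih => intro hj; rw [← h j (by omega) (by omega), ih (by omega)]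
  have hi : ∀ k j, j + k = R - 1 → c < j → f j = f (R - 1) := by
    intro k
    induction k with
    | zero => intro j hj _; rw [← hj]; rfl
    | succ k ih => intro j hj hcj; rw [h j (by omega) (by omega), ih (j + 1) (by omega) (by omega)]
  intro j hj
  rcases le_or_gt j c with hjc | hjc
  · exact lo j hjc
  · rw [hi (R - 1 - j) j (by omega) hjc, h0]

section insertion

variable {R C k r : ℕ} {h : ℕ → ℕ} {half cu cv : ℕ × ℕ → Bool}

theorem insertU_le {j i : ℕ} (hi : i ≤ k) : insertU k r cu (j, i) = cu (j, i) := by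
  simp [insertU, hi]

theorem insertU_gt {j i : ℕ} (hi : k < i) : insertU k r cu (j, i + 4) = cu (j, i) := by
  simp [insertU, show ¬ (i + 4 ≤ k) by omega, show i + 4 ≠ k + 1 by omega,
    show i + 4 ≠ k + 2 by omega, show i ≠ k by omega, show i + 4 ≠ k + 3 by omega]

theorem insertU_new (j : ℕ) : insertU k r cu (j, k + 1) = false ∧
    insertU k r cu (j, k + 2) = (j == r + 1 || j == r + 2) ∧ insertU k r cu (j, k + 3) = false ∧
    insertU k r cu (j, k + 4) = (j == r || j == r + 1) := by
  simp [insertU]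

theorem insertV_le {j i : ℕ} (hi : i ≤ k) : insertV k r cv (j, i) = cv (j, i) := by
  simp [insertV, hi]

theorem insertV_gt {j i : ℕ} (hi : k < i) : insertV k r cv (j, i + 4) = cv (j, i) := by
  simp [insertV, show ¬ (i + 4 ≤ k) by omega, show i + 4 ≠ k + 1 by omega,
    show i + 4 ≠ k + 2 by omega, show i ≠ k by omega, show i + 4 ≠ k + 3 by omega]

theorem insertV_new (j : ℕ) : insertV k r cv (j, k + 1) = (j == r) ∧
    insertV k r cv (j, k + 2) = (j == r + 1) ∧ insertV k r cv (j, k + 3) = (j == r + 1) ∧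
    insertV k r cv (j, k + 4) = (j == r) := by
  simp [insertV]

theorem insertHalf_le {j i : ℕ} (hi : i ≤ k) : insertHalf k r half (j, i) = half (j, i) := by
  simp [insertHalf, hi]

theorem insertHalf_gt {j i : ℕ} (hi : k < i) : insertHalf k r half (j, i + 4) = half (j, i) := by
  simp [insertHalf, show ¬ (i + 4 ≤ k) by omega, show i + 4 ≠ k + 1 by omega,
    show i + 4 ≠ k + 2 by omega, show i ≠ k by omega, show i + 4 ≠ k + 3 by omega]

theorem insertHalf_new (j : ℕ) : insertHalf k r half (j, k + 1) = (j == r || j == r + 1) ∧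
    insertHalf k r half (j, k + 2) = (j == r + 1 || j == r + 2) ∧
    insertHalf k r half (j, k + 3) = (j == r + 1 || j == r + 2) ∧
    insertHalf k r half (j, k + 4) = (j == r || j == r + 1) := by
  simp [insertHalf]

theorem rowStep_of_lt {j i : ℕ} (hi : i + 1 < C) : rowStep C h (j, i) = (j, i + 1) := by
  simp [rowStep, hi]

theorem rowStep_of_eq {j i : ℕ} (hi : i + 1 = C) : rowStep C h (j, i) = (h j, 0) := by
  simp [rowStep, hi]

theorem colStep_id (j i : ℕ) : colStep R id (j, i) = (if j + 1 < R then j + 1 else 0, i) := by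
  unfold colStep; split_ifs <;> rfl

/-- A statement about every column of the enlarged box. -/
theorem insert_cases {P : ℕ → Prop} (h0 : ∀ i ≤ k, P i) (h1 : P (k + 1)) (h2 : P (k + 2))
    (h3 : P (k + 3)) (h4 : P (k + 4)) (h5 : ∀ i, k < i → i < C → P (i + 4)) :
    ∀ i < C + 4, P i := by
  intro i hi
  by_cases hik : k + 5 ≤ i
  · have := h5 (i - 4) (by omega) (by omega)
    rwa [show i - 4 + 4 = i by omega] at this
  · rcases (by omega : i ≤ k ∨ i = k + 1 ∨ i = k + 2 ∨ i = k + 3 ∨ i = k + 4) with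
      h | rfl | rfl | rfl | rfl
    · exact h0 i h
    · exact h1
    · exact h2
    · exact h3
    · exact h4

/-- The cut system with inserted columns is connected. -/
theorem CutSystem.insert_conn (H : CutSystem (box R C) (rowStep C h) (colStep R id) half cu cv)
    (hk : k + 1 < C) (hr : r + 2 < R) (hs : ∀ j < R, cu (j, k) = (j == r || j == r + 1))
    {α : Type} {U V : ℕ × ℕ → α}
    (hU : ∀ x ∈ box R (C + 4), insertU k r cu x = false → U x = U (rowStep (C + 4) h x))
    (hV : ∀ x ∈ box R (C + 4), insertV k r cv x = false → V x = V (colStep R id x))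
    (hsp : ∀ x ∈ box R (C + 4), insertHalf k r half x = true → U x = V x) :
    ∃ q, ∀ x ∈ box R (C + 4), U x = q ∧ V x = q := by
  have row : ∀ j i, j < R → i + 1 < C + 4 → insertU k r cu (j, i) = false →
      U (j, i) = U (j, i + 1) := by
    intro j i hj hi hc
    have := hU (j, i) ⟨hj, by simp only; omega⟩ hc
    rwa [rowStep_of_lt hi] at this
  have colV : ∀ c i, c + 1 < R → i < C + 4 → (∀ j < R, insertV k r cv (j, i) = (j == c)) →
      ∀ j < R, V (j, i) = V (0, i) := by
    intro c i hc hi hcv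
    refine eq_of_single_cut (f := fun j => V (j, i)) hc (fun j hj hjc => ?_) ?_
    · have := hV (j, i) ⟨by simp only; omega, hi⟩ (by rw [hcv j (by omega)]; simpa using hjc)
      rwa [colStep_id, if_pos hj] at this
    · have := hV (R - 1, i) ⟨by simp only; omega, hi⟩
        (by rw [hcv _ (by omega)]; simp; omega)
      rwa [colStep_id, if_neg (by omega)] at this
  have v1 := colV r (k + 1) (by omega) (by omega) fun j _ => (insertV_new j).1
  have v2 := colV (r + 1) (k + 2) (by omega) (by omega) fun j _ => (insertV_new j).2.1
  have v3 := colV (r + 1) (k + 3) (by omega) (by omega) fun j _ => (insertV_new j).2.2.1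
  have v4 := colV r (k + 4) (by omega) (by omega) fun j _ => (insertV_new j).2.2.2
  have sp : ∀ j i, j < R → i < C + 4 → insertHalf k r half (j, i) = true → U (j, i) = V (j, i) :=
    fun j i hj hi hh => hsp (j, i) ⟨hj, hi⟩ hh
  have a0 : ∀ j < R, j ≠ r → j ≠ r + 1 → U (j, k) = U (j, k + 1) := fun j hj h0 h1 =>
    row j k hj (by omega) (by rw [insertU_le le_rfl, hs j hj]; simp [h0, h1])
  have a1 : ∀ j < R, U (j, k + 1) = U (j, k + 2) := fun j hj =>
    row j (k + 1) hj (by omega) (insertU_new j).1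
  have a2 : ∀ j < R, j ≠ r + 1 → j ≠ r + 2 → U (j, k + 2) = U (j, k + 3) := fun j hj h0 h1 =>
    row j (k + 2) hj (by omega) (by rw [(insertU_new j).2.1]; simp [h0, h1])
  have a3 : ∀ j < R, U (j, k + 3) = U (j, k + 4) := fun j hj =>
    row j (k + 3) hj (by omega) (insertU_new j).2.2.1
  have a4 : ∀ j < R, j ≠ r → j ≠ r + 1 → U (j, k + 4) = U (j, k + 5) := fun j hj h0 h1 =>
    row j (k + 4) hj (by omega) (by rw [(insertU_new j).2.2.2]; simp [h0, h1])
  have s1 : U (r, k + 1) = V (0, k + 1) := by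
    rw [sp r (k + 1) (by omega) (by omega) (by rw [(insertHalf_new r).1]; simp), v1 r (by omega)]
  have s1' : U (r + 1, k + 1) = V (0, k + 1) := by
    rw [sp (r + 1) (k + 1) (by omega) (by omega) (by rw [(insertHalf_new (r + 1)).1]; simp),
      v1 _ (by omega)]
  have s2 : U (r + 1, k + 2) = V (0, k + 2) := by
    rw [sp (r + 1) (k + 2) (by omega) (by omega) (by rw [(insertHalf_new (r + 1)).2.1]; simp),
      v2 _ (by omega)]
  have s2' : U (r + 2, k + 2) = V (0, k + 2) := by
    rw [sp (r + 2) (k + 2) (by omega) (by omega) (by rw [(insertHalf_new (r + 2)).2.1]; simp),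
      v2 _ (by omega)]
  have s3 : U (r + 1, k + 3) = V (0, k + 3) := by
    rw [sp (r + 1) (k + 3) (by omega) (by omega) (by rw [(insertHalf_new (r + 1)).2.2.1]; simp),
      v3 _ (by omega)]
  have s3' : U (r + 2, k + 3) = V (0, k + 3) := by
    rw [sp (r + 2) (k + 3) (by omega) (by omega) (by rw [(insertHalf_new (r + 2)).2.2.1]; simp),
      v3 _ (by omega)]
  have s4 : U (r, k + 4) = V (0, k + 4) := by
    rw [sp r (k + 4) (by omega) (by omega) (by rw [(insertHalf_new r).2.2.2]; simp),
      v4 r (by omega)]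
  have s4' : U (r + 1, k + 4) = V (0, k + 4) := by
    rw [sp (r + 1) (k + 4) (by omega) (by omega) (by rw [(insertHalf_new (r + 1)).2.2.2]; simp),
      v4 _ (by omega)]
  have e21 : V (0, k + 2) = V (0, k + 1) := by rw [← s2, ← a1 _ (by omega), s1']
  have e14 : V (0, k + 1) = V (0, k + 4) := by
    rw [← s1, a1 _ (by omega), a2 _ (by omega) (by omega) (by omega), a3 _ (by omega), s4]
  have e43 : V (0, k + 4) = V (0, k + 3) := by rw [← s4', ← a3 _ (by omega), s3]
  have left : U (r + 2, k) = V (0, k + 2) := by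
    rw [a0 _ (by omega) (by omega) (by omega), a1 _ (by omega), s2']
  have right : U (r + 2, k + 5) = V (0, k + 3) := by
    rw [← a4 _ (by omega) (by omega) (by omega), ← a3 _ (by omega), s3']
  have bridge : ∀ j < R, cu (j, k) = false → U (j, k) = U (j, k + 5) := by
    intro j hj hc
    rw [hs j hj] at hc
    simp only [Bool.or_eq_false_iff, beq_eq_false_iff_ne] at hc
    by_cases h2 : j = r + 2
    · subst h2
      rw [left, right, e21, e14, e43]
    · rw [a0 j hj hc.1 hc.2, a1 j hj, a2 j hj hc.2 h2, a3 j hj, a4 j hj hc.1 hc.2]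
  let e (x : ℕ × ℕ) : ℕ × ℕ := if x.2 ≤ k then x else (x.1, x.2 + 4)
  have e_le : ∀ j i, i ≤ k → e (j, i) = (j, i) := fun j i hi => by simp [e, hi]
  have e_gt : ∀ j i, k < i → e (j, i) = (j, i + 4) := fun j i hi => by
    simp [e, show ¬ (i ≤ k) by omega]
  obtain ⟨q, hq⟩ := H.conn α (U ∘ e) (V ∘ e) (by
      rintro ⟨j, i⟩ ⟨hj, hi⟩ hc
      simp only at hj hi
      simp only [Function.comp]
      rcases lt_trichotomy i k with hik | rfl | hik
      · rw [rowStep_of_lt (by omega), e_le _ _ hik.le, e_le _ _ hik]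
        exact row j i hj (by omega) (by rwa [insertU_le hik.le])
      · rw [rowStep_of_lt hk, e_le _ _ le_rfl, e_gt _ _ (by omega)]
        exact bridge j hj hc
      · have := hU (j, i + 4) ⟨hj, by simp only; omega⟩ (by rwa [insertU_gt hik])
        rw [e_gt _ _ hik, this]
        by_cases hlt : i + 1 < C
        · rw [rowStep_of_lt hlt, e_gt j (i + 1) (by omega), rowStep_of_lt (by omega)]
        · rw [rowStep_of_eq (show i + 1 = C by omega), e_le (h j) 0 (by omega),
            rowStep_of_eq (by omega)]) (by
      rintro ⟨j, i⟩ ⟨hj, hi⟩ hc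
      simp only at hj hi
      simp only [Function.comp, colStep_id]
      rcases le_or_gt i k with hik | hik
      · have := hV (j, i) ⟨hj, by simp only; omega⟩ (by rwa [insertV_le hik])
        rw [e_le _ _ hik, e_le _ _ hik, this, colStep_id]
      · have := hV (j, i + 4) ⟨hj, by simp only; omega⟩ (by rwa [insertV_gt hik])
        rw [e_gt _ _ hik, e_gt _ _ hik, this, colStep_id]) (by
      rintro ⟨j, i⟩ ⟨hj, hi⟩ hc
      simp only at hj hi
      simp only [Function.comp]
      rcases le_or_gt i k with hik | hik
      · rw [e_le _ _ hik]
        exact sp j i hj (by omega) (by rwa [insertHalf_le hik])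
      · rw [e_gt _ _ hik]
        exact sp j (i + 4) hj (by omega) (by rwa [insertHalf_gt hik]))
  simp only [Function.comp] at hq
  have old_le : ∀ j i, j < R → i ≤ k → U (j, i) = q ∧ V (j, i) = q := by
    intro j i hj hi
    have := hq (j, i) ⟨hj, by simp only; omega⟩
    rwa [e_le _ _ hi] at this
  have old_gt : ∀ j i, j < R → k < i → i < C → U (j, i + 4) = q ∧ V (j, i + 4) = q := by
    intro j i hj hi hiC
    have := hq (j, i) ⟨hj, hiC⟩
    rwa [e_gt _ _ hi] at this
  have q2 : V (0, k + 2) = q := by rw [← left, (old_le _ _ (by omega) le_rfl).1]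
  have q1 : V (0, k + 1) = q := by rw [← e21, q2]
  have q4 : V (0, k + 4) = q := by rw [← e14, q1]
  have q3 : V (0, k + 3) = q := by rw [← e43, q4]
  have u1 : ∀ j < R, U (j, k + 1) = q := by
    intro j hj
    by_cases h0 : j = r
    · rw [h0, s1, q1]
    by_cases h1 : j = r + 1
    · rw [h1, s1', q1]
    rw [← a0 j hj h0 h1, (old_le j k hj le_rfl).1]
  have u2 : ∀ j < R, U (j, k + 2) = q := fun j hj => by rw [← a1 j hj, u1 j hj]
  have u4 : ∀ j < R, U (j, k + 4) = q := by
    intro j hj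
    by_cases h0 : j = r
    · rw [h0, s4, q4]
    by_cases h1 : j = r + 1
    · rw [h1, s4', q4]
    rw [a4 j hj h0 h1, (old_gt j (k + 1) hj (by omega) hk).1]
  have u3 : ∀ j < R, U (j, k + 3) = q := fun j hj => by rw [a3 j hj, u4 j hj]
  refine ⟨q, ?_⟩
  rintro ⟨j, i⟩ ⟨hj, hi⟩
  simp only at hj hi
  revert i
  refine insert_cases (k := k) ?_ ?_ ?_ ?_ ?_ ?_
  · exact fun i hi => old_le j i hj hi
  · exact ⟨u1 j hj, by rw [v1 j hj, q1]⟩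
  · exact ⟨u2 j hj, by rw [v2 j hj, q2]⟩
  · exact ⟨u3 j hj, by rw [v3 j hj, q3]⟩
  · exact ⟨u4 j hj, by rw [v4 j hj, q4]⟩
  · exact fun i hi hiC => old_gt j i hj hi hiC

/-- Four columns can be inserted behind a column cut exactly in two consecutive rows. -/
theorem CutSystem.insert (H : CutSystem (box R C) (rowStep C h) (colStep R id) half cu cv)
    (hk : k + 1 < C) (hr : r + 2 < R) (hs : ∀ j < R, cu (j, k) = (j == r || j == r + 1)) :
    CutSystem (box R (C + 4)) (rowStep (C + 4) h) (colStep R id) (insertHalf k r half)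
      (insertU k r cu) (insertV k r cv) := by
  -- the values at consecutive places of a row
  have rows : ∀ (P : Bool → Bool → Bool → Prop),
      (∀ x ∈ box R C, P (cu x) (cu (rowStep C h x)) (half (rowStep C h x))) →
      (∀ p, P p false p) → (∀ p, P false p p) → ∀ x ∈ box R (C + 4), P (insertU k r cu x)
        (insertU k r cu (rowStep (C + 4) h x)) (insertHalf k r half (rowStep (C + 4) h x)) := by
    rintro P hP h1 h2 ⟨j, i⟩ ⟨hj, hi⟩
    simp only at hj hi
    obtain ⟨n1, n2, n3, n4⟩ := insertU_new (k := k) (r := r) (cu := cu) j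
    obtain ⟨m1, m2, m3, m4⟩ := insertHalf_new (k := k) (r := r) (half := half) j
    revert i
    refine insert_cases (k := k) ?_ ?_ ?_ ?_ ?_ ?_
    · intro i hi
      rw [rowStep_of_lt (by omega)]
      rcases hi.lt_or_eq with hi | rfl
      · have := hP (j, i) ⟨hj, by simp only; omega⟩
        rw [rowStep_of_lt (by omega)] at this
        rwa [insertU_le (by omega), insertU_le (by omega), insertHalf_le (by omega)]
      · rw [n1, m1, insertU_le le_rfl, hs j hj]; exact h1 _
    · rw [rowStep_of_lt (by omega), n1, n2, m2]; exact h2 _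
    · rw [rowStep_of_lt (by omega), n2, n3, m3]; exact h1 _
    · rw [rowStep_of_lt (by omega), n3, n4, m4]; exact h2 _
    · have := hP (j, k) ⟨hj, by simp only; omega⟩
      rw [rowStep_of_lt (by omega)] at this ⊢
      rwa [n4, insertU_gt (i := k + 1) (by omega), insertHalf_gt (i := k + 1) (by omega), ← hs j hj]
    · intro i hi hiC
      have := hP (j, i) ⟨hj, hiC⟩
      by_cases hlt : i + 1 < C
      · rw [rowStep_of_lt hlt] at this
        rw [rowStep_of_lt (by omega), insertU_gt hi]
        rwa [insertU_gt (i := i + 1) (by omega), insertHalf_gt (i := i + 1) (by omega)]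
      · rw [rowStep_of_eq (by omega)] at this
        rwa [rowStep_of_eq (by omega), insertU_gt hi, insertU_le (by omega),
            insertHalf_le (by omega)]
  have cols : ∀ (P : Bool → Bool → Bool → Prop),
      (∀ x ∈ box R C, P (cv x) (cv (colStep R id x)) (half (colStep R id x))) →
      (∀ c j, c + 1 < R → j < R → P (j == c) ((if j + 1 < R then j + 1 else 0) == c)
        (((if j + 1 < R then j + 1 else 0) == c) || (if j + 1 < R then j + 1 else 0) == c + 1)) →
      ∀ x ∈ box R (C + 4), P (insertV k r cv x)
        (insertV k r cv (colStep R id x)) (insertHalf k r half (colStep R id x)) := by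
    rintro P hP h1 ⟨j, i⟩ ⟨hj, hi⟩
    simp only at hj hi
    rw [colStep_id]
    obtain ⟨n1, n2, n3, n4⟩ := insertV_new (k := k) (r := r) (cv := cv) j
    obtain ⟨n1', n2', n3', n4'⟩ := insertV_new (k := k) (r := r) (cv := cv)
      (if j + 1 < R then j + 1 else 0)
    obtain ⟨m1, m2, m3, m4⟩ := insertHalf_new (k := k) (r := r) (half := half)
      (if j + 1 < R then j + 1 else 0)
    revert i
    refine insert_cases (k := k) ?_ ?_ ?_ ?_ ?_ ?_
    · intro i hi
      have := hP (j, i) ⟨hj, by simp only; omega⟩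
      rw [colStep_id] at this
      rwa [insertV_le hi, insertV_le hi, insertHalf_le hi]
    · rw [n1, n1', m1]; exact h1 r j (by omega) hj
    · rw [n2, n2', m2]; exact h1 (r + 1) j (by omega) hj
    · rw [n3, n3', m3]; exact h1 (r + 1) j (by omega) hj
    · rw [n4, n4', m4]; exact h1 r j (by omega) hj
    · intro i hi hiC
      have := hP (j, i) ⟨hj, hiC⟩
      rw [colStep_id] at this
      rwa [insertV_gt hi, insertV_gt hi, insertHalf_gt hi]
  refine ⟨rows (fun p q _ => (p && q) = false) H.locU (by simp) (by simp),
    rows (fun p q s => s = xor p q) H.halfU (by simp) (by simp),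
    cols (fun p q _ => (p && q) = false) H.locV (fun c j hc hj => ?_),
    cols (fun p q s => s = xor p q) H.halfV (fun c j hc hj => ?_), ?_⟩
  · clear rows cols; grind
  · clear rows cols; grind
  · exact fun α U V hU hV hsp => H.insert_conn hk hr hs hU hV hsp

end insertion

/-- A list of places, the place `(j, i)` of a box with `C` columns having the number `j * C + i`. -/
def listCut (C : ℕ) (L : List ℕ) (x : ℕ × ℕ) : Bool := L.contains (x.1 * C + x.2)

def rowCode (C : ℕ) (h : ℕ → ℕ) (x : ℕ) : ℕ := if x % C + 1 < C then x + 1 else h (x / C) * C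

def colCode (R C : ℕ) (g : ℕ → ℕ) (x : ℕ) : ℕ := if x / C + 1 < R then x + C else g (x % C)

def checkBox (R C : ℕ) (h g : ℕ → ℕ) (K : List ℕ × List ℕ) : Bool :=
  checkCuts (R * C) (rowCode C h) (colCode R C g) K.1 K.2

theorem box_codes {R C : ℕ} (hC : 0 < C) :
    (∀ x ∈ box R C, ∃ y ∈ {x | x < R * C}, ((y / C, y % C) : ℕ × ℕ) = x) ∧
      ∀ y ∈ {x | x < R * C}, ((y / C, y % C) : ℕ × ℕ) ∈ box R C := by
  refine ⟨?_, fun x hx => ⟨Nat.div_lt_of_lt_mul (by rwa [mul_comm]), Nat.mod_lt _ hC⟩⟩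
  rintro ⟨j, i⟩ ⟨hj, hi⟩
  simp only at hj hi
  refine ⟨j * C + i, ?_, ?_⟩
  · calc j * C + i < j * C + C := by omega
      _ = (j + 1) * C := by ring
      _ ≤ R * C := Nat.mul_le_mul_right _ hj
  · ext
    · simp only
      rw [mul_comm, Nat.mul_add_div hC, Nat.div_eq_of_lt hi, add_zero]
    · simp only
      rw [mul_comm, Nat.mul_add_mod, Nat.mod_eq_of_lt hi]

theorem rowStep_code {C : ℕ} {h : ℕ → ℕ} {S : Set ℕ} (hC : 0 < C) : ∀ x ∈ S,
    rowStep C h (x / C, x % C) = (rowCode C h x / C, rowCode C h x % C) := by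
  intro x _
  simp only [rowStep, rowCode]
  split_ifs with hx
  · have h1 := Nat.div_add_mod x C
    have h2 : x + 1 = C * (x / C) + (x % C + 1) := by omega
    rw [h2, Nat.mul_add_div hC, Nat.mul_add_mod, Nat.div_eq_of_lt hx, Nat.mod_eq_of_lt hx, add_zero]
  · rw [Nat.mul_div_cancel _ hC, Nat.mul_mod_left]

theorem CutSystem.of_checkBox {R C : ℕ} {h g : ℕ → ℕ} {K : List ℕ × List ℕ} (hC : 0 < C)
    (hg : ∀ i < C, g i < C) (hK : checkBox R C h g K = true) :
    ∃ half, CutSystem (box R C) (rowStep C h) (colStep R g) half (listCut C K.1)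
      (listCut C K.2) := by
  refine ⟨fun x => halfOf (rowCode C h) K.1 (x.1 * C + x.2),
    CutSystem.of_map (S' := {x | x < R * C}) (σ' := rowCode C h) (τ' := colCode R C g)
      (fun x => (x / C, x % C)) (box_codes hC).1 (box_codes hC).2 (rowStep_code hC) ?_ ?_⟩
  · intro x _
    simp only [colStep, colCode]
    split_ifs with hx
    · rw [Nat.add_div_right _ hC, Nat.add_mod_right]
    · have := hg (x % C) (Nat.mod_lt _ hC)
      rw [Nat.div_eq_of_lt this, Nat.mod_eq_of_lt this]
  · have := CutSystem.of_check hK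
    convert this using 1 <;> funext x <;> simp [listCut, Nat.div_add_mod']

/-- The cuts do not involve the edges leaving the box. -/
def innerCuts (R C : ℕ) (K : List ℕ × List ℕ) : Bool :=
  ((List.range R).all fun j => !listCut C K.1 (j, C - 1)) &&
    (List.range C).all fun i => !listCut C K.2 (R - 1, i)

theorem innerCuts_iff {R C : ℕ} {K : List ℕ × List ℕ} : innerCuts R C K = true ↔
    (∀ j < R, listCut C K.1 (j, C - 1) = false) ∧ ∀ i < C, listCut C K.2 (R - 1, i) = false := by
  simp [innerCuts]

/-- Duplicate-free lists of length `k` with entries less than `R`. -/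
def injLists (R : ℕ) : ℕ → List (List ℕ)
  | 0 => [[]]
  | k + 1 => (injLists R k).flatMap fun l =>
      ((List.range R).filter fun x => !l.contains x).map fun x => l ++ [x]

theorem mem_injLists {R : ℕ} {h : ℕ → ℕ} (hlt : ∀ j < R, h j < R)
    (hinj : ∀ j < R, ∀ j' < R, h j = h j' → j = j') :
    ∀ k ≤ R, (List.range k).map h ∈ injLists R k := by
  intro k
  induction k with
  | zero => simp [injLists]
  | succ k ih =>
    intro hk
    refine List.mem_flatMap.2 ⟨_, ih (by omega), List.mem_map.2 ⟨h k, List.mem_filter.2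
      ⟨List.mem_range.2 (hlt k hk), ?_⟩, by simp [List.range_succ]⟩⟩
    simp only [Bool.not_eq_true', List.contains_eq_mem, decide_eq_false_iff_not, List.mem_map,
      List.mem_range, not_exists, not_and]
    intro j hj hjk
    have := hinj j (by omega) k hk hjk
    omega

def listFun (l : List ℕ) (j : ℕ) : ℕ := l.getD j 0

theorem listFun_map_range {R j : ℕ} (h : ℕ → ℕ) (hj : j < R) :
    listFun ((List.range R).map h) j = h j := by
  simp [listFun, hj]

/-- Checks the last two conditions of `Gluing`. -/
def admissible (R d : ℕ) (h : ℕ → ℕ) : Bool :=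
  ((List.range R).all fun j => h j % d == j % d) &&
  (List.range R).sublists.all fun s => !(s.all fun j => s.contains (h j)) ||
    s.all fun j => (List.range R).all fun j' => j % d != j' % d || s.contains j'

theorem Gluing.admissible {R d : ℕ} {h h' : ℕ → ℕ} (H : Gluing R d h) (hh : ∀ j < R, h' j = h j) :
    admissible R d h' = true := by
  simp only [_root_.admissible, Bool.and_eq_true, List.all_eq_true, List.mem_range, beq_iff_eq,
    List.mem_sublists, Bool.or_eq_true, Bool.not_eq_true', bne_iff_ne, List.contains_iff_mem]
  refine ⟨fun j hj => by rw [hh j hj, H.mod j hj], fun s hs => ?_⟩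
  have hlt : ∀ j ∈ s, j < R := fun j hj => List.mem_range.1 (hs.subset hj)
  by_cases hc : ∀ j ∈ s, h j ∈ s
  · refine Or.inr fun j hj j' hj' => ?_
    by_cases hjj : j % d = j' % d
    · exact Or.inr (H.trans (· ∈ s) (fun j _ hj => hc j hj) j (hlt j hj) j' hj' hjj hj)
    · exact Or.inl hjj
  · refine Or.inl ?_
    push Not at hc
    obtain ⟨j, hj, hjs⟩ := hc
    simp only [List.all_eq_false]
    exact ⟨j, hj, by simpa [hh j (hlt j hj)] using hjs⟩

/-- Checks a property for all possible gluings. -/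
def allGluings (R d : ℕ) (p : (ℕ → ℕ) → Bool) : Bool :=
  (injLists R R).all fun l => !admissible R d (listFun l) || p (listFun l)

theorem Gluing.exists_of_allGluings {R d : ℕ} {h : ℕ → ℕ} {p : (ℕ → ℕ) → Bool} (H : Gluing R d h)
    (hp : allGluings R d p = true) : ∃ h', (∀ j < R, h' j = h j) ∧ p h' = true := by
  have h1 : ∀ j < R, listFun ((List.range R).map h) j = h j := fun j hj => listFun_map_range h hj
  have := List.all_eq_true.1 hp _ (mem_injLists H.lt H.inj R le_rfl)
  rw [H.admissible h1] at this
  exact ⟨_, h1, by simpa using this⟩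

theorem CutSystem.congr_gluing {R C : ℕ} {h g h' g' : ℕ → ℕ} {half cu cv : ℕ × ℕ → Bool}
    (H : CutSystem (box R C) (rowStep C h') (colStep R g') half cu cv)
    (hh : ∀ j < R, h' j = h j) (hg : ∀ i < C, g' i = g i) :
    CutSystem (box R C) (rowStep C h) (colStep R g) half cu cv := by
  refine H.congr (fun x hx => ?_) (fun x hx => ?_)
  · simp only [rowStep]; rw [hh x.1 hx.1]
  · simp only [colStep]; rw [hg x.2 hx.2]

/-- A box for which every possible gluing is checked to have an inner cut system. -/
theorem good_of_allGluings {m : ℕ} [NeZero m] {a b : ZMod m} {d e R C : ℕ} (F : Frame a b d e)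
    (hR : d ≤ R) (hC : e ≤ C) (hinj : Set.InjOn (place a b) (box R C))
    (pats : List (List ℕ × List ℕ))
    (hp : allGluings R d (fun h => allGluings C e fun g => pats.any fun K =>
      checkBox R C h g K && innerCuts R C K) = true) : Good a b := by
  have hd := F.d_pos
  have he := F.e_pos
  obtain ⟨h, hh, G⟩ := F.exists_rowStep (by omega) hinj
  obtain ⟨g, hg, G'⟩ := F.exists_colStep (by omega) hinj
  obtain ⟨h', h1, hp⟩ := G.exists_of_allGluings hp
  obtain ⟨g', h2, hp⟩ := G'.exists_of_allGluings hp
  obtain ⟨K, -, hK⟩ := List.any_eq_true.1 hp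
  obtain ⟨hK, hin⟩ := Bool.and_eq_true_iff.1 hK
  obtain ⟨half, H⟩ := CutSystem.of_checkBox (by omega)
    (fun i hi => by rw [h2 i hi]; exact G'.lt i hi) hK
  rw [innerCuts_iff] at hin
  exact (H.congr_gluing h1 h2).good_box F hR hC hinj hh hg
    (fun j hj hc => by rw [hin.1 j hj] at hc; exact Bool.noConfusion hc)
    (fun i hi hc => by rw [hin.2 i hi] at hc; exact Bool.noConfusion hc)

theorem CutSystem.transpose {R C : ℕ} {h g : ℕ → ℕ} {half cu cv : ℕ × ℕ → Bool}
    (H : CutSystem (box R C) (rowStep C h) (colStep R g) half cu cv) :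
    CutSystem (box C R) (rowStep R g) (colStep C h) (half ∘ Prod.swap) (cv ∘ Prod.swap)
      (cu ∘ Prod.swap) := by
  refine CutSystem.of_map (S' := box R C) (σ' := colStep R g) (τ' := rowStep C h) Prod.swap
    (fun x hx => ⟨x.swap, ⟨hx.2, hx.1⟩, rfl⟩) (fun x hx => ⟨hx.2, hx.1⟩) (fun x _ => ?_)
    (fun x _ => ?_) H.swap
  · simp only [rowStep, colStep, Prod.fst_swap, Prod.snd_swap]
    split_ifs <;> rfl
  · simp only [rowStep, colStep, Prod.fst_swap, Prod.snd_swap]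
    split_ifs <;> rfl

/-- Repeated insertion of four columns. -/
theorem CutSystem.exists_insert {R C k r : ℕ} {h : ℕ → ℕ} {half cu cv : ℕ × ℕ → Bool}
    (H : CutSystem (box R C) (rowStep C h) (colStep R id) half cu cv)
    (hk : k + 1 < C) (hr : r + 2 < R) (hs : ∀ j < R, cu (j, k) = (j == r || j == r + 1))
    (hend : ∀ j < R, cu (j, C - 1) = false) (n : ℕ) :
    ∃ half' cu' cv', CutSystem (box R (C + 4 * n)) (rowStep (C + 4 * n) h) (colStep R id)
      half' cu' cv' ∧ (∀ j < R, cu' (j, k) = (j == r || j == r + 1)) ∧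
      (∀ j < R, cu' (j, C + 4 * n - 1) = false) ∧
      ((∀ i < C, cv (R - 1, i) = false) → ∀ i < C + 4 * n, cv' (R - 1, i) = false) ∧
      ∀ q s, q ≠ r → q ≠ r + 1 → k < s → (∀ i < C, cv (q, i) = (i == s || i == s + 1)) →
        ∀ i < C + 4 * n, cv' (q, i) = (i == s + 4 * n || i == s + 4 * n + 1) := by
  induction n with
  | zero => exact ⟨half, cu, cv, H, hs, hend, fun h => h, fun q s _ _ _ h => h⟩
  | succ n ih =>
    obtain ⟨half', cu', cv', H', h1, h2, h3, h4⟩ := ih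
    refine ⟨_, _, _, H'.insert (by omega) hr h1, ?_, ?_, ?_, ?_⟩
    · intro j hj
      rw [insertU_le le_rfl, h1 j hj]
    · intro j hj
      have e := insertU_gt (k := k) (r := r) (cu := cu') (j := j) (i := C + 4 * n - 1) (by omega)
      rw [h2 j hj] at e
      rw [← e]; congr 2; omega
    · intro hin
      refine insert_cases (k := k) ?_ ?_ ?_ ?_ ?_ ?_
      · intro i hi
        rw [insertV_le hi, h3 hin i (by omega)]
      · rw [(insertV_new _).1]; simp; omega
      · rw [(insertV_new _).2.1]; simp; omega
      · rw [(insertV_new _).2.2.1]; simp; omega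
      · rw [(insertV_new _).2.2.2]; simp; omega
      · intro i hi hiC
        rw [insertV_gt hi, h3 hin i hiC]
    · intro q s hq hq' hks hin
      have h5 := h4 q s hq hq' hks hin
      refine insert_cases (k := k) ?_ ?_ ?_ ?_ ?_ ?_
      · intro i hi
        rw [insertV_le hi, h5 i (by omega), Bool.eq_iff_iff]; simp; omega
      · rw [(insertV_new _).1, Bool.eq_iff_iff]; simp; omega
      · rw [(insertV_new _).2.1, Bool.eq_iff_iff]; simp; omega
      · rw [(insertV_new _).2.2.1, Bool.eq_iff_iff]; simp; omega
      · rw [(insertV_new _).2.2.2, Bool.eq_iff_iff]; simp; omega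
      · intro i hi hiC
        rw [insertV_gt hi, h5 i hiC, Bool.eq_iff_iff]; simp; omega

theorem injOn_place {m : ℕ} {a b : ZMod m} {R C : ℕ}
    (h : ∀ x y : ℤ, |x| < C → |y| < R → x • a = y • b → x = 0 ∧ y = 0) :
    Set.InjOn (place a b) (box R C) := by
  rintro ⟨j, i⟩ ⟨hj, hi⟩ ⟨j', i'⟩ ⟨hj', hi'⟩ hxy
  simp only [place] at hj hi hj' hi' hxy
  have := h ((i : ℤ) - i') ((j' : ℤ) - j) (by rw [abs_lt]; omega) (by rw [abs_lt]; omega) (by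
    rw [sub_smul, sub_smul, sub_eq_sub_iff_add_eq_add]
    simp only [natCast_zsmul]
    rw [hxy, add_comm])
  ext <;> simp only <;> omega

/-- The cuts at the two horizontal and the two vertical sides of each of the given squares. -/
def squares (C : ℕ) (L : List (ℕ × ℕ)) : List ℕ × List ℕ :=
  (L.flatMap fun x => [x.1 * C + x.2, (x.1 + 1) * C + x.2],
    L.flatMap fun x => [x.1 * C + x.2, x.1 * C + (x.2 + 1)])

/-- For the boxes with 4 to 7 rows and columns, squares defining inner cuts with
identity gluings, a row, and a column at which that row can be split. -/
def smallBoxes : List (List (ℕ × ℕ) × ℕ × ℕ) := [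
  ([(0,0),(1,3),(2,1)],2,1), ([(0,0),(1,4),(2,2)],2,2), ([(0,0),(0,3),(1,5),(2,1)],2,1),
  ([(0,0),(1,2),(3,1)],3,1), ([(0,0),(1,3),(3,1)],3,1), ([(0,0),(0,2),(0,4),(2,2),(3,4)],2,2),
  ([(0,0),(0,2),(0,4),(2,2),(3,5)],2,2), ([(0,0),(2,1),(4,2)],2,1),
  ([(0,0),(0,2),(2,2),(4,3)],2,2), ([(0,0),(0,2),(0,4),(2,1),(2,4),(4,2)],4,2),
  ([(0,0),(0,2),(0,4),(2,1),(2,5),(4,2)],4,2), ([(0,0),(1,2),(3,1),(5,2)],3,1),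
  ([(0,0),(0,2),(2,2),(4,1),(5,3)],2,2), ([(0,0),(0,2),(0,4),(2,1),(2,4),(4,4),(5,2)],5,2),
  ([(0,0),(0,2),(0,4),(2,1),(2,4),(4,1),(5,5)],4,1)]

def checkSplit (R C : ℕ) (K : List ℕ × List ℕ) (q s : ℕ) : Bool :=
  ((List.range R).all fun j => listCut C K.1 (j, 0) == (j == 0 || j == 1)) &&
    ((List.range C).all fun i => listCut C K.2 (q, i) == (i == s || i == s + 1)) &&
    1 < q && q + 1 < R && 0 < s && s + 2 < C

def checkSmall (R C : ℕ) (p : List (ℕ × ℕ) × ℕ × ℕ) : Bool :=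
  checkSplit R C (squares C p.1) p.2.1 p.2.2 && innerCuts R C (squares C p.1) &&
    checkBox R C id id (squares C p.1)

theorem exists_checkSmall : ∀ r < 4, ∀ c < 4, (r = 0 ∧ c = 0) ∨
    checkSmall (4 + r) (4 + c) (smallBoxes.getD (4 * r + c - 1) ([], 0, 0)) = true := by
  decide +kernel

theorem good_of_four_le_of_four_le {m : ℕ} [NeZero m] {a b : ZMod m} {d e : ℕ}
    (F : Frame a b d e) (hd : 4 ≤ d) (he : 4 ≤ e) : Good a b := by
  have hinj : Set.InjOn (place b a) (box e d) := injOn_place fun x y hx hy hxy => by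
    have h := F.symm.dvd x y hxy
    exact ⟨Int.eq_zero_of_abs_lt_dvd h.1 hx, Int.eq_zero_of_abs_lt_dvd h.2 hy⟩
  obtain ⟨h, hh, G⟩ := F.symm.exists_rowStep (by omega) hinj
  obtain ⟨g, hg, G'⟩ := F.symm.exists_colStep (by omega) hinj
  obtain ⟨r, nr, hr, hdr⟩ : ∃ r n, r < 4 ∧ d = 4 + r + 4 * n := ⟨d % 4, d / 4 - 1, by omega⟩
  obtain ⟨c, nc, hc, hec⟩ : ∃ c n, c < 4 ∧ e = 4 + c + 4 * n := ⟨e % 4, e / 4 - 1, by omega⟩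
  have hcop : ¬ (r = 0 ∧ c = 0) := by
    rintro ⟨rfl, rfl⟩
    have h1 : 4 ∣ Nat.gcd d e := Nat.dvd_gcd ⟨1 + nr, by omega⟩ ⟨1 + nc, by omega⟩
    rw [F.coprime] at h1
    omega
  have hck := (exists_checkSmall r hr c hc).resolve_left hcop
  generalize smallBoxes.getD (4 * r + c - 1) ([], 0, 0) = p at hck
  obtain ⟨L, q, s⟩ := p
  simp only [checkSmall, checkSplit, Bool.and_eq_true, List.all_eq_true, List.mem_range,
    beq_iff_eq, decide_eq_true_eq, innerCuts_iff] at hck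
  obtain ⟨⟨⟨⟨⟨⟨⟨h1, h2⟩, hq⟩, hqr⟩, hs⟩, hsc⟩, h3, h4⟩, hK⟩ := hck
  obtain ⟨half, H⟩ := CutSystem.of_checkBox (by omega) (fun i hi => hi) hK
  obtain ⟨half', cu', cv', H', -, h3', h4', h5⟩ :=
    H.exists_insert (k := 0) (r := 0) (by omega) (by omega) h1 h3 nc
  have h5 := h5 q s (by omega) (by omega) hs h2
  obtain ⟨half'', cu'', cv'', H'', -, h3'', h4'', -⟩ :=
    H'.transpose.exists_insert (k := q) (r := s + 4 * nc) (by omega) (by omega) h5 (h4' h4) nr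
  have h4'' := h4'' h3'
  rw [← hdr, ← hec] at H'' h4''
  rw [← hdr] at h3''
  rw [← hec] at h3''
  refine ((H''.congr_gluing (fun j hj => (G.eq_self le_rfl hj).symm)
    (fun i hi => (G'.eq_self le_rfl hi).symm)).good_box F.symm le_rfl le_rfl hinj hh hg
    (fun j hj hc => ?_) (fun i hi hc => ?_)).symm
  · rw [h3'' j hj] at hc; exact Bool.noConfusion hc
  · rw [h4'' i hi] at hc; exact Bool.noConfusion hc

def checkCylinder (R C d : ℕ) (inner : Bool) (pats : List (List ℕ × List ℕ)) : Bool :=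
  allGluings R d fun h => pats.any fun K => checkBox R C h id K &&
    ((List.range R).all fun j => listCut C K.1 (j, 0) == (j == 0 || j == 1)) &&
    ((List.range R).all fun j => !listCut C K.1 (j, C - 1)) &&
    (!inner || (List.range C).all fun i => !listCut C K.2 (R - 1, i))

/-- A box whose columns close up, obtained by repeated insertion from a small one. -/
theorem good_of_checkCylinder {m : ℕ} [NeZero m] {a b : ZMod m} {d e R C n : ℕ}
    (F : Frame a b d e) (hR : d ≤ R) (hR' : 2 < R) (hC : 1 < C) (he : e = C + 4 * n)
    (hb : ∀ y : ℤ, |y| < R → y • b = 0 → y = 0) (inner : Bool) (hin : inner = false → R • b = 0)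
    (pats : List (List ℕ × List ℕ)) (hp : checkCylinder R C d inner pats = true) : Good a b := by
  have hinj : Set.InjOn (place a b) (box R e) := injOn_place fun x y hx hy hxy => by
    have h := Int.eq_zero_of_abs_lt_dvd (F.dvd x y hxy).1 hx
    exact ⟨h, hb y hy (by rw [← hxy, h, zero_smul])⟩
  obtain ⟨h, hh, G⟩ := F.exists_rowStep (by omega) hinj
  obtain ⟨g, hg, G'⟩ := F.exists_colStep (by omega) hinj
  obtain ⟨h', h1, hp⟩ := G.exists_of_allGluings hp
  obtain ⟨K, -, hK⟩ := List.any_eq_true.1 hp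
  simp only [Bool.and_eq_true, List.all_eq_true, List.mem_range, Bool.or_eq_true,
    beq_iff_eq, Bool.not_eq_true'] at hK
  obtain ⟨⟨⟨hK, h2⟩, h3⟩, h4⟩ := hK
  obtain ⟨half, H⟩ := CutSystem.of_checkBox (by omega) (fun i hi => hi) hK
  obtain ⟨half', cu', cv', H', -, h3', h4', -⟩ :=
    H.exists_insert (k := 0) (r := 0) hC hR' h2 h3 n
  rw [← he] at H' h3' h4'
  refine (H'.congr_gluing h1 (fun i hi => (G'.eq_self le_rfl hi).symm)).good_box F hR le_rfl hinj
    hh hg (fun j hj hc => ?_) (fun i hi hc => ?_)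
  · rw [h3' j hj] at hc; exact Bool.noConfusion hc
  · rcases h4 with h4 | h4
    · rw [G'.eq_self le_rfl hi, place, place, add_assoc, ← succ_nsmul]
      simp only
      rw [show R - 1 + 1 = R by omega, hin h4, zero_smul]
    · rw [h4' h4 i hi] at hc; exact Bool.noConfusion hc

def fourRows (c : ℕ) : List (List ℕ × List ℕ) := [
  [([0,2,4,6,10,14],[0,1,2,3,10,11]), ([0,2,4,6,9,13],[0,1,2,3,9,10]),
    ([0,4,10,14],[0,1,10,11]), ([0,4,6,10],[0,1,6,7])],
  [([0,2,5,7,11,13,16,18],[0,1,2,3,11,12,13,14]), ([0,3,5,8,11,13,16,18],[0,1,3,4,11,12,13,14]),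
    ([0,3,5,8,11,16],[0,1,3,4,11,12])],
  [([0,2,4,6,8,10,13,15,19,21],[0,1,2,3,4,5,13,14,15,16]),
    ([0,2,4,6,8,10,13,16,19,22],[0,1,2,3,4,5,13,14,16,17]),
    ([0,2,4,6,8,10,14,20],[0,1,2,3,4,5,14,15])],
  [([0,2,4,7,9,11,15,17,19,22,24,26],[0,1,2,3,4,5,15,16,17,18,19,20]),
    ([0,2,4,7,9,11,16,19,23,26],[0,1,2,3,4,5,16,17,19,20]),
    ([0,2,5,7,9,12,15,17,19,22,24,26],[0,1,2,3,5,6,15,16,17,18,19,20])]].getD c []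

theorem checkCylinder_fourRows : ∀ d < 4, d ≠ 0 → ∀ c < 4,
    checkCylinder 4 (4 + c) d true (fourRows c) = true := by
  decide +kernel

theorem good_of_four_le {m : ℕ} [NeZero m] {a b : ZMod m} {d e : ℕ} (F : Frame a b d e)
    (hd : d < 4) (he : 4 ≤ e) (hb : ∀ y : ℤ, |y| < 4 → y • b = 0 → y = 0) : Good a b :=
  good_of_checkCylinder (R := 4) (C := 4 + e % 4) (n := e / 4 - 1) F (by omega) (by omega)
    (by omega) (by omega) (by simpa using hb) true (by simp) _
    (checkCylinder_fourRows d hd F.d_pos.ne' (e % 4) (by omega))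

def threeRows (c : ℕ) : List (List ℕ × List ℕ) := [
  [([0,2,4,10],[0,1,10,11]), ([0,4,6,10],[0,1,6,7])],
  [([0,2,4,6,10,14],[0,1,4,5,14,15]), ([0,2,6,10,14,16],[0,1,10,11,14,15])]].getD c []

theorem checkCylinder_threeRows : ∀ d < 4, d ≠ 0 → ∀ c < 2,
    checkCylinder 3 (4 + 2 * c) d false (threeRows c) = true := by
  decide +kernel

theorem good_of_three_smul_eq_zero_of_even {m : ℕ} [NeZero m] {a b : ZMod m} {d e : ℕ}
    (F : Frame a b d e) (he : 4 ≤ e) (he2 : e % 2 = 0)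
    (h3 : 3 • b = 0) (hb3 : ∀ y : ℤ, |y| < 3 → y • b = 0 → y = 0) : Good a b := by
  have hd : d ≤ 3 := Nat.le_of_dvd (by omega) (by
    have := (F.dvd 0 3 (by rw [zero_smul]; exact_mod_cast h3.symm)).2
    exact_mod_cast this)
  exact good_of_checkCylinder (R := 3) (C := 4 + 2 * (e / 2 % 2)) (n := e / 4 - 1) F hd (by omega)
    (by omega) (by omega) (by simpa using hb3) false (fun _ => h3) _
    (checkCylinder_threeRows d (by omega) F.d_pos.ne' (e / 2 % 2) (by omega))

def zigzagRow (e s c : ℕ) : ℕ :=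
  if c + 1 = e then (if s = 0 then 0 else 2) else if c % 2 = 0 then 2 else 1

def zigzagCol (e s c : ℕ) : ℕ :=
  if c + 1 = e ∧ s = 0 then 0 else if c = 0 ∧ s ≠ 2 then 2 else 1

theorem zigzagCol_of_ne_zero {e s c : ℕ} (hc : c ≠ 0) :
    zigzagCol e s c = if c + 1 = e ∧ s = 0 then 0 else 1 := by
  simp [zigzagCol, hc]

theorem cutSystem_zigzag {e s : ℕ} (he : 3 ≤ e) (he2 : e % 2 = 1) (hs : s < 3) :
    CutSystem (box 3 e) (rowStep e fun j => (j + s) % 3) (colStep 3 id)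
      (fun x => decide (x.1 ≠ (zigzagCol e s x.2 + 2) % 3))
      (fun x => decide (x.1 = zigzagRow e s x.2))
      (fun x => decide (x.1 = zigzagCol e s x.2)) := by
  refine ⟨?_, ?_, ?_, ?_, ?_⟩
  · rintro ⟨j, i⟩ ⟨hj, hi⟩
    rw [← Bool.not_eq_true]
    rcases lt_or_ge (i + 1) e with h | h
    · simp only [rowStep_of_lt h, zigzagRow, Bool.and_eq_true, decide_eq_true_eq] at *
      split_ifs <;> omega
    · simp only [rowStep, not_lt.2 h, if_false, zigzagRow, Bool.and_eq_true,
        decide_eq_true_eq] at *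
      split_ifs <;> omega
  · rintro ⟨j, i⟩ ⟨hj, hi⟩
    rw [decide_eq_xor]
    rcases lt_or_ge (i + 1) e with h | h
    · simp only [rowStep_of_lt h, zigzagRow, zigzagCol] at *
      split_ifs <;> first | omega | simp at *
    · simp only [rowStep, not_lt.2 h, if_false, zigzagRow, zigzagCol] at *
      split_ifs <;> first | omega | (simp at *; omega)
  · rintro ⟨j, i⟩ ⟨hj, hi⟩
    rw [← Bool.not_eq_true]
    obtain ⟨j', hj', h⟩ : ∃ j', j' = (if j + 1 < 3 then j + 1 else 0) ∧
        colStep 3 id (j, i) = (j', i) := ⟨_, rfl, colStep_id j i⟩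
    · simp only [h, zigzagCol, Bool.and_eq_true, decide_eq_true_eq] at *
      split_ifs at * <;> omega
  · rintro ⟨j, i⟩ ⟨hj, hi⟩
    rw [decide_eq_xor]
    obtain ⟨j', hj', h⟩ : ∃ j', j' = (if j + 1 < 3 then j + 1 else 0) ∧
        colStep 3 id (j, i) = (j', i) := ⟨_, rfl, colStep_id j i⟩
    · simp only [h, zigzagCol] at *
      split_ifs at * <;> omega
  · intro α U V hU hV hsp
    have row : ∀ j i, j < 3 → i + 1 < e → j ≠ zigzagRow e s i → U (j, i) = U (j, i + 1) := by
      intro j i hj hi hc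
      have := hU (j, i) ⟨hj, by simp only; omega⟩ (by simpa using hc)
      rwa [rowStep_of_lt hi] at this
    have wrap : ∀ j, j < 3 → j ≠ zigzagRow e s (e - 1) → U (j, e - 1) = U ((j + s) % 3, 0) := by
      intro j hj hc
      have := hU (j, e - 1) ⟨hj, by simp only; omega⟩ (by simpa using hc)
      simpa [rowStep, show ¬ (e - 1 + 1 < e) by omega] using this
    have col : ∀ j i, j < 3 → i < e → V (j, i) = V (0, i) := by
      intro j i hj hi
      have hv : ∀ j < 3, j ≠ zigzagCol e s i → V (j, i) = V ((j + 1) % 3, i) := by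
        intro j hj hc
        have := hV (j, i) ⟨hj, hi⟩ (by simpa using hc)
        rw [this, colStep_id]
        congr 2; split_ifs <;> omega
      have h0 := hv 0 (by omega)
      have h1 := hv 1 (by omega)
      have h2 := hv 2 (by omega)
      simp only [Nat.reduceAdd, Nat.reduceMod] at h0 h1 h2
      interval_cases j
      · rfl
      · by_cases hz : 0 = zigzagCol e s i
        · rw [h1 (by omega), h2 (by omega)]
        · rw [h0 hz]
      · by_cases hz : 2 = zigzagCol e s i
        · rw [h0 (by omega), h1 (by omega)]
        · rw [h2 hz]
    have sp : ∀ j i, j < 3 → i < e → j ≠ (zigzagCol e s i + 2) % 3 → U (j, i) = V (0, i) := by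
      intro j i hj hi hc
      rw [hsp (j, i) ⟨hj, hi⟩ (by simpa using hc), col j i hj hi]
    have r0 : ∀ i < e, U (0, i) = U (0, 0) := by
      intro i
      induction i with
      | zero => simp
      | succ i ih =>
        intro hi
        rw [← row 0 i (by omega) hi (by unfold zigzagRow; split_ifs <;> omega), ih (by omega)]
    have mid : ∀ i, 1 ≤ i → (i + 1 < e ∨ i < e ∧ s ≠ 0) → V (0, i) = V (0, 1) := by
      intro i
      induction i with
      | zero => simp
      | succ i ih =>
        intro h1 h2
        rcases Nat.eq_zero_or_pos i with rfl | hi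
        · rfl
        have hz : zigzagCol e s i = 1 := by unfold zigzagCol; split_ifs <;> omega
        have hz' : zigzagCol e s (i + 1) = 1 := by
          rw [zigzagCol_of_ne_zero (by omega)]; split_ifs <;> omega
        rw [← ih hi (by omega)]
        have hr : zigzagRow e s i = if i % 2 = 0 then 2 else 1 := by
          unfold zigzagRow; split_ifs <;> omega
        have := row (if i % 2 = 0 then 1 else 2) i (by split_ifs <;> omega) (by omega)
          (by rw [hr]; split_ifs <;> omega)
        rw [sp _ i (by split_ifs <;> omega) (by omega) (by rw [hz]; split_ifs <;> omega),
          sp _ (i + 1) (by split_ifs <;> omega) (by omega)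
            (by rw [hz']; split_ifs <;> omega)] at this
        exact this.symm
    have fin : (∀ i < e, V (0, i) = V (0, 1)) → U (0, 0) = V (0, 1) → U (1, 0) = V (0, 1) →
        U (2, 0) = V (0, 1) → (∀ j < 3, U (j, e - 1) = V (0, 1)) →
        ∃ k, ∀ x ∈ box 3 e, U x = k ∧ V x = k := by
      intro hV' h0 h1 h2 he'
      refine ⟨V (0, 1), ?_⟩
      rintro ⟨j, i⟩ ⟨hj, hi⟩
      simp only at hj hi
      refine ⟨?_, by rw [col j i hj hi, hV' i hi]⟩
      rcases Nat.eq_zero_or_pos j with rfl | hj0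
      · rw [r0 i hi, h0]
      rcases Nat.eq_zero_or_pos i with rfl | hi0
      · interval_cases j <;> assumption
      rcases eq_or_ne (i + 1) e with rfl | hie
      · exact he' j hj
      · rw [sp j i hj hi (by unfold zigzagCol; split_ifs <;> omega), hV' i hi]
    have z0 : zigzagCol e s 0 = if s = 2 then 1 else 2 := by
      simp only [zigzagCol, show ¬ (0 + 1 = e) by omega]; split_ifs <;> first | rfl | simp_all
    have ze : zigzagCol e s (e - 1) = if s = 0 then 0 else 1 := by
      unfold zigzagCol; split_ifs <;> omega
    have re : zigzagRow e s (e - 1) = if s = 0 then 0 else 2 := by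
      unfold zigzagRow; split_ifs <;> omega
    have row1 : U (1, 0) = V (0, 1) := by
      rw [row 1 0 (by omega) (by omega) (by unfold zigzagRow; split_ifs <;> omega),
        sp 1 (0 + 1) (by omega) (by omega)
          (by rw [zigzagCol_of_ne_zero (by omega)]; split_ifs <;> omega)]
    have w0 := wrap 0 (by omega)
    have w1 := wrap 1 (by omega)
    have w2 := wrap 2 (by omega)
    have s0 := fun j hj => sp j 0 hj (by omega)
    have se := fun j hj => sp j (e - 1) hj (by omega)
    have hall : ∀ i < e, V (0, i) = V (0, 1) ∨ i = 0 ∨ i = e - 1 ∧ s = 0 := fun i hi => by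
      by_cases h : i = 0 ∨ i = e - 1 ∧ s = 0
      · exact Or.inr h
      · exact Or.inl (mid i (by omega) (by omega))
    have hfin : V (0, 0) = V (0, 1) → V (0, e - 1) = V (0, 1) →  ∀ i < e, V (0, i) = V (0, 1) := by
      intro h0 h1 i hi
      rcases hall i hi with h | rfl | ⟨rfl, -⟩ <;> assumption
    rw [re] at w0 w1 w2
    rw [z0] at s0
    rw [ze] at se
    interval_cases s <;> simp at w0 w1 w2 s0 se
    · have hm := sp 2 (e - 2) (by omega) (by omega) (by unfold zigzagCol; split_ifs <;> omega)
      rw [mid (e - 2) (by omega) (by omega), row 2 (e - 2) (by omega) (by omega)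
        (by unfold zigzagRow; split_ifs <;> omega), show e - 2 + 1 = e - 1 by omega] at hm
      have h0 := s0 0 (by omega) (by omega)
      have h2 := s0 2 (by omega) (by omega)
      have e0 := se 0 (by omega) (by omega)
      have e1 := se 1 (by omega) (by omega)
      have hr := r0 (e - 1) (by omega)
      clear hU hV hsp row wrap col sp r0 mid hall s0 se
      refine fin (hfin ?_ ?_) ?_ row1 ?_ fun j hj => ?_
      all_goals clear fin hfin
      all_goals first | interval_cases j | skip
      all_goals grind only
    · have h0 := s0 0 (by omega) (by omega)
      have h2 := s0 2 (by omega) (by omega)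
      have e1 := se 1 (by omega) (by omega)
      have e2 := se 2 (by omega) (by omega)
      have hr := r0 (e - 1) (by omega)
      have hm := mid (e - 1) (by omega) (by omega)
      clear hU hV hsp row wrap col sp r0 mid hall s0 se
      refine fin (hfin ?_ ?_) ?_ row1 ?_ fun j hj => ?_
      all_goals clear fin hfin
      all_goals first | interval_cases j | skip
      all_goals grind only
    · have h0 := s0 1 (by omega) (by omega)
      have h2 := s0 2 (by omega) (by omega)
      have e1 := se 1 (by omega) (by omega)
      have e2 := se 2 (by omega) (by omega)
      have hr := r0 (e - 1) (by omega)
      have hm := mid (e - 1) (by omega) (by omega)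
      clear hU hV hsp row wrap col sp r0 mid hall s0 se
      refine fin (hfin ?_ ?_) ?_ row1 ?_ fun j hj => ?_
      all_goals clear fin hfin
      all_goals first | interval_cases j | skip
      all_goals grind only

theorem good_of_three_smul_eq_zero_of_odd {m : ℕ} [NeZero m] {a b : ZMod m} {d e : ℕ}
    (F : Frame a b d e) (he : 3 ≤ e) (he2 : e % 2 = 1)
    (h3 : 3 • b = 0) (hb3 : ∀ y : ℤ, |y| < 3 → y • b = 0 → y = 0) : Good a b := by
  have hd : d ≤ 3 := Nat.le_of_dvd (by omega) (by
    have := (F.dvd 0 3 (by rw [zero_smul]; exact_mod_cast h3.symm)).2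
    exact_mod_cast this)
  have hmod : ∀ k : ℕ, k • b = (k % 3) • b := fun k => by
    conv_lhs => rw [← Nat.div_add_mod k 3, add_smul, mul_comm, mul_smul, h3, smul_zero, zero_add]
  have hinj : Set.InjOn (place a b) (box 3 e) := injOn_place fun x y hx hy hxy => by
    have h := Int.eq_zero_of_abs_lt_dvd (F.dvd x y hxy).1 hx
    exact ⟨h, hb3 y (by exact_mod_cast hy) (by rw [← hxy, h, zero_smul])⟩
  obtain ⟨h, hh, G⟩ := F.exists_rowStep (by omega) hinj
  obtain ⟨g, hg, G'⟩ := F.exists_colStep (by omega) hinj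
  obtain ⟨t, ht⟩ := F.symm.exists_smul_eq
  obtain ⟨s, hs⟩ := exists_nat_smul_eq b t
  rw [natCast_zsmul, hs, hmod] at ht
  have hplace : ∀ j < 3, place a b ((j + s % 3) % 3, 0) = place a b (j, e - 1) + a := by
    intro j hj
    simp only [place, zero_smul, zero_add]
    rw [← hmod, add_smul, ← ht, add_right_comm, ← succ_nsmul, show e - 1 + 1 = e by omega, add_comm]
  have hhj : ∀ j < 3, (j + s % 3) % 3 = h j := by
    intro j hj
    have := hh.eq_of_add hinj (x := (j, e - 1)) ⟨hj, by simp only; omega⟩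
      (y := ((j + s % 3) % 3, 0)) ⟨Nat.mod_lt _ (by omega), by simp only; omega⟩ (hplace j hj)
    rw [rowStep_of_eq (by omega)] at this
    exact (congrArg Prod.fst this).symm
  refine ((cutSystem_zigzag he he2 (Nat.mod_lt s (by omega))).congr_gluing hhj
    (fun i hi => (G'.eq_self le_rfl hi).symm)).good_box F hd le_rfl hinj hh hg
    (fun j hj _ => ?_) (fun i hi _ => ?_)
  · rw [← hhj j hj, hplace j hj]
  · rw [G'.eq_self le_rfl hi, place, place, add_assoc, ← succ_nsmul]
    simp only
    rw [h3, zero_smul]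

/-- The step along `b`, seen in the box spanned by `a` and `c = a - b`, where `t • c = 0`. -/
def stripStep (t L : ℕ) (h : ℕ → ℕ) (x : ℕ × ℕ) : ℕ × ℕ :=
  if x.2 + 1 < L then ((x.1 + (t - 1)) % t, x.2 + 1) else (h ((x.1 + (L - 1)) % t), 0)

def stripCode (t L : ℕ) (h : ℕ → ℕ) (x : ℕ) : ℕ :=
  if x % L + 1 < L then (x / L + (t - 1)) % t * L + (x % L + 1)
  else h ((x / L + (L - 1)) % t) * L

theorem CutSystem.of_checkStrip {t L : ℕ} {h h' : ℕ → ℕ} {K : List ℕ × List ℕ} (hL : 0 < L)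
    (hK : checkCuts (t * L) (rowCode L h) (stripCode t L h') K.1 K.2 = true) :
    ∃ half, CutSystem (box t L) (rowStep L h) (stripStep t L h') half (listCut L K.1)
      (listCut L K.2) := by
  refine ⟨fun x => halfOf (rowCode L h) K.1 (x.1 * L + x.2),
    CutSystem.of_map (S' := {x | x < t * L}) (σ' := rowCode L h) (τ' := stripCode t L h')
      (fun x => (x / L, x % L)) (box_codes hL).1 (box_codes hL).2 (rowStep_code hL) ?_ ?_⟩
  · intro x _
    simp only [stripStep, stripCode]
    split_ifs with hx
    · rw [mul_comm, Nat.mul_add_div hL, Nat.mul_add_mod, Nat.div_eq_of_lt hx, Nat.mod_eq_of_lt hx,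
        add_zero]
    · rw [Nat.mul_div_cancel _ hL, Nat.mul_mod_left]
  · have := CutSystem.of_check hK
    convert this using 1 <;> funext x <;> simp [listCut, Nat.div_add_mod']

theorem nsmul_mod {m t : ℕ} {c : ZMod m} (ht : t • c = 0) (k : ℕ) : (k % t) • c = k • c := by
  conv_rhs => rw [← Nat.div_add_mod k t, add_smul, mul_comm, mul_smul, ht, smul_zero, zero_add]

theorem firstReturn_stripStep {m t L : ℕ} {a b : ZMod m} {h : ℕ → ℕ} (ht : t • (a - b) = 0)
    (ht0 : 0 < t) (hlt : ∀ j < t, h j < t)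
    (H : FirstReturn (box t L) (place b (a - b)) b (rowStep L h)) :
    FirstReturn (box t L) (place a (a - b)) b (stripStep t L h) := by
  have hmod : ∀ k, k % t < t := fun k => Nat.mod_lt k ht0
  have hplace : ∀ x : ℕ × ℕ, place b (a - b) ((x.1 + x.2) % t, x.2) = place a (a - b) x := by
    intro x
    simp only [place, nsmul_mod ht, add_smul, smul_sub]
    abel
  have hmem : ∀ x ∈ box t L, ((x.1 + x.2) % t, x.2) ∈ box t L := fun x hx => ⟨hmod _, hx.2⟩
  rintro ⟨j, i⟩ hx
  obtain ⟨-, k, h1, h2⟩ := H _ (hmem _ hx)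
  have hstep : rowStep L h ((j + i) % t, i) =
      (((stripStep t L h (j, i)).1 + (stripStep t L h (j, i)).2) % t,
        (stripStep t L h (j, i)).2) := by
    simp only [rowStep, stripStep]
    split_ifs with hi
    · ext
      · simp only
        rw [Nat.mod_add_mod, show j + (t - 1) + (i + 1) = j + i + t by omega, Nat.add_mod_right]
      · rfl
    · ext
      · have : i = L - 1 := by have := hx.2; simp only at this; omega
        subst this
        simp only [add_zero]
        rw [Nat.mod_eq_of_lt (hlt _ (hmod _))]
      · rfl
  refine ⟨?_, k, ?_, fun s hs => ?_⟩
  · unfold stripStep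
    split_ifs with hi
    · exact ⟨hmod _, hi⟩
    · exact ⟨hlt _ (hmod _), by have := hx.2; simp only at this ⊢; omega⟩
  · rw [← hplace, ← hstep, h1, ← hplace (j, i)]
  · rintro ⟨y, hy, hys⟩
    exact h2 s hs ⟨_, hmem y hy, by rw [hplace, hys, ← hplace (j, i)]⟩

/-- Windows for the case that `a - b` has small order. -/
theorem good_of_allGluings_strip {m t L d : ℕ} [NeZero m] {a b : ZMod m} (ha : addOrderOf a = m)
    (F : Cosets b (a - b) d) (hd : d ≤ t) (hL : 0 < L) (ht0 : 0 < t) (ht : t • (a - b) = 0)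
    (hc : ∀ y : ℤ, |y| < t → y • (a - b) = 0 → y = 0)
    (hm : ∀ x : ℤ, |x| < L → (m : ℤ) ∣ t * x → x = 0) (pats : List (List ℕ × List ℕ))
    (hp : (allGluings t 1 fun h => allGluings t d fun h' => pats.any fun K =>
      checkCuts (t * L) (rowCode L h) (stripCode t L h') K.1 K.2 &&
        (List.range t).all fun j => !listCut L K.1 (j, L - 1) && !listCut L K.2 (j, L - 1)) =
      true) : Good a b := by
  have hrel : ∀ x y : ℤ, |x| < L → x • a = y • (a - b) → x = 0 := fun x y hx hxy => by
    refine hm x hx ?_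
    rw [← ha, addOrderOf_dvd_iff_zsmul_eq_zero, mul_smul, hxy, smul_comm, natCast_zsmul, ht,
      smul_zero]
  have hinj : Set.InjOn (place a (a - b)) (box t L) := injOn_place fun x y hx hy hxy => by
    obtain rfl := hrel x y hx hxy
    exact ⟨rfl, hc y hy (by rw [← hxy, zero_smul])⟩
  have hinj' : Set.InjOn (place b (a - b)) (box t L) := injOn_place fun x y hx hy hxy => by
    obtain rfl := hrel x (x + y) hx (by rw [add_smul, ← hxy, smul_sub]; abel)
    exact ⟨rfl, hc y hy (by rw [← hxy, zero_smul])⟩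
  have F1 : Cosets a (a - b) 1 := ⟨fun x y _ => by simp, fun z => by
    obtain ⟨s, hs⟩ := exists_nsmul_eq ha z
    exact ⟨0, one_pos, s, by simp [hs]⟩⟩
  obtain ⟨h, hh, G⟩ := F1.exists_rowStep hL hinj
  obtain ⟨g, hg, G'⟩ := F.exists_rowStep hL hinj'
  obtain ⟨h', h1, hp⟩ := G.exists_of_allGluings hp
  obtain ⟨g', h2, hp⟩ := G'.exists_of_allGluings hp
  obtain ⟨K, -, hK⟩ := List.any_eq_true.1 hp
  simp only [Bool.and_eq_true, List.all_eq_true, List.mem_range, Bool.not_eq_true'] at hK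
  obtain ⟨hK, hin⟩ := hK
  obtain ⟨half, H⟩ := CutSystem.of_checkStrip hL hK
  have H := H.congr (σ := rowStep L h) (τ := stripStep t L g)
    (fun x hx => by simp only [rowStep]; rw [h1 x.1 hx.1])
    (fun x hx => by simp only [stripStep]; rw [h2 _ (Nat.mod_lt _ ht0)])
  have hlast : ∀ x ∈ box t L, listCut L K.1 x = true ∨ listCut L K.2 x = true → x.2 + 1 < L := by
    rintro ⟨j, i⟩ ⟨hj, hi⟩ hx
    by_contra hlt
    obtain rfl : i = L - 1 := by simp only at hi hlt; omega
    simp [hin j hj] at hx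
  refine H.good (box_finite t L) hinj hh (firstReturn_stripStep ht ht0 G'.lt hg) (fun z => ?_)
    (fun z => ?_) (fun x hx hcut => ?_) (fun x hx hcut => ?_)
  · obtain ⟨s, hs⟩ := exists_nsmul_eq ha z
    exact ⟨(0, 0), ⟨ht0, hL⟩, s, by simp [place, hs]⟩
  · obtain ⟨j, hj, k, hk⟩ := F.hit z
    obtain ⟨s, hs⟩ := exists_nat_smul_eq b k
    exact ⟨(j, 0), ⟨by simp only; omega, hL⟩, s, by rw [hk, hs]; simp [place]⟩
  · rw [rowStep, if_pos (hlast x hx (Or.inl hcut))]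
    simp only [place]; rw [succ_nsmul]; abel
  · rw [stripStep, if_pos (hlast x hx (Or.inr hcut))]
    simp only [place]
    have hlast : (t - 1) • (a - b) + (a - b) = 0 := by
      rw [← succ_nsmul, show t - 1 + 1 = t by omega, ht]
    rw [nsmul_mod ht, succ_nsmul, add_smul x.1, eq_neg_of_add_eq_zero_left hlast]
    abel

theorem good_of_strip_two {m : ℕ} [NeZero m] {a b : ZMod m} (ha : addOrderOf a = m)
    (F : Cosets b (a - b) 1) (hm : 5 ≤ m) (h2 : 2 • (a - b) = 0) (h1 : a - b ≠ 0) : Good a b := by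
  refine good_of_allGluings_strip (L := 3) ha F one_le_two (by omega) (by omega) h2
    (fun y hy hy0 => ?_) (fun x hx hx0 => ?_) [([1, 4], [1, 4])] (by decide +kernel)
  · rw [abs_lt] at hy
    obtain rfl | rfl | rfl : y = 0 ∨ y = 1 ∨ y = -1 := by omega
    · rfl
    · exact absurd (by simpa using hy0) h1
    · exact absurd (by simpa [-neg_sub, neg_eq_zero] using hy0) h1
  · rw [abs_lt] at hx
    have := Int.eq_zero_of_abs_lt_dvd hx0 (by rw [abs_lt]; push_cast; omega)
    push_cast at this
    omega

theorem good_of_strip_three {m d : ℕ} [NeZero m] {a b : ZMod m} (ha : addOrderOf a = m)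
    (F : Cosets b (a - b) d) (hd : d = 1 ∨ d = 3) (hm : 10 ≤ m) (h3 : 3 • (a - b) = 0)
    (h1 : a - b ≠ 0) : Good a b := by
  refine good_of_allGluings_strip (t := 3) (L := 4) ha F (by omega) (by omega) (by omega) h3
    (fun y hy hy0 => ?_) (fun x hx hx0 => ?_)
    [([1, 4, 6, 8, 10], [2, 4, 8, 9, 10]), ([2, 6, 10], [2, 6, 10]),
      ([0, 2, 5, 8, 10], [0, 1, 2, 6, 8])]
    (by rcases hd with rfl | rfl <;> decide +kernel)
  · rw [abs_lt] at hy
    by_contra hne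
    refine h1 ?_
    have h3' : (3 : ℤ) • (a - b) = 0 := by exact_mod_cast h3
    obtain rfl | rfl | rfl | rfl : y = 1 ∨ y = -1 ∨ y = 2 ∨ y = -2 := by omega
    · simpa using hy0
    · rw [← neg_eq_zero]; simpa [-neg_sub] using hy0
    all_goals simp only [zsmul_eq_mul, Int.cast_neg, Int.cast_ofNat] at h3' hy0
    · linear_combination h3' - hy0
    · linear_combination h3' + hy0
  · rw [abs_lt] at hx
    have := Int.eq_zero_of_abs_lt_dvd hx0 (by rw [abs_lt]; push_cast; omega)
    push_cast at this
    omega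

theorem Frame.cosets_sub {m d e : ℕ} {a b : ZMod m} (F : Frame a b d e) : Cosets b (a - b) e :=
  ⟨fun x y h => (F.dvd y (x + y) (by rw [add_smul, h, smul_sub]; abel)).1, fun z => by
    obtain ⟨i, hi, t, h⟩ := F.hitB z
    exact ⟨i, hi, t + i, by rw [h, add_smul, smul_sub, natCast_zsmul]; abel⟩⟩

theorem good_of_frame_one_two {m : ℕ} [NeZero m] {a b : ZMod m} (F : Frame a b 1 2) (hb : b ≠ 0) :
    Good a b := by
  refine good_of_allGluings (R := 2) (C := 2) F (by omega) (by omega)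
    (injOn_place fun x y hx hy hxy => ?_) [squares 2 [(0, 0)]] (by decide +kernel)
  obtain rfl := Int.eq_zero_of_abs_lt_dvd (F.dvd x y hxy).1 hx
  refine ⟨rfl, ?_⟩
  rw [zero_smul] at hxy
  push_cast at hy
  rw [abs_lt] at hy
  obtain rfl | rfl | rfl : y = 0 ∨ y = 1 ∨ y = -1 := by omega
  · rfl
  · exact absurd (by simpa using hxy.symm) hb
  · exact absurd (by simpa using hxy.symm) hb

theorem good_of_three_smul_eq {m d y : ℕ} [NeZero m] {a b : ZMod m} (F : Frame a b d 3)
    (hd : d < 3) (hb : ∀ y : ℤ, |y| < 4 → y • b = 0 → y = 0) (hy : y < 4) (h : 3 • a = y • b) :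
    Good a b := by
  have hbn : ∀ n : ℕ, n < 4 → n • b = 0 → n = 0 := fun n hn h => by
    have := hb n (by rw [Nat.abs_cast]; exact_mod_cast hn) (by rwa [natCast_zsmul])
    exact_mod_cast this
  have hd0 := F.d_pos
  have hm0 := NeZero.pos m
  have h3m : 3 ∣ m := by
    have := (F.dvd m 0 (by simp)).1
    exact_mod_cast this
  have hm : 4 ≤ m := by
    by_contra hlt
    have := hbn m (by omega) (by simp)
    omega
  interval_cases y
  · obtain ⟨t, ht⟩ := F.exists_smul_eq
    obtain ⟨s, rfl⟩ := (F.dvd t d ht.symm).1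
    have := hbn d (by omega) (by
      rw [← natCast_zsmul, ht, mul_comm, mul_smul]
      simp only [Nat.cast_ofNat, ofNat_zsmul]
      rw [h, zero_smul, smul_zero])
    omega
  · rw [one_smul] at h
    have hc := F.addOrderOf_eq (c := a) (x := 1) (y := 3) (one_smul _ _).symm
      (by rw [← h]; norm_cast)
    simpa [h] using good_one_three hc (by omega)
  · have h1 : a = 2 • (b - a) := by rw [smul_sub, ← h]; abel
    have h2 : b = 3 • (b - a) := by rw [smul_sub, h]; abel
    have hc := F.addOrderOf_eq (c := b - a) (x := 2) (y := 3) (by exact_mod_cast h1)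
      (by exact_mod_cast h2)
    have hm6 : m ≠ 6 := by
      rintro rfl
      have := hbn 2 (by omega) (by
        rw [h2, smul_smul]
        exact addOrderOf_dvd_iff_nsmul_eq_zero.1 hc.dvd)
      omega
    have := good_two_three hc (by omega)
    rwa [← h1, ← h2] at this
  · have h3 : 3 • (a - b) = 0 := by rw [smul_sub, h, sub_self]
    obtain rfl : d = 1 := by
      have := (F.dvd 3 3 (by exact_mod_cast h)).2
      have : d ∣ 3 := by exact_mod_cast this
      obtain rfl | rfl : d = 1 ∨ d = 2 := by omega
      · rfl
      · omega
    obtain ⟨t, ht⟩ := F.exists_smul_eq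
    rw [Nat.cast_one, one_smul] at ht
    have ha := F.addOrderOf_eq (c := a) (x := 1) (y := t) (one_smul _ _).symm ht
    obtain ⟨s, rfl⟩ := (F.dvd t 1 (by rw [ht, one_smul])).1
    obtain ⟨k, rfl⟩ := h3m
    have hk : 4 ≤ k := by
      by_contra hlt
      have := hbn k (by omega) (by
        have h0 : (3 * k) • a = 0 := addOrderOf_dvd_iff_nsmul_eq_zero.1 ha.dvd
        rw [ht, ← natCast_zsmul, smul_smul,
          show (k : ℤ) * ((3 : ℕ) * s) = s * ((3 * k : ℕ) : ℤ) by push_cast; ring, mul_smul,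
          natCast_zsmul, h0, smul_zero])
      omega
    refine good_of_strip_three ha F.cosets_sub (Or.inr rfl) (by omega) h3 fun h0 => ?_
    have := (F.dvd 1 1 (by simpa [sub_eq_zero] using h0)).1
    omega

theorem good_of_frame_three {m d : ℕ} [NeZero m] {a b : ZMod m} (F : Frame a b d 3)
    (hd : d < 3) (hb : ∀ y : ℤ, |y| < 4 → y • b = 0 → y = 0) : Good a b := by
  by_cases hrel : ∃ y : ℤ, |y| < 4 ∧ (3 : ℤ) • a = y • b
  · obtain ⟨y, hy, h⟩ := hrel
    rw [abs_lt] at hy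
    rcases le_total 0 y with h0 | h0
    · lift y to ℕ using h0
      exact good_of_three_smul_eq F hd hb (y := y) (by omega) (by exact_mod_cast h)
    · obtain ⟨n, rfl⟩ := Int.exists_eq_neg_ofNat h0
      refine (good_of_three_smul_eq F.neg_right hd (fun y hy h => hb y hy ?_) (y := n) (by omega) ?_
        ).of_neg_right
      · rwa [smul_neg, neg_eq_zero] at h
      · rw [neg_smul, ← smul_neg] at h
        exact_mod_cast h
  · push Not at hrel
    have key : d ≤ 4 → d = 1 ∨ d = 2 := by have := F.d_pos; omega
    refine good_of_allGluings (R := 4) (C := 4) F (by omega) (by omega)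
      (injOn_place fun x y hx hy hxy => ?_)
      [squares 4 [(0, 2), (2, 0), (2, 2)], squares 4 [(0, 0), (2, 0), (2, 2)]]
      (by rcases key (by omega) with rfl | rfl <;> decide +kernel)
    push_cast at hx hy
    rw [abs_lt] at hx
    have h3 := (F.dvd x y hxy).1
    obtain rfl | rfl | rfl : x = 0 ∨ x = 3 ∨ x = -3 := by push_cast at h3; omega
    · exact ⟨rfl, hb y hy (by rw [← hxy, zero_smul])⟩
    · exact absurd hxy (hrel y hy)
    · refine absurd ?_ (hrel (-y) (by rwa [abs_neg]))
      rw [neg_smul, ← hxy, neg_smul, neg_neg]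

theorem Frame.addOrderOf_left {m e : ℕ} [NeZero m] {a b : ZMod m} (F : Frame a b 1 e) :
    addOrderOf a = m := by
  obtain ⟨t, ht⟩ := F.exists_smul_eq
  exact F.addOrderOf_eq (x := 1) (one_smul _ _).symm (by simpa using ht)

theorem good_of_smul_eq_smul_of_le {m x y : ℕ} [NeZero m] {a b : ZMod m} (F : Frame a b 1 1)
    (hm : 3 ≤ m) (H : m % 6 = 5 → a ≠ 2 • b) (hxy : x ≤ y) (hy : y < 4) (hy0 : 0 < y)
    (hc : 10 ≤ m ∨ x = 1 ∧ (y = 3 → 6 ≤ m)) (h : x • a = y • b) : Good a b := by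
  have ha := F.addOrderOf_left
  have hb := F.symm.addOrderOf_left
  have hne : ∀ y, 0 < y → y < m → y • b ≠ 0 := fun y h0 hy h => by
    have := Nat.le_of_dvd h0 (addOrderOf_dvd_iff_nsmul_eq_zero.2 h)
    omega
  obtain rfl | rfl | rfl | rfl : x = 0 ∨ x = 1 ∨ x = 2 ∨ x = 3 := by omega
  · exact absurd (by rw [← h, zero_smul]) (hne y hy0 (by omega))
  · rw [one_smul] at h
    obtain rfl | rfl | rfl : y = 1 ∨ y = 2 ∨ y = 3 := by omega
    · simpa [h] using good_one_one hb (by omega)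
    · have hm6 : m % 6 ≠ 5 := fun h5 => H h5 h
      have hm2 : m % 2 ≠ 0 := fun h2 => by
        have h0 : (m / 2) • a = 0 := by
          rw [h, smul_smul, show m / 2 * 2 = m by omega]
          exact addOrderOf_dvd_iff_nsmul_eq_zero.1 hb.dvd
        have := Nat.le_of_dvd (by omega) (addOrderOf_dvd_iff_nsmul_eq_zero.2 h0)
        omega
      simpa [h] using (good_one_two hb hm (by omega)).symm
    · simpa [h] using (good_one_three hb (by omega)).symm
  · obtain rfl | rfl : y = 2 ∨ y = 3 := by omega
    · rcases eq_or_ne a b with rfl | hab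
      · simpa using good_one_one ha (by omega)
      · exact good_of_strip_two ha F.cosets_sub (by omega) (by rw [smul_sub, h, sub_self])
          (sub_ne_zero.2 hab)
    · have h1 : b = 2 • (a - b) := by rw [smul_sub, h]; abel
      have h2 : a = 3 • (a - b) := by rw [smul_sub, ← h]; abel
      have hc := F.addOrderOf_eq (c := a - b) (x := 3) (y := 2) (by exact_mod_cast h2)
        (by exact_mod_cast h1)
      have := (good_two_three hc (by omega)).symm
      rwa [← h1, ← h2] at this
  · obtain rfl : y = 3 := by omega
    rcases eq_or_ne a b with rfl | hab
    · simpa using good_one_one ha (by omega)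
    · exact good_of_strip_three ha F.cosets_sub (Or.inl rfl) (by omega)
        (by rw [smul_sub, h, sub_self]) (sub_ne_zero.2 hab)

theorem good_of_smul_eq_smul {m x y : ℕ} [NeZero m] {a b : ZMod m} (F : Frame a b 1 1)
    (hm : 3 ≤ m)
    (H : m % 6 = 5 → (a ≠ 2 • b ∧ a ≠ -(2 • b)) ∧ b ≠ 2 • a ∧ b ≠ -(2 • a))
    (hx : x < 4) (hy : y < 4) (h0 : 0 < max x y)
    (hc : 10 ≤ m ∨ min x y = 1 ∧ (max x y = 3 → 6 ≤ m)) (h : x • a = y • b ∨ x • a = -(y • b)) :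
    Good a b := by
  rcases le_total x y with hxy | hxy
  · rw [max_eq_right hxy, min_eq_left hxy] at *
    rcases h with h | h
    · exact good_of_smul_eq_smul_of_le F hm (fun h5 => (H h5).1.1) hxy hy h0 hc h
    · refine (good_of_smul_eq_smul_of_le F.neg_right hm (fun h5 => ?_) hxy hy h0 hc
        (by rw [h, smul_neg])).of_neg_right
      rw [smul_neg]
      exact (H h5).1.2
  · rw [max_eq_left hxy, min_eq_right hxy] at *
    rcases h with h | h
    · exact (good_of_smul_eq_smul_of_le F.symm hm (fun h5 => (H h5).2.1) hxy hx h0 hc h.symm).symm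
    · refine (good_of_smul_eq_smul_of_le F.symm.neg_right hm (fun h5 => ?_) hxy hx h0 hc
        (by rw [smul_neg, h, neg_neg])).of_neg_right.symm
      rw [smul_neg]
      exact (H h5).2.2

theorem good_of_injOn_place {m : ℕ} [NeZero m] {a b : ZMod m} (F : Frame a b 1 1)
    (hinj : ∀ x y : ℤ, |x| < 4 → |y| < 5 → x • a = y • b → x = 0 ∧ y = 0) : Good a b :=
  good_of_allGluings (R := 5) (C := 4) F (by omega) (by omega) (injOn_place hinj)
    [squares 4 [(1, 2), (2, 0), (3, 2)], squares 4 [(0, 0), (0, 2), (3, 1)],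
      squares 4 [(1, 0), (3, 0), (3, 2)], squares 4 [(1, 0), (1, 2), (3, 0)],
      squares 4 [(0, 2), (1, 0), (3, 0), (3, 2)], squares 4 [(0, 0), (1, 2), (3, 0), (3, 2)]]
    (by decide +kernel)

theorem injOn_place_or {m : ℕ} {a b : ZMod m}
    (H : ∀ x y : ℕ, x < 4 → y < 4 → 0 < max x y → x • a ≠ y • b ∧ x • a ≠ -(y • b)) :
    (∀ x y : ℤ, |x| < 4 → |y| < 5 → x • a = y • b → x = 0 ∧ y = 0) ∨
      ∃ t : ℕ, t < 4 ∧ (4 • b = t • a ∨ 4 • b = -(t • a)) := by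
  by_contra! hcon
  obtain ⟨⟨x, y, hx, hy, h, hne⟩, hcon⟩ := hcon
  rw [abs_lt] at hx hy
  have key : ∃ p q : ℕ, p < 4 ∧ q < 5 ∧ (p ≠ 0 ∨ q ≠ 0) ∧ (p • a = q • b ∨ p • a = -(q • b)) := by
    refine ⟨x.natAbs, y.natAbs, by omega, by omega, by omega, ?_⟩
    simp only [← natCast_zsmul]
    rcases abs_choice x with h1 | h1 <;> rcases abs_choice y with h2 | h2 <;>
      simp [h1, h2, h, -zsmul_eq_mul]
  obtain ⟨p, q, hp, hq, hpq, h⟩ := key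
  rcases Nat.lt_or_ge q 4 with h4 | h4
  · have := H p q hp h4 (by omega)
    tauto
  · obtain rfl : q = 4 := by omega
    have := hcon p hp
    rcases h with h | h
    · exact this.1 h.symm
    · exact this.2 (by rw [h, neg_neg])

set_option synthInstance.maxSize 1000 in
theorem exists_small_relation : ∀ m < 10, 3 ≤ m → ∀ k < m, k.Coprime m → ∃ x < 4, ∃ y < 4,
    min x y = 1 ∧ (max x y = 3 → 6 ≤ m) ∧ (x % m = y * k % m ∨ (x + y * k) % m = 0) := by
  decide +kernel

set_option synthInstance.maxSize 4000 in
set_option synthInstance.maxHeartbeats 400000 in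
theorem small_relation_or_sporadic : ∀ m < 26, 10 ≤ m → ∀ k < m, k.Coprime m →
    (∃ t < 4, 4 * k % m = t % m ∨ (4 * k + t) % m = 0) →
    (∃ t < 4, t * k % m = 4 % m ∨ (4 + t * k) % m = 0) →
    (∃ x < 4, ∃ y < 4, 0 < max x y ∧ (x % m = y * k % m ∨ (x + y * k) % m = 0)) ∨
    (m = 25 ∧ (7 % m = k % m ∨ (7 + k) % m = 0)) ∨
    ((m = 15 ∨ m = 17 ∨ m = 19) ∧ (4 % m = k % m ∨ (4 + k) % m = 0)) ∨
    (m = 19 ∧ (1 % m = 4 * k % m ∨ (1 + 4 * k) % m = 0)) := by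
  decide +kernel

theorem nsmul_eq_or_neg_iff {m : ℕ} [NeZero m] {a : ZMod m} (ha : addOrderOf a = m) (x z : ℕ) :
    x • a = z • a ∨ x • a = -(z • a) ↔ x % m = z % m ∨ (x + z) % m = 0 := by
  refine or_congr (nsmul_eq_iff_mod ha x z) ?_
  rw [eq_neg_iff_add_eq_zero, ← add_smul, ← addOrderOf_dvd_iff_nsmul_eq_zero, ha,
    Nat.dvd_iff_mod_eq_zero]

theorem lt_twentySix {m t t' : ℕ} {a b : ZMod m} (hb : addOrderOf b = m) (ht : t < 4)
    (ht' : t' < 4) (h : 4 • b = t • a ∨ 4 • b = -(t • a))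
    (h' : 4 • a = t' • b ∨ 4 • a = -(t' • b)) : m < 26 := by
  have key : ∀ {t : ℕ} {a b : ZMod m}, t < 4 → (4 • b = t • a ∨ 4 • b = -(t • a)) →
      ∃ s : ℤ, |s| ≤ 3 ∧ (4 : ℤ) • b = s • a := by
    rintro t a b ht (h | h)
    · exact ⟨t, by rw [abs_le]; omega, by exact_mod_cast h⟩
    · exact ⟨-t, by rw [abs_le]; omega, by rw [neg_smul]; exact_mod_cast h⟩
  obtain ⟨s, hs, h⟩ := key ht h
  obtain ⟨s', hs', h'⟩ := key ht' h'
  have h0 : (16 - s * s') • b = 0 := by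
    rw [sub_smul, mul_smul, ← h', smul_comm, ← h, smul_smul]
    norm_num
  rw [← addOrderOf_dvd_iff_zsmul_eq_zero, hb] at h0
  have hss : |s * s'| ≤ 9 := by
    rw [abs_mul]
    nlinarith [abs_nonneg s, abs_nonneg s']
  rw [abs_le] at hss
  have := Int.le_of_dvd (by omega) h0
  omega

/-- The case that `a` and `b` both generate. -/
theorem good_of_frame_one_one {m : ℕ} [NeZero m] {a b : ZMod m} (F : Frame a b 1 1) (hm : 3 ≤ m)
    (H : m % 6 = 5 → (a ≠ 2 • b ∧ a ≠ -(2 • b)) ∧ b ≠ 2 • a ∧ b ≠ -(2 • a)) : Good a b := by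
  have ha := F.addOrderOf_left
  have hb := F.symm.addOrderOf_left
  obtain ⟨k, hk, hbk⟩ := exists_nsmul_eq ha b
  have hiff : ∀ x y : ℕ, (x • a = y • b ∨ x • a = -(y • b)) ↔
      (x % m = y * k % m ∨ (x + y * k) % m = 0) := fun x y => by
    rw [hbk, smul_smul, nsmul_eq_or_neg_iff ha]
  have hcop : k.Coprime m := by
    have h1 := addOrderOf_nsmul a (n := k)
    rw [← hbk, ha, hb] at h1
    rcases Nat.div_eq_self.1 h1.symm with h | h
    · omega
    · exact Nat.Coprime.symm h
  rcases Nat.lt_or_ge m 10 with h10 | h10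
  · obtain ⟨x, hx, y, hy, h1, h2, h3⟩ := exists_small_relation m h10 hm k hk hcop
    exact good_of_smul_eq_smul F hm H hx hy (by omega) (Or.inr ⟨h1, h2⟩) ((hiff x y).2 h3)
  by_cases hrel : ∃ x y : ℕ, x < 4 ∧ y < 4 ∧ 0 < max x y ∧ (x • a = y • b ∨ x • a = -(y • b))
  · obtain ⟨x, y, hx, hy, h0, h⟩ := hrel
    exact good_of_smul_eq_smul F hm H hx hy h0 (Or.inl h10) h
  push Not at hrel
  rcases injOn_place_or hrel with h | ⟨t, ht, h1⟩
  · exact good_of_injOn_place F h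
  rcases injOn_place_or (a := b) (b := a) (fun x y hx hy h0 =>
      ⟨(hrel y x hy hx (by omega)).1.symm, fun h => (hrel y x hy hx (by omega)).2
        (by rw [h, neg_neg])⟩) with h | ⟨t', ht', h2⟩
  · exact (good_of_injOn_place F.symm h).symm
  have hm26 : m < 26 := lt_twentySix hb ht ht' h1 h2
  rw [hbk, smul_smul, nsmul_eq_or_neg_iff ha] at h1
  rw [hiff] at h2
  rcases small_relation_or_sporadic m hm26 h10 k hk hcop ⟨t, ht, h1⟩ ⟨t', ht', by tauto⟩ with
    ⟨x, hx, y, hy, h0, h⟩ | ⟨rfl, h⟩ | ⟨hm', h⟩ | ⟨rfl, h⟩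
  · have := hrel x y hx hy h0
    rw [← hiff] at h
    tauto
  · rw [← nsmul_eq_or_neg_iff ha, ← hbk] at h
    have := good_one_seven_twentyfive ha
    rw [one_smul] at this
    rcases h with h | h
    · rwa [h] at this
    · rw [h] at this; exact this.of_neg_right
  · rw [← nsmul_eq_or_neg_iff ha, ← hbk] at h
    have : Good (1 • a) (4 • a) := by
      rcases hm' with rfl | rfl | rfl
      · exact good_one_four_fifteen ha
      · exact good_one_four_seventeen ha
      · exact good_one_four_nineteen ha
    rw [one_smul] at this
    rcases h with h | h
    · rwa [h] at this
    · rw [h] at this; exact this.of_neg_right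
  · rw [← hiff, one_smul] at h
    have := (good_one_four_nineteen hb).symm
    rw [one_smul] at this
    rcases h with h | h
    · rwa [← h] at this
    · rw [← neg_eq_iff_eq_neg] at h
      rw [← h] at this
      exact this.of_neg_left

theorem igraph_neg_right (m : ℕ) (a b : ZMod m) : Igraph m a (-b) = Igraph m a b := by
  rw [Igraph, Igraph, neg_neg, Set.pair_comm b]

/-- Exchanging the two copies of `ZMod m`. -/
def igraphSwap (m : ℕ) (a b : ZMod m) : Igraph m a b ≃g Igraph m b a where
  toEquiv := Equiv.sumComm _ _
  map_rel_iff' := by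
    rintro (i | i) (j | j) <;> simp [Igraph, bicirculant, SimpleGraph.fromRel_adj, eq_comm]

/-- Scaling by a unit. -/
def igraphScale {m : ℕ} (u : (ZMod m)ˣ) (a b : ZMod m) :
    Igraph m a b ≃g Igraph m (u * a) (u * b) where
  toEquiv := Equiv.sumCongr u.mulLeft u.mulLeft
  map_rel_iff' := by
    rintro (i | i) (j | j) <;>
      simp [Igraph, bicirculant, SimpleGraph.fromRel_adj, ← mul_neg, ← mul_add]

theorem nonempty_iso_one_two {m : ℕ} [NeZero m] {a : ZMod m} (ha : addOrderOf a = m) :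
    Nonempty (Igraph m a (2 • a) ≃g Igraph m 1 2) := by
  obtain ⟨r, -, hr⟩ := exists_nsmul_eq ha 1
  have hu : IsUnit a := IsUnit.of_mul_eq_one (r : ZMod m) (by rw [mul_comm, ← nsmul_eq_mul, hr])
  obtain ⟨u, rfl⟩ := hu
  have := igraphScale u 1 2
  rw [mul_one, mul_two, ← two_smul ℕ] at this
  exact ⟨this.symm⟩

theorem good_of_frame {m : ℕ} [NeZero m] {a b : ZMod m} {d e : ℕ} (hm : 3 ≤ m)
    (F : Frame a b d e) (hde : d ≤ e) (hb : b ≠ 0) (hb2 : 2 * b ≠ 0)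
    (hexc : ¬ (m % 6 = 5 ∧ Nonempty (Igraph m a b ≃g Igraph m 1 2))) : Good a b := by
  rcases Nat.lt_or_ge d 4 with hd | hd
  swap
  · exact good_of_four_le_of_four_le F hd (by omega)
  have hb3 : ∀ y : ℤ, |y| < 3 → y • b = 0 → y = 0 := by
    intro y hy h
    rw [abs_lt] at hy
    obtain rfl | rfl | rfl | rfl | rfl : y = -2 ∨ y = -1 ∨ y = 0 ∨ y = 1 ∨ y = 2 := by omega
    all_goals simp_all
  have hb4 : 3 • b ≠ 0 → ∀ y : ℤ, |y| < 4 → y • b = 0 → y = 0 := by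
    intro h3 y hy h
    by_cases hlt : |y| < 3
    · exact hb3 y hlt h
    · rcases eq_or_eq_neg_of_abs_eq (show |y| = 3 by omega) with rfl | rfl
      · exact absurd (by exact_mod_cast h) h3
      · refine absurd ?_ h3
        rw [neg_smul, neg_eq_zero] at h
        exact_mod_cast h
  have hd0 := F.d_pos
  have he0 := F.e_pos
  rcases eq_or_ne e 1 with rfl | he1
  · obtain rfl : d = 1 := by omega
    refine good_of_frame_one_one F hm fun h5 => ?_
    have H : Nonempty (Igraph m a b ≃g Igraph m 1 2) → False := fun h => hexc ⟨h5, h⟩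
    have ha1 := nonempty_iso_one_two F.addOrderOf_left
    have hb1 := nonempty_iso_one_two F.symm.addOrderOf_left
    refine ⟨⟨fun h => H ?_, fun h => H ?_⟩, fun h => H ?_, fun h => H ?_⟩
    · rw [← h] at hb1
      exact hb1.map (igraphSwap m a b).trans
    · rw [← igraph_neg_right, ← h] at hb1
      exact hb1.map (igraphSwap m a b).trans
    · rwa [← h] at ha1
    · rwa [← igraph_neg_right, ← h] at ha1
  have hne : d ≠ e := by
    rintro rfl
    exact he1 ((Nat.coprime_self d).1 F.coprime)
  rcases eq_or_ne e 2 with rfl | he2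
  · obtain rfl : d = 1 := by omega
    exact good_of_frame_one_two F hb
  by_cases h3 : 3 • b = 0
  · rcases Nat.mod_two_eq_zero_or_one e with he | he
    · exact good_of_three_smul_eq_zero_of_even F (by omega) he h3 hb3
    · exact good_of_three_smul_eq_zero_of_odd F (by omega) he h3 hb3
  · rcases eq_or_ne e 3 with rfl | he3
    · exact good_of_frame_three F (by omega) (hb4 h3)
    · exact good_of_four_le F hd (by omega) (hb4 h3)

/-- Every connected I-graph is hamiltonian, except possibly if `m ≡ 5 (mod 6)` and
the graph is isomorphic to the generalized Petersen graph `G(m,2) = I(m;1,2)`. -/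
theorem Igraph_isHamiltonian (m : ℕ) [NeZero m] (hm : 3 ≤ m) (a b : ZMod m)
    (ha : a ≠ 0) (hb : b ≠ 0) (ha2 : 2 * a ≠ 0) (hb2 : 2 * b ≠ 0)
    (hconn : (Igraph m a b).Connected)
    (hexc : ¬ (m % 6 = 5 ∧ Nonempty (Igraph m a b ≃g Igraph m 1 2))) :
    (Igraph m a b).IsHamiltonian := by
  obtain ⟨d, e, F⟩ := frame_of_connected hconn
  refine Good.isHamiltonian ha hb ha2 hb2 ?_
  rcases le_total d e with h | h
  · exact good_of_frame hm F h hb hb2 hexc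
  · exact (good_of_frame hm F.symm h ha ha2 fun ⟨h5, hiso⟩ =>
      hexc ⟨h5, hiso.map (igraphSwap m a b).trans⟩).symm
end

section
/- Let m ≥ 5 be an integer with m ≡ 5 (mod 6). Then the generalized Petersen graph G(m,2) = I(m;1,2) is not Hamiltonian. -/
open SimpleGraph

/-- The generalized Petersen graph `G(m,2)` has edges of three kinds: outer edges `u_i u_{i+1}`,
spokes `u_i v_i` and inner edges `v_i v_{i+2}`. The predicates `o`, `s`, `t` select edges of each
kind, and this structure says that the selected edges form a connected spanning `2`-regular
subgraph. Sets of vertices are given by their traces `A` and `B` on the two copies of `ZMod m`. -/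
structure IsSpanningCycle (m : ℕ) (o s t : ZMod m → Prop) : Prop where
  outer : ∀ i, (o i ∧ o (i + 1) ∧ ¬ s (i + 1)) ∨ (o i ∧ ¬ o (i + 1) ∧ s (i + 1)) ∨
    (¬ o i ∧ o (i + 1) ∧ s (i + 1))
  inner : ∀ i, (t (i - 1) ∧ t (i + 1) ∧ ¬ s (i + 1)) ∨ (t (i - 1) ∧ ¬ t (i + 1) ∧ s (i + 1)) ∨
    (¬ t (i - 1) ∧ t (i + 1) ∧ s (i + 1))
  connected : ∀ A B : ZMod m → Prop, (∀ i, o i → (A i ↔ A (i + 1))) → (∀ i, s i → (A i ↔ B i)) →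
    (∀ i, t i → (B i ↔ B (i + 2))) → (∃ i, A i ∨ B i) → ∀ i, A i ∧ B i

lemma ncard_two_of_subset_triple {α : Type*} {N : Set α} {a b c : α} (hab : a ≠ b) (hac : a ≠ c)
    (hbc : b ≠ c) (hN : N ⊆ {a, b, c}) (h : N.ncard = 2) :
    (a ∈ N ∧ b ∈ N ∧ c ∉ N) ∨ (a ∈ N ∧ b ∉ N ∧ c ∈ N) ∨ (a ∉ N ∧ b ∈ N ∧ c ∈ N) := by
  obtain ⟨x, y, hxy, rfl⟩ := Set.ncard_eq_two.1 h
  have hx := hN (show x ∈ ({x, y} : Set α) by simp)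
  have hy := hN (show y ∈ ({x, y} : Set α) by simp)
  simp only [Set.mem_insert_iff, Set.mem_singleton_iff] at *
  grind

lemma Igraph_adj_inl {m : ℕ} {a b i : ZMod m} {y : ZMod m ⊕ ZMod m}
    (h : (Igraph m a b).Adj (Sum.inl i) y) :
    y = Sum.inl (i - a) ∨ y = Sum.inl (i + a) ∨ y = Sum.inr i := by
  rcases y with j | j <;> simp [Igraph, bicirculant] at h ⊢ <;> grind

lemma Igraph_adj_inr {m : ℕ} {a b i : ZMod m} {y : ZMod m ⊕ ZMod m}
    (h : (Igraph m a b).Adj (Sum.inr i) y) :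
    y = Sum.inr (i - b) ∨ y = Sum.inr (i + b) ∨ y = Sum.inl i := by
  rcases y with j | j <;> simp [Igraph, bicirculant] at h ⊢ <;> grind

lemma SimpleGraph.Walk.mem_iff_of_forall_adj_toSubgraph {V : Type*} {G : SimpleGraph V} {a b : V}
    (p : G.Walk a b) (W : Set V) (hW : ∀ x y, p.toSubgraph.Adj x y → (x ∈ W ↔ y ∈ W)) {x : V}
    (hx : x ∈ p.support) : x ∈ W ↔ a ∈ W := by
  induction p with
  | nil => simp_all
  | cons h q ih =>
    rename_i u v w
    have huv := hW u v (by simp)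
    rcases List.mem_cons.1 (Walk.support_cons h q ▸ hx) with rfl | hx
    · rfl
    · exact (ih (fun x y hxy => hW x y (by simp [hxy])) hx).trans huv.symm

lemma ZMod.natCast_ne_zero_of_lt {m n : ℕ} (h0 : 0 < n) (hn : n < m) : (n : ZMod m) ≠ 0 := by
  rw [Ne, ZMod.natCast_eq_zero_iff]
  exact fun h => absurd (Nat.le_of_dvd h0 h) (by omega)

lemma exists_isSpanningCycle {m : ℕ} [NeZero m] (hm : 5 ≤ m)
    (h : (Igraph m 1 2).IsHamiltonian) : ∃ o s t : ZMod m → Prop, IsSpanningCycle m o s t := by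
  obtain ⟨a, p, hp⟩ := h (by simp [ZMod.card]; omega)
  have two_ne : (2 : ZMod m) ≠ 0 := by
    exact_mod_cast ZMod.natCast_ne_zero_of_lt (m := m) (n := 2) (by omega) (by omega)
  have four_ne : (4 : ZMod m) ≠ 0 := by
    exact_mod_cast ZMod.natCast_ne_zero_of_lt (m := m) (n := 4) (by omega) (by omega)
  have deg (x) := hp.isCycle.ncard_neighborSet_toSubgraph_eq_two (hp.mem_support x)
  refine ⟨fun i => p.toSubgraph.Adj (Sum.inl i) (Sum.inl (i + 1)),
    fun i => p.toSubgraph.Adj (Sum.inl i) (Sum.inr i),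
    fun i => p.toSubgraph.Adj (Sum.inr i) (Sum.inr (i + 2)), ?_, ?_, ?_⟩
  · intro i
    have := ncard_two_of_subset_triple (N := p.toSubgraph.neighborSet (Sum.inl (i + 1)))
      (a := Sum.inl i) (b := Sum.inl (i + 1 + 1)) (c := Sum.inr (i + 1))
      (fun hc => two_ne (by linear_combination -Sum.inl.inj hc)) (by simp)
      (by simp) (fun y hy => by simpa using Igraph_adj_inl (p.toSubgraph.adj_sub hy)) (deg _)
    simpa only [Subgraph.mem_neighborSet, p.toSubgraph.adj_comm _ (Sum.inl i)] using this
  · intro i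
    have := ncard_two_of_subset_triple (N := p.toSubgraph.neighborSet (Sum.inr (i + 1)))
      (a := Sum.inr (i - 1)) (b := Sum.inr (i + 1 + 2)) (c := Sum.inl (i + 1))
      (fun hc => four_ne (by linear_combination -Sum.inr.inj hc)) (by simp)
      (by simp) (fun y hy => by
        have := Igraph_adj_inr (p.toSubgraph.adj_sub hy)
        rwa [show i + 1 - 2 = i - 1 by ring] at this) (deg _)
    rw [show i - 1 + 2 = i + 1 by ring]
    simpa only [Subgraph.mem_neighborSet, p.toSubgraph.adj_comm (Sum.inr (i + 1)) (Sum.inr (i - 1)),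
      p.toSubgraph.adj_comm (Sum.inr (i + 1)) (Sum.inl (i + 1))] using this
  · rintro A B ho hs ht ⟨i₀, hi₀⟩ i
    have closed (x y : ZMod m ⊕ ZMod m) (hxy : p.toSubgraph.Adj x y) :
        x ∈ {z | Sum.elim A B z} ↔ y ∈ {z | Sum.elim A B z} := by
      rcases x with j | j
      · rcases Igraph_adj_inl (p.toSubgraph.adj_sub hxy) with rfl | rfl | rfl
        · simpa using (ho (j - 1) (by simpa using hxy.symm)).symm
        · simpa using ho j hxy
        · simpa using hs j hxy
      · rcases Igraph_adj_inr (p.toSubgraph.adj_sub hxy) with rfl | rfl | rfl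
        · simpa using (ht (j - 2) (by simpa using hxy.symm)).symm
        · simpa using ht j hxy
        · simpa using (hs j hxy.symm).symm
    have key (x) := p.mem_iff_of_forall_adj_toSubgraph _ closed (hp.mem_support x)
    have h1 := key (Sum.inl i₀)
    have h2 := key (Sum.inr i₀)
    have h3 := key (Sum.inl i)
    have h4 := key (Sum.inr i)
    simp only [Set.mem_ofPred_eq, Sum.elim_inl, Sum.elim_inr] at h1 h2 h3 h4
    tauto

lemma ZMod.forall_of_add_one {m : ℕ} [NeZero m] {P : ZMod m → Prop} {i₀ : ZMod m} (h₀ : P i₀)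
    (h : ∀ i, P i → P (i + 1)) (i : ZMod m) : P i := by
  have key (n : ℕ) : P (i₀ + n) := by
    induction n with
    | zero => simpa
    | succ n ih => simpa [add_assoc] using h _ ih
  simpa using key (i - i₀).val

lemma ZMod.sum_add_one {m : ℕ} [NeZero m] (f : ZMod m → ℕ) : ∑ i, f (i + 1) = ∑ i, f i :=
  Equiv.sum_comp (Equiv.addRight 1) f

namespace IsSpanningCycle

variable {m : ℕ} {o s t : ZMod m → Prop}

/-- The cut between positions `i` and `i + 1` is crossed by the edges `u_i u_{i+1}`,
`v_{i-1} v_{i+1}` and `v_i v_{i+2}`. At most one such cut contains no selected edge. -/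
lemma empty_cut_unique [NeZero m] (h : IsSpanningCycle m o s t) {i j : ZMod m}
    (hi : ¬ o i ∧ ¬ t (i - 1) ∧ ¬ t i) (hj : ¬ o j ∧ ¬ t (j - 1) ∧ ¬ t j) : i = j := by
  by_contra hij
  have hLm := ZMod.val_lt (j - i)
  have hL0 : 0 < (j - i).val := by
    rw [Nat.pos_iff_ne_zero, Ne, ZMod.val_eq_zero]
    grind
  have hL : ((j - i).val : ZMod m) = j - i := by simp
  generalize (j - i).val = L at *
  have := h.connected (fun k => ∃ n : ℕ, 1 ≤ n ∧ n ≤ L ∧ k = i + n)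
    (fun k => ∃ n : ℕ, 1 ≤ n ∧ n ≤ L ∧ k = i + n) ?_ (by simp) ?_
    ⟨i + 1, Or.inl ⟨1, le_rfl, hL0, by simp⟩⟩ i
  · obtain ⟨⟨n, h1, h2, h3⟩, -⟩ := this
    exact ZMod.natCast_ne_zero_of_lt (m := m) (n := n) (by omega) (by omega) (by grind)
  · refine fun k hk => ⟨?_, ?_⟩
    · rintro ⟨n, h1, h2, rfl⟩
      have : n ≠ L := by rintro rfl; grind
      exact ⟨n + 1, by omega, by omega, by push_cast; ring⟩
    · rintro ⟨n, h1, h2, h3⟩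
      have : n ≠ 1 := by rintro rfl; grind
      exact ⟨n - 1, by omega, by omega, by rw [Nat.cast_sub h1]; grind⟩
  · refine fun k hk => ⟨?_, ?_⟩
    · rintro ⟨n, h1, h2, rfl⟩
      have : n ≠ L := by rintro rfl; grind
      have : n + 1 ≠ L := by
        rintro rfl
        push_cast at hL
        grind
      exact ⟨n + 2, by omega, by omega, by push_cast; ring⟩
    · rintro ⟨n, h1, h2, h3⟩
      have : n ≠ 1 := by
        rintro rfl
        push_cast at h3
        grind
      have : n ≠ 2 := by
        rintro rfl
        push_cast at h3
        grind
      exact ⟨n - 2, by omega, by omega, by rw [Nat.cast_sub (by omega)]; push_cast; grind⟩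

/-- The number of selected edges crossing a cut has constant parity. -/
lemma parity_cut (h : IsSpanningCycle m o s t) (i : ZMod m) :
    (o i ↔ (t (i - 1) ↔ t i)) ↔ (o (i + 1) ↔ (t (i + 1 - 1) ↔ t (i + 1))) := by
  have := h.outer i
  have := h.inner i
  rw [add_sub_cancel_right]
  tauto

open Classical in
lemma mod_three_of_even_cut [NeZero m] (h : IsSpanningCycle m o s t)
    (he : ∀ i, ¬ (o i ↔ (t (i - 1) ↔ t i))) : m % 3 ≠ 2 := by
  let p (i : ZMod m) : ℕ := if ¬ o i ∧ t (i - 1) ∧ t i then 1 else 0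
  let q (i : ZMod m) : ℕ := if o i ∧ t (i - 1) ∧ ¬ t i then 1 else 0
  let r (i : ZMod m) : ℕ := if o i ∧ ¬ t (i - 1) ∧ t i then 1 else 0
  let e (i : ZMod m) : ℕ := if ¬ o i ∧ ¬ t (i - 1) ∧ ¬ t i then 1 else 0
  have total : ∑ i, (p i + q i + r i + e i) = m := by
    rw [Finset.sum_congr rfl (g := fun _ => 1)]
    · simp [ZMod.card]
    · intro i _
      have := he i
      by_cases o i <;> by_cases t i <;> by_cases t (i - 1) <;> simp_all [p, q, r, e]
  have hq : ∑ i, q i = ∑ i, p i := by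
    rw [← ZMod.sum_add_one q]
    refine Finset.sum_congr rfl fun i _ => ?_
    have := h.outer i
    have := h.inner i
    have := he i
    simp only [p, q, add_sub_cancel_right]
    grind
  have hr : ∑ i, r i = ∑ i, p i := by
    rw [← ZMod.sum_add_one p]
    refine Finset.sum_congr rfl fun i _ => ?_
    have := h.outer i
    have := h.inner i
    have := he i
    simp only [p, r, add_sub_cancel_right]
    grind
  have hE : ∑ i, e i ≤ 1 := by
    simp only [e, Finset.sum_boole, Nat.cast_id, Finset.card_le_one, Finset.mem_filter]
    exact fun i hi j hj => h.empty_cut_unique hi.2 hj.2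
  simp only [Finset.sum_add_distrib] at total
  omega

/-- If all cuts strictly between positions `e - 1` and `e + L` are full and the cuts at both ends
are crossed by one inner edge only, the selected edges contain a closed cycle between these
positions when `L` is even. -/
lemma not_even_of_full_cuts (h : IsSpanningCycle m o s t) {e : ZMod m} {L : ℕ} (hLm : L + 1 < m)
    (he : ¬ o (e - 1) ∧ ¬ t (e - 2)) (hL : ¬ o (e + L) ∧ ¬ t (e + L))
    (hfull : ∀ j < L, o (e + j) ∧ t (e + j)) : ¬ Even L := by
  intro hLe
  have := h.connected (fun k => ∃ n : ℕ, n ≤ L ∧ k = e + n)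
    (fun k => ∃ n : ℕ, n ≤ L ∧ Even n ∧ k = e + n) ?_ ?_ ?_ ⟨e, Or.inl ⟨0, by simp⟩⟩ (e - 1)
  · obtain ⟨⟨n, h1, h2⟩, -⟩ := this
    refine ZMod.natCast_ne_zero_of_lt (m := m) (n := n + 1) (by omega) (by omega) ?_
    push_cast
    grind
  · refine fun k hk => ⟨?_, ?_⟩
    · rintro ⟨n, h1, rfl⟩
      have : n ≠ L := by rintro rfl; grind
      exact ⟨n + 1, by omega, by push_cast; ring⟩
    · rintro ⟨n, h1, h2⟩
      have : n ≠ 0 := by rintro rfl; push_cast at h2; grind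
      exact ⟨n - 1, by omega, by rw [Nat.cast_sub (by omega)]; grind⟩
  · refine fun k hk => ⟨?_, fun ⟨n, h1, _, h2⟩ => ⟨n, h1, h2⟩⟩
    rintro ⟨n, h1, rfl⟩
    refine ⟨n, h1, ?_, rfl⟩
    by_cases hn0 : n = 0
    · simp [hn0]
    by_cases hnL : n = L
    · rwa [hnL]
    have h3 := hfull n (by omega)
    have h4 := hfull (n - 1) (by omega)
    have h5 := h.outer (e + (n - 1 : ℕ))
    rw [show e + ((n - 1 : ℕ) : ZMod m) + 1 = e + n by
      rw [Nat.cast_sub (by omega)]; push_cast; ring] at h5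
    tauto
  · refine fun k hk => ⟨?_, ?_⟩
    · rintro ⟨n, h1, h2, rfl⟩
      have : n ≠ L := by rintro rfl; grind
      exact ⟨n + 2, by grind, by grind, by push_cast; ring⟩
    · rintro ⟨n, h1, h2, h3⟩
      have : n ≠ 0 := by rintro rfl; push_cast at h3; grind
      exact ⟨n - 2, by omega, by grind, by rw [Nat.cast_sub (by grind)]; push_cast; grind⟩

lemma exists_spoke (h : IsSpanningCycle m o s t) : ∃ i, s i := by
  by_contra! hs
  simpa using h.connected (fun _ => True) (fun _ => False) (by simp) (by simpa) (by simp)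
    ⟨0, by simp⟩ 0

/-- The cut before position `i` is crossed by one inner edge, ending at `v_{i+1}`. Then both
`u_i` and `v_i` lie on the spoke. -/
def LastCut (o t : ZMod m → Prop) (i : ZMod m) : Prop :=
  ¬ o (i - 1) ∧ ¬ t (i - 2) ∧ t (i - 1)

lemma lastCut_add_one_iff (o t : ZMod m → Prop) (i : ZMod m) :
    LastCut o t (i + 1) ↔ ¬ o i ∧ ¬ t (i - 1) ∧ t i := by
  rw [LastCut, add_sub_cancel_right, show i + 1 - 2 = i - 1 by ring]

lemma exists_lastCut (h : IsSpanningCycle m o s t)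
    (hodd : ∀ i, o i ↔ (t (i - 1) ↔ t i)) : ∃ i, LastCut o t i := by
  by_contra! hc
  replace hc (i : ZMod m) := (lastCut_add_one_iff o t i).not.1 (hc _)
  have h2 (i : ZMod m) : ¬ (o i ∧ ¬ t (i - 1) ∧ ¬ t i) := by
    have := h.outer i
    have := h.inner i
    have := hc (i + 1)
    rw [add_sub_cancel_right] at this
    tauto
  have h1 (i : ZMod m) : ¬ (¬ o i ∧ t (i - 1) ∧ ¬ t i) := by
    have := h.outer i
    have := h.inner i
    have := h2 (i + 1)
    rw [add_sub_cancel_right] at this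
    tauto
  have hall (i : ZMod m) : o i ∧ t (i - 1) ∧ t i := by
    have := hodd i
    have := hc i
    have := h2 i
    have := h1 i
    tauto
  obtain ⟨i, hi⟩ := h.exists_spoke
  have h3 := h.outer (i - 1)
  have h4 := hall (i - 1)
  have h5 := hall i
  rw [sub_add_cancel] at h3
  tauto

lemma lastCut_add_three (h : IsSpanningCycle m o s t) {k : ZMod m} (h1 : ¬ o k) (h2 : ¬ t k)
    (h3 : t (k - 1)) : LastCut o t (k + 3) := by
  have h4 := h.outer k
  have h5 := h.inner k
  have h6 := h.outer (k + 1)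
  have h7 := h.inner (k + 1)
  rw [show k + 3 = k + 1 + 1 + 1 by ring, lastCut_add_one_iff]
  rw [add_sub_cancel_right] at *
  tauto

lemma LastCut.of_add_three (h : IsSpanningCycle m o s t) {k : ZMod m}
    (hk : LastCut o t (k + 3)) : ¬ o k ∧ ¬ t k ∧ o (k + 1) ∧ ¬ t (k + 1) := by
  have h4 := h.outer k
  have h5 := h.inner k
  have h6 := h.outer (k + 1)
  have h7 := h.inner (k + 1)
  rw [show k + 3 = k + 1 + 1 + 1 by ring, lastCut_add_one_iff] at hk
  rw [add_sub_cancel_right] at *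
  tauto

/-- The distance between consecutive positions satisfying `LastCut` is even. -/
lemma odd_of_lastCut_add_one (h : IsSpanningCycle m o s t) (hodd : ∀ i, o i ↔ (t (i - 1) ↔ t i))
    {i : ZMod m} {d : ℕ} (hdm : d < m) (hd : LastCut o t (i - d))
    (hmin : ∀ n < d, ¬ LastCut o t (i - n)) (hi : LastCut o t (i + 1)) : Odd d := by
  obtain ⟨k, rfl⟩ : ∃ k, i = k + 2 := ⟨i - 2, by ring⟩
  rw [add_assoc, show (2 : ZMod m) + 1 = 3 by norm_num] at hi
  obtain ⟨h1, h2, h3, h4⟩ := LastCut.of_add_three h hi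
  have d0 : d ≠ 0 := by
    rintro rfl
    rw [Nat.cast_zero, sub_zero] at hd
    exact hd.1 (by rwa [show k + 2 - 1 = k + 1 by ring])
  have d1 : d ≠ 1 := by
    rintro rfl
    rw [Nat.cast_one] at hd
    exact h2 (by simpa [show k + 2 - 1 - 1 = k by ring] using hd.2.2)
  obtain ⟨L, rfl⟩ : ∃ L, d = L + 2 := ⟨d - 2, by omega⟩
  rw [show k + 2 - ((L + 2 : ℕ) : ZMod m) = k - L by push_cast; ring] at hd
  have hfull (j : ℕ) (hj : j < L) : o (k - L + j) ∧ t (k - L + j) := by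
    induction j with
    | zero =>
      have h5 := h.outer (k - L - 1)
      have h6 := h.inner (k - L - 1)
      rw [show k - L - 1 - 1 = k - (L : ZMod m) - 2 by ring] at h6
      rw [sub_add_cancel] at h5 h6
      rw [LastCut] at hd
      rw [Nat.cast_zero, add_zero]
      tauto
    | succ j ih =>
      have h5 := ih (by omega)
      have h6 := hodd (k - L + (j + 1 : ℕ))
      have h7 := h.lastCut_add_three (k := k - L + (j + 1 : ℕ))
      have h8 := hmin (L - (j + 2)) (by omega)
      rw [show k + 2 - ((L - (j + 2) : ℕ) : ZMod m) = k - L + (j + 1 : ℕ) + 3 by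
        rw [Nat.cast_sub (by omega)]; push_cast; ring] at h8
      rw [show k - L + ((j + 1 : ℕ) : ZMod m) - 1 = k - L + j by push_cast; ring] at h6 h7
      tauto
  have := h.not_even_of_full_cuts (L := L) (by omega) ⟨hd.1, hd.2.1⟩
    (by rw [sub_add_cancel]; exact ⟨h1, h2⟩) hfull
  grind

lemma even_of_odd_cut [NeZero m] (h : IsSpanningCycle m o s t)
    (hodd : ∀ i, o i ↔ (t (i - 1) ↔ t i)) : Even m := by
  classical
  obtain ⟨e₀, he₀⟩ := h.exists_lastCut hodd
  have hex (i : ZMod m) : ∃ d : ℕ, LastCut o t (i - d) := ⟨(i - e₀).val, by simpa⟩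
  let d (i : ZMod m) : ℕ := Nat.find (hex i)
  have alternate (i : ZMod m) : (d (i + 1) + d i) % 2 = 1 := by
    have hd : LastCut o t (i - d i) := Nat.find_spec (hex i)
    have hmin {n : ℕ} (hn : n < d i) : ¬ LastCut o t (i - n) := Nat.find_min (hex i) hn
    by_cases hi : LastCut o t (i + 1)
    · have hz : d (i + 1) = 0 := by
        rw [Nat.find_eq_zero]
        simpa
      have hdm : d i < m := by
        by_contra! hle
        have := NeZero.pos m
        refine hmin (n := d i - m) (by omega) ?_
        rwa [Nat.cast_sub hle, ZMod.natCast_self, sub_zero]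
      have := h.odd_of_lastCut_add_one hodd hdm hd (fun n => hmin) hi
      rw [Nat.odd_iff] at this
      omega
    · have hz : d (i + 1) = d i + 1 := by
        rw [Nat.find_eq_iff]
        refine ⟨by push_cast; rwa [add_sub_add_right_eq_sub], fun n hn => ?_⟩
        rcases n with _ | n
        · simpa
        · push_cast
          rw [add_sub_add_right_eq_sub]
          exact hmin (by omega)
      omega
  have hn (n : ℕ) : d n % 2 = (d 0 + n) % 2 := by
    induction n with
    | zero => simp
    | succ n ih =>
      have := alternate n
      push_cast
      omega
  have := hn m
  rw [ZMod.natCast_self] at this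
  rw [Nat.even_iff]
  omega

end IsSpanningCycle

/-- The generalized Petersen graph `G(m,2) = I(m;1,2)` with `m ≡ 5 (mod 6)`
is not hamiltonian. -/
theorem petersen_two_not_hamiltonian (m : ℕ) [NeZero m] (hm : 5 ≤ m) (hmod : m % 6 = 5) :
    ¬ (Igraph m 1 2).IsHamiltonian := by
  intro hG
  obtain ⟨o, s, t, h⟩ := exists_isSpanningCycle hm hG
  by_cases hp : o 0 ↔ (t (0 - 1) ↔ t 0)
  · have := h.even_of_odd_cut (ZMod.forall_of_add_one hp fun i => (h.parity_cut i).1)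
    rw [Nat.even_iff] at this
    omega
  · have := h.mod_three_of_even_cut
      (ZMod.forall_of_add_one hp fun i => (not_congr (h.parity_cut i)).1)
    omega
end
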